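/- Under the capillary-gravity stratified water-wave hypotheses, if the Bernoulli function β and the streamline density ρ both belong to the Gevrey class G^s([p₀,0]) for some s ≥ 1, then the pseudo-stream function ψ is smooth on Ω̄ and belongs to G^s(Ω̄); that is, there exists a constant C ≥ 1 such that sup_{Ω̄} |∂_x^{α₁}∂_y^{α₂} ψ| ≤ C^{|α|+1}(|α|!)^s for every multi-index α = (α₁,α₂) ∈ ℕ². In particular, if s = 1 (β and ρ real analytic on [p₀,0]), then ψ is real analytic on Ω̄. -/

import Mathlib

open Set

noncomputable section

/-- The mixed partial derivative `∂_x^a ∂_y^b f` of `f : ℝ² → ℝ` within the set `S`,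
realized as the iterated Fréchet derivative within `S` applied to the corresponding
coordinate directions. -/
def mpw (S : Set (ℝ × ℝ)) (a b : ℕ) (f : ℝ × ℝ → ℝ) (z : ℝ × ℝ) : ℝ :=
  iteratedFDerivWithin ℝ (a + b) f S z
    (fun i => if (i : ℕ) < a then ((1 : ℝ), (0 : ℝ)) else ((0 : ℝ), (1 : ℝ)))

/-- Euclidean distance on `ℝ²`. -/
def edist2 (z z' : ℝ × ℝ) : ℝ := Real.sqrt ((z.1 - z'.1) ^ 2 + (z.2 - z'.2) ^ 2)

/-- Gevrey regularity on `[p₀, 0]` of index `s`. -/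
def GevreyOnIcc (s p₀ : ℝ) (f : ℝ → ℝ) : Prop :=
  ContDiffOn ℝ (⊤ : ℕ∞) f (Set.Icc p₀ 0) ∧
  ∃ M : ℝ, 1 ≤ M ∧ ∀ k : ℕ, ∀ p ∈ Set.Icc p₀ 0,
    |iteratedDerivWithin k f (Set.Icc p₀ 0) p| ≤ M ^ (k + 1) * (Nat.factorial k : ℝ) ^ s

/-- Gevrey regularity of index `s` of a function of two variables on a set `S`:
smoothness together with bounds `sup_S |∂^α f| ≤ C^{|α|+1}(|α|!)^s`. -/
def GevreyOn2 (s : ℝ) (S : Set (ℝ × ℝ)) (f : ℝ × ℝ → ℝ) : Prop :=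
  ContDiffOn ℝ (⊤ : ℕ∞) f S ∧
  ∃ C : ℝ, 1 ≤ C ∧ ∀ a b : ℕ, ∀ z ∈ S,
    |mpw S a b f z| ≤ C ^ (a + b + 1) * (Nat.factorial (a + b) : ℝ) ^ s

end

set_option linter.all false

section
variable {a b c : ℝ}
theorem mll (h : b ≤ c) (k : 0 ≤ a) : a * b ≤ a * c := mul_le_mul_of_nonneg_left h k
theorem mlr (h : b ≤ c) (k : 0 ≤ a) : b * a ≤ c * a := mul_le_mul_of_nonneg_right h k
end

section
open Set
noncomputable section

structure Ops (ι F : Type*) [CommRing F] [Algebra ℝ F] where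
  δ : ι → F →ₗ[ℝ] F
  T : ι → F →ₐ[ℝ] F
  leib : ∀ i f g, δ i (f * g) = f * δ i g + δ i f * T i g
  comm : ∀ i j f, δ i (T j f) = T j (δ i f)

def cv (x y : ℕ → ℝ) (k : ℕ) : ℝ :=
  ∑ ij ∈ Finset.HasAntidiagonal.antidiagonal k, (k.choose ij.1 : ℝ) * (x ij.1 * y ij.2)

def sh (x : ℕ → ℝ) : ℕ → ℝ := fun k => x (k + 1)

/-- zero out index 0 -/
def z0 (x : ℕ → ℝ) : ℕ → ℝ := fun k => if k = 0 then 0 else x k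

lemma cv_succ (x y : ℕ → ℝ) (k : ℕ) : cv x y (k + 1) = cv x (sh y) k + cv (sh x) y k := by
  unfold cv sh
  have := Finset.sum_antidiagonal_choose_succ_mul (fun i j => x i * y j) k
  rw [this]
  congr 1
  refine Finset.sum_congr rfl fun ij h => ?_
  have h : ij.1 + ij.2 = k := by simpa using h
  rw [← h, Nat.choose_symm_add]

lemma cv_zero (x y : ℕ → ℝ) : cv x y 0 = x 0 * y 0 := by simp [cv]

lemma cv_mono {x y x' y' : ℕ → ℝ} (k : ℕ) (hx0 : ∀ i, i ≤ k → 0 ≤ x i) (hy0 : ∀ i, i ≤ k → 0 ≤ y i)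
    (hx : ∀ i, i ≤ k → x i ≤ x' i) (hy : ∀ i, i ≤ k → y i ≤ y' i) : cv x y k ≤ cv x' y' k := by
  unfold cv
  apply Finset.sum_le_sum
  rintro ⟨i, j⟩ hij
  have hij : i + j = k := by simpa using hij
  have h1 := hx0 i (by omega)
  have h2 := hy0 j (by omega)
  have h3 := hx i (by omega)
  have h4 := hy j (by omega)
  have : x i * y j ≤ x' i * y' j := mul_le_mul h3 h4 h2 (h1.trans h3)
  exact mll this (by positivity)

/-- sum with the edge in the second index split off -/
lemma cv_edge_right (x y : ℕ → ℝ) (k : ℕ) : cv x y k = cv x (z0 y) k + x k * y 0 := by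
  unfold cv
  have h : ∀ ij ∈ Finset.HasAntidiagonal.antidiagonal k, (k.choose ij.1 : ℝ) * (x ij.1 * y ij.2)
      = (k.choose ij.1 : ℝ) * (x ij.1 * z0 y ij.2) + (if ij = (k, 0) then x k * y 0 else 0) := by
    rintro ⟨i, j⟩ hij
    have hij : i + j = k := by simpa using hij
    by_cases hj : j = 0
    · subst hj
      have : i = k := by omega
      subst this
      simp [z0]
    · simp [z0, hj]
  rw [Finset.sum_congr rfl h, Finset.sum_add_distrib]
  simp

lemma cv_edge_left (x y : ℕ → ℝ) (k : ℕ) : cv x y k = cv (z0 x) y k + x 0 * y k := by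
  unfold cv
  have h : ∀ ij ∈ Finset.HasAntidiagonal.antidiagonal k, (k.choose ij.1 : ℝ) * (x ij.1 * y ij.2)
      = (k.choose ij.1 : ℝ) * (z0 x ij.1 * y ij.2) + (if ij = (0, k) then x 0 * y k else 0) := by
    rintro ⟨i, j⟩ hij
    have hij : i + j = k := by simpa using hij
    by_cases hj : i = 0
    · subst hj
      have : j = k := by omega
      subst this
      simp [z0]
    · simp [z0, hj]
  rw [Finset.sum_congr rfl h, Finset.sum_add_distrib]
  simp

namespace Ops
variable {ι F : Type*} [CommRing F] [Algebra ℝ F] (O : Ops ι F)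

def D : List ι → F →ₗ[ℝ] F
  | [] => LinearMap.id
  | i :: l => (D l) ∘ₗ O.δ i

def Tl : List ι → F →ₐ[ℝ] F
  | [] => AlgHom.id ℝ F
  | i :: l => (Tl l).comp (O.T i)

@[simp] lemma D_nil (f : F) : O.D [] f = f := rfl
@[simp] lemma D_cons (i : ι) (l : List ι) (f : F) : O.D (i :: l) f = O.D l (O.δ i f) := rfl
@[simp] lemma Tl_nil (f : F) : O.Tl [] f = f := rfl
@[simp] lemma Tl_cons (i : ι) (l : List ι) (f : F) : O.Tl (i :: l) f = O.Tl l (O.T i f) := rfl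

lemma D_T (l : List ι) (j : ι) (f : F) : O.D l (O.T j f) = O.T j (O.D l f) := by
  induction l generalizing f with
  | nil => rfl
  | cons i l ih => simp [O.comm, ih]

lemma D_append (l l' : List ι) (f : F) : O.D (l ++ l') f = O.D l' (O.D l f) := by
  induction l generalizing f with
  | nil => rfl
  | cons i l ih => simp [ih]

variable {O}

lemma conv_bound {n1 n2 n3 : F → ℝ} (h3 : ∀ f g, n3 (f + g) ≤ n3 f + n3 g)
    (h12 : ∀ f g, n3 (f * g) ≤ n1 f * n2 g) (hn1 : ∀ f, 0 ≤ n1 f)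
    (hn2 : ∀ f, 0 ≤ n2 f) (hT : ∀ i g, n2 (O.T i g) = n2 g)
    (l : List ι) (f g : F) (x y : ℕ → ℝ)
    (hx : ∀ l', List.Sublist l' l → n1 (O.D l' f) ≤ x l'.length)
    (hy : ∀ l', List.Sublist l' l → n2 (O.D l' g) ≤ y l'.length) :
    n3 (O.D l (f * g)) ≤ cv x y l.length := by
  induction l generalizing f g x y with
  | nil =>
    have h1 := hx [] (List.Sublist.refl _)
    have h2 := hy [] (List.Sublist.refl _)
    simp only [D_nil, List.length_nil, cv_zero] at *
    exact (h12 f g).trans (mul_le_mul h1 h2 (hn2 _) ((hn1 _).trans h1))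
  | cons i l ih =>
    rw [D_cons, O.leib, map_add, List.length_cons, cv_succ]
    refine (h3 _ _).trans (add_le_add ?_ ?_)
    · refine ih f _ x (sh y) (fun l' h => hx l' (h.cons i)) (fun l' h => ?_)
      exact hy (i :: l') (h.cons_cons i)
    · refine ih _ _ (sh x) y (fun l' h => hx (i :: l') (h.cons_cons i)) (fun l' h => ?_)
      rw [O.D_T, hT]
      exact hy l' (h.cons i)

lemma mid_bound {n1 n2 n3 : F → ℝ} (h3 : ∀ f g, n3 (f + g) ≤ n3 f + n3 g) (h30 : n3 0 ≤ 0)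
    (h12 : ∀ f g, n3 (f * g) ≤ n1 f * n2 g) (hn1 : ∀ f, 0 ≤ n1 f)
    (hn2 : ∀ f, 0 ≤ n2 f) (hT : ∀ i g, n2 (O.T i g) = n2 g)
    (l : List ι) (hl : 1 ≤ l.length) (f g : F) (x y : ℕ → ℝ)
    (hx : ∀ l' : List ι, 1 ≤ l'.length → l'.length < l.length → n1 (O.D l' f) ≤ x l'.length)
    (hy : ∀ l' : List ι, 1 ≤ l'.length → l'.length < l.length → n2 (O.D l' g) ≤ y l'.length) :
    n3 (O.D l (f * g) - f * O.D l g - O.D l f * O.Tl l g) ≤ cv (z0 x) (z0 y) l.length := by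
  have hTl : ∀ l : List ι, ∀ g, n2 (O.Tl l g) = n2 g := by
    intro l
    induction l with
    | nil => intro g; rfl
    | cons i l ih => intro g; simp [ih, hT]
  induction l generalizing f g x y with
  | nil => simp at hl
  | cons i l ih =>
    rcases l with _ | ⟨j, l⟩
    · simp [O.leib, cv_succ, cv_zero, z0, h30]
    · set m := j :: l with hm
      have hm1 : 1 ≤ m.length := by simp [hm]
      have e : O.D (i :: m) (f * g) - f * O.D (i :: m) g - O.D (i :: m) f * O.Tl (i :: m) g
        = ((O.D m (f * O.δ i g) - f * O.D m (O.δ i g) - O.D m f * O.Tl m (O.δ i g))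
            + O.D m f * O.Tl m (O.δ i g))
          + ((O.D m (O.δ i f * O.T i g) - O.δ i f * O.D m (O.T i g)
              - O.D m (O.δ i f) * O.Tl m (O.T i g)) + O.δ i f * O.D m (O.T i g)) := by
        simp only [D_cons, Tl_cons, O.leib, map_add]; ring
      rw [e, List.length_cons, cv_succ, cv_edge_right (z0 x) (sh (z0 y)), cv_edge_left (sh (z0 x))]
      have ex : z0 (sh (z0 x)) = z0 (sh x) := by
        funext k; by_cases hk : k = 0 <;> simp [z0, sh, hk]
      have ey : z0 (sh (z0 y)) = z0 (sh y) := by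
        funext k; by_cases hk : k = 0 <;> simp [z0, sh, hk]
      rw [ex, ey]
      have hmlen : m.length ≠ 0 := by omega
      refine (h3 _ _).trans (add_le_add ((h3 _ _).trans (add_le_add ?_ ?_))
        ((h3 _ _).trans (add_le_add ?_ ?_)))
      · refine ih hm1 f _ x (sh y) (fun l' h h' => hx l' h (by simp; omega)) (fun l' h h' => ?_)
        exact hy (i :: l') (by simp) (by simp; omega)
      · have h1 := hx m hm1 (by simp)
        have h2 := hy [i] (by simp) (by simp; omega)
        simp only [D_cons, D_nil, List.length_cons, List.length_nil] at h2
        simp only [sh, z0, hmlen, if_false]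
        refine (h12 _ _).trans ?_
        rw [hTl]
        exact mul_le_mul h1 (by simpa using h2) (hn2 _) ((hn1 _).trans h1)
      · refine ih hm1 _ _ (sh x) y (fun l' h h' => hx (i :: l') (by simp) (by simp; omega))
          (fun l' h h' => ?_)
        rw [O.D_T, hT]
        exact hy l' h (by simp; omega)
      · have h1 := hx [i] (by simp) (by simp; omega)
        have h2 := hy m hm1 (by simp)
        simp only [D_cons, D_nil, List.length_cons, List.length_nil] at h1
        simp only [sh, z0, hmlen, if_false]
        refine (h12 _ _).trans ?_
        rw [O.D_T, hT]
        exact mul_le_mul (by simpa using h1) h2 (hn2 _) ((hn1 _).trans (by simpa using h1))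

end Ops

/-! weights -/

lemma sum_inv_sq (n : ℕ) :
    ∑ i ∈ Finset.range (n + 1), (1:ℝ) / ((i:ℝ) + 1) ^ 2 ≤ 2 - 1 / ((n:ℝ) + 1) := by
  induction n with
  | zero => simp; norm_num
  | succ n ih =>
    rw [Finset.sum_range_succ]
    have : (1:ℝ) / (((n + 1 : ℕ):ℝ) + 1) ^ 2 ≤ 1 / ((n:ℝ)+1) - 1 / (((n + 1 : ℕ):ℝ) + 1) := by
      push_cast
      rw [div_sub_div _ _ (by positivity) (by positivity), div_le_div_iff₀ (by positivity) (by positivity)]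
      ring_nf
      have : (0:ℝ) ≤ n := by positivity
      nlinarith
    linarith

lemma conv_inv_sq (k : ℕ) : ∑ ij ∈ Finset.HasAntidiagonal.antidiagonal k,
    (1:ℝ) / (((ij.1:ℝ) + 1) ^ 2 * ((ij.2:ℝ) + 1) ^ 2) ≤ 8 / ((k:ℝ) + 1) ^ 2 := by
  have h : ∀ ij ∈ Finset.HasAntidiagonal.antidiagonal k,
      (1:ℝ) / (((ij.1:ℝ) + 1) ^ 2 * ((ij.2:ℝ) + 1) ^ 2) ≤
      2 / ((k:ℝ) + 1) ^ 2 * (1 / ((ij.1:ℝ) + 1) ^ 2) + 2 / ((k:ℝ) + 1) ^ 2 * (1 / ((ij.2:ℝ) + 1) ^ 2) := by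
    rintro ⟨i, j⟩ hij
    have hij : i + j = k := by simpa using hij
    subst hij
    push_cast
    have hi : (0:ℝ) ≤ i := by positivity
    have hj : (0:ℝ) ≤ j := by positivity
    have : 2 / ((i:ℝ) + j + 1) ^ 2 * (1 / ((i:ℝ) + 1) ^ 2) + 2 / ((i:ℝ) + j + 1) ^ 2 * (1 / ((j:ℝ) + 1) ^ 2)
      = (2 * ((i:ℝ) + 1) ^ 2 + 2 * ((j:ℝ) + 1) ^ 2) / ((i:ℝ) + j + 1) ^ 2 *
        (1 / (((i:ℝ) + 1) ^ 2 * ((j:ℝ) + 1) ^ 2)) := by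
      field_simp; ring
    rw [this]
    refine le_mul_of_one_le_left (by positivity) ?_
    rw [le_div_iff₀ (by positivity)]
    nlinarith [sq_nonneg ((i:ℝ) - j)]
  refine (Finset.sum_le_sum h).trans ?_
  rw [Finset.sum_add_distrib, ← Finset.mul_sum, ← Finset.mul_sum,
    Finset.Nat.sum_antidiagonal_eq_sum_range_succ (fun i _ => (1:ℝ) / ((i:ℝ) + 1) ^ 2),
    ← Finset.Nat.sum_antidiagonal_swap]
  simp only [Prod.snd_swap]
  rw [Finset.Nat.sum_antidiagonal_eq_sum_range_succ (fun i _ => (1:ℝ) / ((i:ℝ) + 1) ^ 2)]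
  have h1 := sum_inv_sq k
  have h2 : (0:ℝ) ≤ 1 / ((k:ℝ) + 1) := by positivity
  have h3 : (0:ℝ) ≤ 2 / ((k:ℝ) + 1) ^ 2 := by positivity
  have := mll (h1.trans (sub_le_self _ h2)) h3
  have e : 8 / ((k:ℝ) + 1) ^ 2 = 2 / ((k:ℝ) + 1) ^ 2 * 2 + 2 / ((k:ℝ) + 1) ^ 2 * 2 := by ring
  rw [e]
  exact add_le_add this this

/-- Step 1 weights -/
def xw (r : ℝ) (k : ℕ) : ℝ := r ^ (k - 1) * (k.factorial : ℝ) / ((k:ℝ) + 1) ^ 2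

def ew (r : ℝ) (k : ℕ) : ℝ := if k ≤ 1 then 1 else r⁻¹

lemma xw_zero (r : ℝ) : xw r 0 = 1 := by simp [xw]
lemma xw_one (r : ℝ) : xw r 1 = 1 / 4 := by norm_num [xw]
lemma xw_pos {r : ℝ} (hr : 1 ≤ r) (k : ℕ) : 0 < xw r k := by unfold xw; positivity
lemma ew_pos {r : ℝ} (hr : 1 ≤ r) (k : ℕ) : 0 < ew r k := by
  unfold ew; split_ifs <;> positivity
lemma ew_le {r : ℝ} (hr : 1 ≤ r) (k : ℕ) : ew r k ≤ 1 := by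
  unfold ew; split_ifs
  · rfl
  · exact inv_le_one_of_one_le₀ hr

lemma xw_pred {r : ℝ} (hr : 1 ≤ r) (k : ℕ) : xw r k ≤ 4 * (ew r (k + 1) * xw r (k + 1)) := by
  rcases k with _ | k
  · norm_num [ew, xw]
  · simp only [ew, xw]
    rw [if_neg (by omega)]
    simp only [Nat.add_sub_cancel]
    have h0 : (0:ℝ) < r := by linarith
    rw [Nat.factorial_succ (k + 1)]
    push_cast
    rw [← mul_div_assoc, ← mul_div_assoc, div_le_div_iff₀ (by positivity) (by positivity)]
    have e : 4 * (r⁻¹ * (r ^ (k + 1) * (((k:ℝ) + 1 + 1) * ((k+1).factorial:ℝ)))) * ((k:ℝ) + 1 + 1) ^ 2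
       = r ^ k * ((k+1).factorial : ℝ) * (4 * ((k:ℝ) + 1 + 1) ^ 3) := by
      field_simp; ring
    rw [e]
    refine mll ?_ (by positivity)
    have : (0:ℝ) ≤ k := by positivity
    nlinarith [mul_nonneg this this, mul_nonneg (mul_nonneg this this) this]

lemma xw_pred' {r : ℝ} (hr : 1 ≤ r) (k : ℕ) : xw r k ≤ 4 * xw r (k + 1) := by
  have h1 := xw_pred hr k
  have h2 := mlr (ew_le hr (k + 1)) (xw_pos hr (k + 1)).le
  linarith

lemma cv_smul (c d : ℝ) (x y : ℕ → ℝ) (k : ℕ) :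
    cv (fun i => c * x i) (fun i => d * y i) k = c * d * cv x y k := by
  unfold cv
  rw [Finset.mul_sum]
  exact Finset.sum_congr rfl fun ij _ => by ring

lemma cv_mid_xw {r : ℝ} (hr : 1 ≤ r) (k : ℕ) :
    cv (z0 (xw r)) (z0 (xw r)) k ≤ 8 * (ew r k * xw r k) := by
  have h0 : (0:ℝ) < r := by linarith
  rcases Nat.lt_or_ge k 2 with hk | hk
  · have h1 := ew_pos hr k
    have h2 := xw_pos hr k
    have : cv (z0 (xw r)) (z0 (xw r)) k = 0 := by
      interval_cases k <;> simp [cv_succ, cv_zero, z0]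
    rw [this]; positivity
  · have e : ew r k = r⁻¹ := if_neg (by omega)
    rw [e]
    have h : ∀ ij ∈ Finset.HasAntidiagonal.antidiagonal k,
        (k.choose ij.1 : ℝ) * (z0 (xw r) ij.1 * z0 (xw r) ij.2) ≤
        r ^ (k - 2) * k.factorial * (1 / (((ij.1:ℝ) + 1) ^ 2 * ((ij.2:ℝ) + 1) ^ 2)) := by
      rintro ⟨i, j⟩ hij
      have hij : i + j = k := by simpa using hij
      subst hij
      by_cases hi : i = 0
      · simp only [z0, hi, if_true]; rw [zero_mul, mul_zero]; positivity
      by_cases hj : j = 0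
      · simp only [z0, hj, if_true]; rw [mul_zero, mul_zero]; positivity
      simp only [z0, hi, hj, if_false, xw]
      apply le_of_eq
      have e1 : r ^ (i + j - 2) = r ^ (i - 1) * r ^ (j - 1) := by
        rw [← pow_add]; congr 1; omega
      have e2 := Nat.add_choose_mul_factorial_mul_factorial i j
      rw [← Nat.choose_symm_add] at e2
      rw [e1, ← e2]
      push_cast
      field_simp
    refine (Finset.sum_le_sum h).trans ?_
    rw [← Finset.mul_sum]
    refine (mll (conv_inv_sq k) (by positivity)).trans (le_of_eq ?_)
    unfold xw
    have e1 : r ^ (k - 1) = r ^ (k - 2) * r := by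
      rw [← pow_succ]; congr 1; omega
    rw [e1]; field_simp

lemma cv_xw {r : ℝ} (hr : 1 ≤ r) (k : ℕ) : cv (xw r) (xw r) k ≤ 10 * xw r k := by
  have hp := xw_pos hr k
  rw [cv_edge_right]
  rcases k with _ | k
  · rw [xw_zero]; simp [cv_zero, z0, xw_zero]
  · rw [cv_edge_left]
    have := cv_mid_xw hr (k + 1)
    have h2 := mlr (ew_le hr (k + 1)) hp.le
    have h3 : z0 (xw r) (k + 1) = xw r (k + 1) := rfl
    rw [h3, xw_zero]
    linarith

/-- Step 3 weights -/
def yw (s : ℝ) (k : ℕ) : ℝ := (k.factorial : ℝ) ^ s / ((k:ℝ) + 1) ^ 2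

lemma yw_pos (s : ℝ) (k : ℕ) : 0 < yw s k := by
  unfold yw
  have : (0:ℝ) < k.factorial := by positivity
  positivity

lemma choose_fact_rpow {s : ℝ} (hs : 1 ≤ s) (i j : ℕ) :
    ((i + j).choose i : ℝ) * ((i.factorial : ℝ) ^ s * (j.factorial : ℝ) ^ s) ≤ ((i + j).factorial : ℝ) ^ s := by
  have e2 := Nat.add_choose_mul_factorial_mul_factorial i j
  rw [← Nat.choose_symm_add] at e2
  rw [← e2]
  push_cast
  rw [Real.mul_rpow (by positivity) (by positivity), Real.mul_rpow (by positivity) (by positivity), mul_assoc]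
  refine mlr ?_ (by positivity)
  have : (1:ℝ) ≤ ((i + j).choose i : ℝ) := by
    exact_mod_cast Nat.choose_pos (by omega)
  exact Real.self_le_rpow_of_one_le this hs

lemma cv_yw {s : ℝ} (hs : 1 ≤ s) (k : ℕ) : cv (yw s) (yw s) k ≤ 8 * yw s k := by
  have h : ∀ ij ∈ Finset.HasAntidiagonal.antidiagonal k,
      (k.choose ij.1 : ℝ) * (yw s ij.1 * yw s ij.2) ≤
      (k.factorial:ℝ) ^ s * (1 / (((ij.1:ℝ) + 1) ^ 2 * ((ij.2:ℝ) + 1) ^ 2)) := by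
    rintro ⟨i, j⟩ hij
    have hij : i + j = k := by simpa using hij
    subst hij
    simp only [yw]
    have := choose_fact_rpow hs i j
    calc _ = ((i + j).choose i : ℝ) * ((i.factorial : ℝ) ^ s * (j.factorial : ℝ) ^ s) *
          (1 / (((i:ℝ) + 1) ^ 2 * ((j:ℝ) + 1) ^ 2)) := by field_simp
      _ ≤ _ := mlr this (by positivity)
  refine (Finset.sum_le_sum h).trans ?_
  rw [← Finset.mul_sum]
  refine (mll (conv_inv_sq k) (by positivity)).trans (le_of_eq ?_)
  unfold yw; ring

lemma cv_yw_sh {s : ℝ} (hs : 1 ≤ s) (k : ℕ) : cv (yw s) (sh (yw s)) k ≤ 8 * sh (yw s) k := by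
  have h := cv_yw hs (k + 1)
  rw [cv_succ] at h
  have : 0 ≤ cv (sh (yw s)) (yw s) k :=
    Finset.sum_nonneg fun ij _ => by
      have := yw_pos s (ij.1 + 1); have := yw_pos s ij.2
      simp only [sh]; positivity
  show _ ≤ 8 * yw s (k + 1)
  linarith

end
end

section
open Set
open scoped BoundedContinuousFunction
noncomputable section

lemma cs_int {h k : ℝ → ℝ} (hh : Continuous h) (hk : Continuous k) {u v : ℝ} (huv : u ≤ v) :
    (∫ t in u..v, h t * k t) ^ 2 ≤ (∫ t in u..v, h t ^ 2) * ∫ t in u..v, k t ^ 2 := by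
  have key : ∀ x : ℝ, 0 ≤ (∫ t in u..v, h t ^ 2) * (x * x) + (-2 * ∫ t in u..v, h t * k t) * x
      + ∫ t in u..v, k t ^ 2 := by
    intro x
    have e : (∫ t in u..v, (x * h t - k t) ^ 2) = (∫ t in u..v, h t ^ 2) * (x * x)
        + (-2 * ∫ t in u..v, h t * k t) * x + ∫ t in u..v, k t ^ 2 := by
      have i1 : IntervalIntegrable (fun t => (x * x) * h t ^ 2) MeasureTheory.volume u v :=
        (by fun_prop : Continuous _).intervalIntegrable _ _
      have i2 : IntervalIntegrable (fun t => (-2 * x) * (h t * k t)) MeasureTheory.volume u v :=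
        (by fun_prop : Continuous _).intervalIntegrable _ _
      have i3 : IntervalIntegrable (fun t => k t ^ 2) MeasureTheory.volume u v :=
        (by fun_prop : Continuous _).intervalIntegrable _ _
      have : (fun t => (x * h t - k t) ^ 2) =
          fun t => (x * x) * h t ^ 2 + (-2 * x) * (h t * k t) + k t ^ 2 := by
        funext t; ring
      rw [this, intervalIntegral.integral_add (i1.add i2) i3, intervalIntegral.integral_add i1 i2,
        intervalIntegral.integral_const_mul, intervalIntegral.integral_const_mul]
      ring
    rw [← e]
    exact intervalIntegral.integral_nonneg huv fun t _ => sq_nonneg _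
  have := discrim_le_zero key
  unfold discrim at this
  nlinarith

lemma cs_int' {h k : ℝ → ℝ} (hh : Continuous h) (hk : Continuous k) {u v : ℝ} (huv : u ≤ v) :
    |∫ t in u..v, h t * k t| ≤ √(∫ t in u..v, h t ^ 2) * √(∫ t in u..v, k t ^ 2) := by
  rw [← Real.sqrt_mul (intervalIntegral.integral_nonneg huv fun t _ => sq_nonneg _)]
  exact Real.abs_le_sqrt (cs_int hh hk huv)

lemma mink_int {h k : ℝ → ℝ} (hh : Continuous h) (hk : Continuous k) {u v : ℝ} (huv : u ≤ v) :
    √(∫ t in u..v, (h t + k t) ^ 2) ≤ √(∫ t in u..v, h t ^ 2) + √(∫ t in u..v, k t ^ 2) := by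
  have e : (∫ t in u..v, (h t + k t) ^ 2) = (∫ t in u..v, h t ^ 2)
        + 2 * (∫ t in u..v, h t * k t)  + ∫ t in u..v, k t ^ 2 := by
      have i1 : IntervalIntegrable (fun t => h t ^ 2) MeasureTheory.volume u v :=
        (by fun_prop : Continuous _).intervalIntegrable _ _
      have i2 : IntervalIntegrable (fun t => 2 * (h t * k t)) MeasureTheory.volume u v :=
        (by fun_prop : Continuous _).intervalIntegrable _ _
      have i3 : IntervalIntegrable (fun t => k t ^ 2) MeasureTheory.volume u v :=
        (by fun_prop : Continuous _).intervalIntegrable _ _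
      have : (fun t => (h t + k t) ^ 2) =
          fun t => h t ^ 2 + 2 * (h t * k t) + k t ^ 2 := by
        funext t; ring
      rw [this, intervalIntegral.integral_add (i1.add i2) i3, intervalIntegral.integral_add i1 i2,
        intervalIntegral.integral_const_mul]
  have h1 := (le_abs_self _).trans (cs_int' hh hk huv)
  have a0 : 0 ≤ ∫ t in u..v, h t ^ 2 := intervalIntegral.integral_nonneg huv fun t _ => sq_nonneg _
  have b0 : 0 ≤ ∫ t in u..v, k t ^ 2 := intervalIntegral.integral_nonneg huv fun t _ => sq_nonneg _
  apply Real.sqrt_le_iff.2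
  refine ⟨by positivity, ?_⟩
  rw [e, add_sq, Real.sq_sqrt a0, Real.sq_sqrt b0]
  linarith

/-- a module-type seminorm on a normed algebra -/
structure Md (E : Type*) [NormedCommRing E] [NormedAlgebra ℝ E] where
  m : Seminorm ℝ E
  c : ℝ
  c0 : 0 ≤ c
  le : ∀ u, m u ≤ c * ‖u‖
  mul : ∀ u v, m (u * v) ≤ ‖u‖ * m v

section
variable {E : Type*} [NormedCommRing E] [NormedAlgebra ℝ E]

lemma Md.cont (M : Md E) : Continuous M.m :=
  Seminorm.continuous_of_le (p := M.m) (q := M.c.toNNReal • normSeminorm ℝ E)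
    (by
      have : Continuous fun u : E => M.c.toNNReal * ‖u‖ := by fun_prop
      exact this)
    (fun u => by
      have := M.le u
      simpa [NNReal.smul_def, Real.coe_toNNReal _ M.c0] using this)

def nmd (E : Type*) [NormedCommRing E] [NormedAlgebra ℝ E] : Md E where
  m := normSeminorm ℝ E
  c := 1
  c0 := zero_le_one
  le := fun u => by simp
  mul := fun u v => norm_mul_le u v

namespace Md
variable (M : Md E)

def Uq (f : ℝ →ᵇ E) (q0 : ℝ) : ℝ := √(∫ q in q0..q0 + 1, M.m (f q) ^ 2)
def U (f : ℝ →ᵇ E) : ℝ := ⨆ q0, M.Uq f q0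
def S (f : ℝ →ᵇ E) : ℝ := ⨆ q, M.m (f q)

lemma cm (f : ℝ →ᵇ E) : Continuous fun q => M.m (f q) := M.cont.comp f.continuous
lemma nn (u : E) : 0 ≤ M.m u := apply_nonneg _ _
lemma m_le (f : ℝ →ᵇ E) (q : ℝ) : M.m (f q) ≤ M.c * ‖f‖ :=
  (M.le _).trans (mll (f.norm_coe_le_norm q) M.c0)

lemma Uq_le_of {f : ℝ →ᵇ E} {C : ℝ} (hC : 0 ≤ C) (h : ∀ q, M.m (f q) ≤ C) (q0 : ℝ) :
    M.Uq f q0 ≤ C := by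
  refine Real.sqrt_le_iff.2 ⟨hC, ?_⟩
  have : (∫ q in q0..q0 + 1, M.m (f q) ^ 2) ≤ ∫ q in q0..q0 + 1, C ^ 2 := by
    apply intervalIntegral.integral_mono_on (by linarith)
    · exact ((M.cm f).pow 2).intervalIntegrable _ _
    · exact continuous_const.intervalIntegrable _ _
    · intro q _
      exact pow_le_pow_left₀ (M.nn _) (h q) 2
  simpa using this

lemma bdd (f : ℝ →ᵇ E) : BddAbove (range (M.Uq f)) :=
  ⟨M.c * ‖f‖, by
    rintro _ ⟨q0, rfl⟩
    exact M.Uq_le_of (mul_nonneg M.c0 (norm_nonneg _)) (M.m_le f) q0⟩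

lemma bddS (f : ℝ →ᵇ E) : BddAbove (range fun q => M.m (f q)) :=
  ⟨M.c * ‖f‖, by rintro _ ⟨q0, rfl⟩; exact M.m_le f q0⟩

lemma Uq_le (f : ℝ →ᵇ E) (q0 : ℝ) : M.Uq f q0 ≤ M.U f := le_ciSup (M.bdd f) q0
lemma le_S (f : ℝ →ᵇ E) (q : ℝ) : M.m (f q) ≤ M.S f := le_ciSup (M.bddS f) q
lemma U_nn (f : ℝ →ᵇ E) : 0 ≤ M.U f := (Real.sqrt_nonneg _).trans (M.Uq_le f 0)
lemma S_nn (f : ℝ →ᵇ E) : 0 ≤ M.S f := (M.nn _).trans (M.le_S f 0)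
lemma U_le_S (f : ℝ →ᵇ E) : M.U f ≤ M.S f := ciSup_le (M.Uq_le_of (M.S_nn f) (M.le_S f))
lemma S_le (f : ℝ →ᵇ E) : M.S f ≤ M.c * ‖f‖ := ciSup_le (M.m_le f)
lemma U_le (f : ℝ →ᵇ E) : M.U f ≤ M.c * ‖f‖ := (M.U_le_S f).trans (M.S_le f)

lemma int_le (f : ℝ →ᵇ E) (q0 : ℝ) : (∫ q in q0..q0 + 1, M.m (f q) ^ 2) ≤ M.U f ^ 2 :=
  (Real.sqrt_le_left (M.U_nn f)).1 (M.Uq_le f q0)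

lemma U_le_of {f : ℝ →ᵇ E} {C : ℝ} (hC : 0 ≤ C)
    (h : ∀ q0, (∫ q in q0..q0 + 1, M.m (f q) ^ 2) ≤ C ^ 2) : M.U f ≤ C :=
  ciSup_le fun q0 => Real.sqrt_le_iff.2 ⟨hC, h q0⟩

lemma U_add (f g : ℝ →ᵇ E) : M.U (f + g) ≤ M.U f + M.U g := by
  refine ciSup_le fun q0 => ?_
  have h1 := mink_int (M.cm f) (M.cm g) (by linarith : q0 ≤ q0 + 1)
  have h2 : M.Uq (f + g) q0 ≤ √(∫ t in q0..q0+1, (M.m (f t) + M.m (g t)) ^ 2) := by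
    apply Real.sqrt_le_sqrt
    apply intervalIntegral.integral_mono_on (by linarith)
    · exact ((M.cm _).pow 2).intervalIntegrable _ _
    · exact (((M.cm f).add (M.cm g)).pow 2).intervalIntegrable _ _
    · intro q _
      exact pow_le_pow_left₀ (M.nn _) (by simpa using map_add_le_add M.m (f q) (g q)) 2
  exact h2.trans (h1.trans (add_le_add (M.Uq_le f q0) (M.Uq_le g q0)))

/-- monotonicity with constant -/
lemma U_mono {M M' : Md E} {f g : ℝ →ᵇ E} {C : ℝ} (hC : 0 ≤ C) (h : ∀ q, M.m (f q) ≤ C * M'.m (g q)) :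
    M.U f ≤ C * M'.U g := by
  refine M.U_le_of (mul_nonneg hC (M'.U_nn g)) fun q0 => ?_
  have : (∫ q in q0..q0 + 1, M.m (f q) ^ 2) ≤ ∫ q in q0..q0 + 1, C ^ 2 * M'.m (g q) ^ 2 := by
    apply intervalIntegral.integral_mono_on (by linarith)
    · exact ((M.cm _).pow 2).intervalIntegrable _ _
    · exact (continuous_const.mul ((M'.cm g).pow 2)).intervalIntegrable _ _
    · intro q _
      rw [← mul_pow]
      exact pow_le_pow_left₀ (M.nn _) (h q) 2
  refine this.trans ?_
  rw [intervalIntegral.integral_const_mul, mul_pow]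
  exact mll (M'.int_le g q0) (sq_nonneg _)

lemma U_smul_le (r : ℝ) (f : ℝ →ᵇ E) : M.U (r • f) ≤ |r| * M.U f :=
  U_mono (abs_nonneg r) fun q => by
    have := map_smul_eq_mul M.m r (f q)
    simp only [Real.norm_eq_abs] at this
    exact this.le

lemma U_neg (f : ℝ →ᵇ E) : M.U (-f) = M.U f := by
  apply le_antisymm
  · simpa using U_mono (M := M) (M' := M) (f := -f) (g := f) zero_le_one (fun q => by simp)
  · simpa using U_mono (M := M) (M' := M) (f := f) (g := -f) zero_le_one (fun q => by simp)

lemma U_sub (f g : ℝ →ᵇ E) : M.U (f - g) ≤ M.U f + M.U g := by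
  rw [sub_eq_add_neg, ← M.U_neg g]; exact M.U_add _ _

lemma U_zero : M.U 0 = 0 := le_antisymm (by simpa using M.U_le 0) (M.U_nn 0)

lemma U_mul (f g : ℝ →ᵇ E) : M.U (f * g) ≤ ‖f‖ * M.U g :=
  U_mono (norm_nonneg f) fun q => (M.mul _ _).trans
    (mlr (f.norm_coe_le_norm q) (M.nn _))

lemma U_mul' (f g : ℝ →ᵇ E) : M.U (f * g) ≤ M.U f * ‖g‖ := by
  rw [mul_comm, mul_comm (M.U f)]; exact M.U_mul g f

lemma U_mulS (f g : ℝ →ᵇ E) : M.U (f * g) ≤ (nmd E).U f * M.S g := by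
  rw [mul_comm ((nmd E).U f)]
  refine U_mono (M := M) (M' := nmd E) (f := f * g) (g := f) (M.S_nn g) fun q =>
    (M.mul (f q) (g q)).trans ?_
  rw [mul_comm]
  exact mlr (M.le_S g q) (norm_nonneg _)

lemma U_le_nmd (f : ℝ →ᵇ E) : M.U f ≤ M.c * (nmd E).U f := U_mono M.c0 fun q => M.le _

lemma nmd_S (f : ℝ →ᵇ E) : (nmd E).S f = ‖f‖ := by
  apply le_antisymm
  · simpa [nmd] using (nmd E).S_le f
  · exact (BoundedContinuousFunction.norm_le ((nmd E).S_nn f)).2 fun q => (nmd E).le_S f q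

end Md

/-- translations -/
def Tr (τ : ℝ) : (ℝ →ᵇ E) →ₐ[ℝ] (ℝ →ᵇ E) where
  toFun f := f.compContinuous ⟨fun q => q + τ, by fun_prop⟩
  map_one' := by ext; rfl
  map_mul' _ _ := by ext; rfl
  map_zero' := by ext; rfl
  map_add' _ _ := by ext; rfl
  commutes' _ := by ext; rfl

@[simp] lemma Tr_apply (τ : ℝ) (f : ℝ →ᵇ E) (q : ℝ) : Tr τ f q = f (q + τ) := rfl

def dOps (E : Type*) [NormedCommRing E] [NormedAlgebra ℝ E] : Ops (Ioc (0:ℝ) 1) (ℝ →ᵇ E) where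
  δ τ := (τ : ℝ)⁻¹ • ((Tr (τ : ℝ)).toLinearMap - LinearMap.id)
  T τ := Tr (τ : ℝ)
  leib τ f g := by
    ext q
    simp only [LinearMap.smul_apply, LinearMap.sub_apply, LinearMap.id_apply, AlgHom.toLinearMap_apply,
      map_mul, BoundedContinuousFunction.coe_add, BoundedContinuousFunction.coe_mul, Pi.mul_apply, Pi.add_apply,
      BoundedContinuousFunction.coe_smul, BoundedContinuousFunction.coe_sub, Pi.sub_apply, Pi.smul_apply]
    rw [mul_smul_comm, smul_mul_assoc, ← smul_add]
    congr 1; ring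
  comm τ τ' f := by
    ext q
    simp [add_right_comm]

abbrev DD {E : Type*} [NormedCommRing E] [NormedAlgebra ℝ E] (l : List (Ioc (0:ℝ) 1)) :
    (ℝ →ᵇ E) →ₗ[ℝ] (ℝ →ᵇ E) := (dOps E).D l

lemma dOps_δ (τ : Ioc (0:ℝ) 1) (f : ℝ →ᵇ E) (q : ℝ) :
    (dOps E).δ τ f q = (τ : ℝ)⁻¹ • (f (q + τ) - f q) := rfl

namespace Md
variable (M : Md E)
lemma U_Tr_le (τ : ℝ) (f : ℝ →ᵇ E) : M.U (Tr τ f) ≤ M.U f := by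
  refine M.U_le_of (M.U_nn f) fun q0 => ?_
  have : (∫ q in q0..q0 + 1, M.m (Tr τ f q) ^ 2) = ∫ q in (q0 + τ)..(q0 + τ + 1), M.m (f q) ^ 2 := by
    simp only [Tr_apply]
    rw [intervalIntegral.integral_comp_add_right (fun q => M.m (f q) ^ 2)]
    congr 1; ring
  rw [this]; exact M.int_le f _

lemma Tr_Tr (τ : ℝ) (f : ℝ →ᵇ E) : Tr (-τ) (Tr τ f) = f := by ext q; simp

lemma U_Tr (τ : ℝ) (f : ℝ →ᵇ E) : M.U (Tr τ f) = M.U f := by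
  refine le_antisymm (M.U_Tr_le τ f) ?_
  have := M.U_Tr_le (-τ) (Tr τ f)
  rwa [Tr_Tr] at this

lemma S_Tr_le (τ : ℝ) (f : ℝ →ᵇ E) : M.S (Tr τ f) ≤ M.S f := ciSup_le fun q => M.le_S f (q + τ)

lemma S_Tr (τ : ℝ) (f : ℝ →ᵇ E) : M.S (Tr τ f) = M.S f := by
  refine le_antisymm (M.S_Tr_le τ f) ?_
  have := M.S_Tr_le (-τ) (Tr τ f)
  rwa [Tr_Tr] at this

lemma norm_Tr (τ : ℝ) (f : ℝ →ᵇ E) : ‖Tr τ f‖ = ‖f‖ := by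
  rw [← nmd_S, ← nmd_S, S_Tr]
end Md
end
end
end

section
open Set MeasureTheory
open scoped BoundedContinuousFunction
noncomputable section

lemma ii_swap {f : ℝ → ℝ → ℝ} (hf : Continuous (Function.uncurry f)) {a b c d : ℝ} (hab : a ≤ b) (hcd : c ≤ d) :
    ∫ x in a..b, ∫ y in c..d, f x y = ∫ y in c..d, ∫ x in a..b, f x y := by
  simp only [intervalIntegral.integral_of_le hab, intervalIntegral.integral_of_le hcd]
  apply integral_integral_swap
  have := (hf.continuousOn (s := Icc a b ×ˢ Icc c d)).integrableOn_compact
    (isCompact_Icc.prod isCompact_Icc) (μ := volume)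
  rw [Measure.prod_restrict]
  exact this.mono_set (prod_mono Ioc_subset_Icc_self Ioc_subset_Icc_self)

def HQ {E : Type*} [NormedCommRing E] [NormedAlgebra ℝ E] (u v : ℝ →ᵇ E) : Prop :=
  ∀ q, HasDerivAt u (v q) q

section
variable {E : Type*} [NormedCommRing E] [NormedAlgebra ℝ E] [CompleteSpace E]

lemma jensen_aux (φ : E → ℝ) (hφ : ConvexOn ℝ univ φ) (hc : Continuous φ) (w : ℝ → E) (hw : Continuous w) :
    φ (∫ s in (0:ℝ)..1, w s) ≤ ∫ s in (0:ℝ)..1, φ (w s) := by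
  rw [intervalIntegral.integral_of_le zero_le_one, intervalIntegral.integral_of_le zero_le_one]
  haveI : IsProbabilityMeasure (volume.restrict (Ioc (0:ℝ) 1)) := ⟨by simp⟩
  exact hφ.map_integral_le hc.continuousOn isClosed_univ (by simp)
    ((hw.integrableOn_Icc (a := 0) (b := 1)).mono_set Ioc_subset_Icc_self)
    (((hc.comp hw).integrableOn_Icc (a := 0) (b := 1)).mono_set Ioc_subset_Icc_self)

namespace Md
variable (M : Md E)

lemma jensen1 (w : ℝ → E) (hw : Continuous w) :
    M.m (∫ s in (0:ℝ)..1, w s) ≤ ∫ s in (0:ℝ)..1, M.m (w s) :=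
  jensen_aux M.m M.m.convexOn M.cont w hw

lemma jensen2 (w : ℝ → E) (hw : Continuous w) :
    M.m (∫ s in (0:ℝ)..1, w s) ^ 2 ≤ ∫ s in (0:ℝ)..1, M.m (w s) ^ 2 :=
  jensen_aux (fun u => M.m u ^ 2) (M.m.convexOn.pow (fun _ _ => M.nn _) 2) (M.cont.pow 2) w hw

lemma m_int_le (w : ℝ → E) (hw : Continuous w) {u v : ℝ} (huv : u ≤ v) :
    M.m (∫ s in u..v, w s) ≤ ∫ s in u..v, M.m (w s) := by
  rcases huv.eq_or_lt with rfl | h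
  · simp
  have hp : 0 < v - u := sub_pos.2 h
  have e1 : (∫ s in u..v, w s) = (v - u) • ∫ s in (0:ℝ)..1, w ((v - u) * s + u) := by
    rw [intervalIntegral.smul_integral_comp_mul_add]; simp
  have e2 : (∫ s in u..v, M.m (w s)) = (v - u) • ∫ s in (0:ℝ)..1, M.m (w ((v - u) * s + u)) := by
    rw [intervalIntegral.smul_integral_comp_mul_add (fun s => M.m (w s))]; simp
  rw [e1, e2, map_smul_eq_mul, Real.norm_of_nonneg hp.le, smul_eq_mul]
  exact mll (M.jensen1 _ (hw.comp (by fun_prop))) hp.le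

lemma U_avg {f v : ℝ →ᵇ E} {τ : ℝ} (h : ∀ q, f q = ∫ s in (0:ℝ)..1, v (q + τ * s)) : M.U f ≤ M.U v := by
  refine M.U_le_of (M.U_nn v) fun q0 => ?_
  have c2 : Continuous (Function.uncurry fun q s => M.m (v (q + τ * s)) ^ 2) := by
    exact ((M.cm v).comp (by fun_prop : Continuous fun z : ℝ × ℝ => z.1 + τ * z.2)).pow 2
  have h1 : (∫ q in q0..q0 + 1, M.m (f q) ^ 2)
      ≤ ∫ q in q0..q0 + 1, ∫ s in (0:ℝ)..1, M.m (v (q + τ * s)) ^ 2 := by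
    apply intervalIntegral.integral_mono_on (by linarith)
    · exact ((M.cm f).pow 2).intervalIntegrable _ _
    · exact (intervalIntegral.continuous_parametric_intervalIntegral_of_continuous' c2 0 1).intervalIntegrable _ _
    · intro q _
      rw [h q]
      exact M.jensen2 _ (v.continuous.comp (by fun_prop))
  refine h1.trans ?_
  rw [ii_swap c2 (by linarith) zero_le_one]
  · have : ∀ s ∈ Icc (0:ℝ) 1, (∫ q in q0..q0 + 1, M.m (v (q + τ * s)) ^ 2) ≤ M.U v ^ 2 := by
      intro s _
      rw [intervalIntegral.integral_comp_add_right (fun q => M.m (v q) ^ 2)]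
      have := M.int_le v (q0 + τ * s)
      convert this using 2; ring
    calc _ ≤ ∫ s in (0:ℝ)..1, M.U v ^ 2 := by
          apply intervalIntegral.integral_mono_on zero_le_one _ _ this
          · exact (intervalIntegral.continuous_parametric_intervalIntegral_of_continuous' (f := fun s q => M.m (v (q + τ * s)) ^ 2)
              (c2.comp continuous_swap) q0 (q0+1)).intervalIntegrable _ _
          · exact continuous_const.intervalIntegrable _ _
      _ = _ := by simp

end Md

lemma HQ.δ_eq {u v : ℝ →ᵇ E} (h : HQ u v) (τ : Ioc (0:ℝ) 1) (q : ℝ) :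
    (dOps E).δ τ u q = ∫ s in (0:ℝ)..1, v (q + τ * s) := by
  have hτ : (τ : ℝ) ≠ 0 := τ.2.1.ne'
  rw [dOps_δ, ← intervalIntegral.integral_eq_sub_of_hasDerivAt (fun x _ => h x)
    (v.continuous.intervalIntegrable _ _)]
  have e := intervalIntegral.smul_integral_comp_add_mul (a := 0) (b := 1) (fun x => v x) (τ:ℝ) q
  rw [inv_smul_eq_iff₀ hτ, e]; simp

variable (M : Md E)

lemma HQ.U_δ {u v : ℝ →ᵇ E} (h : HQ u v) (τ : Ioc (0:ℝ) 1) : M.U ((dOps E).δ τ u) ≤ M.U v :=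
  M.U_avg (h.δ_eq τ)

lemma HQ.S_δ {u v : ℝ →ᵇ E} (h : HQ u v) (τ : Ioc (0:ℝ) 1) : M.S ((dOps E).δ τ u) ≤ M.S v := by
  refine ciSup_le fun q => ?_
  rw [h.δ_eq]
  refine (M.jensen1 _ (v.continuous.comp (by fun_prop))).trans ?_
  calc _ ≤ ∫ s in (0:ℝ)..1, M.S v := by
        apply intervalIntegral.integral_mono_on zero_le_one
        · exact ((M.cm v).comp (by fun_prop : Continuous fun s => q + (τ:ℝ) * s)).intervalIntegrable _ _
        · exact continuous_const.intervalIntegrable _ _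
        · intro s _; exact M.le_S v _
    _ = _ := by simp

lemma HQ.norm_δ {u v : ℝ →ᵇ E} (h : HQ u v) (τ : Ioc (0:ℝ) 1) : ‖(dOps E).δ τ u‖ ≤ ‖v‖ := by
  rw [← Md.nmd_S, ← Md.nmd_S]; exact h.S_δ _ τ

lemma HQ.δ {u v : ℝ →ᵇ E} (h : HQ u v) (τ : Ioc (0:ℝ) 1) : HQ ((dOps E).δ τ u) ((dOps E).δ τ v) := by
  intro q
  have h1 : HasDerivAt (fun q => u (q + τ)) (v (q + τ)) q := by
    simpa using (h (q + τ)).comp_add_const q (τ:ℝ)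
  exact (h1.sub (h q)).const_smul (τ:ℝ)⁻¹

lemma HQ.D {u v : ℝ →ᵇ E} (h : HQ u v) (l : List (Ioc (0:ℝ) 1)) : HQ (DD l u) (DD l v) := by
  induction l generalizing u v with
  | nil => exact h
  | cons τ l ih => exact ih (h.δ τ)

lemma dOps_δδ (τ τ' : Ioc (0:ℝ) 1) (f : ℝ →ᵇ E) :
    (dOps E).δ τ ((dOps E).δ τ' f) = (dOps E).δ τ' ((dOps E).δ τ f) := by
  ext q
  simp only [dOps_δ]
  rw [← smul_sub, ← smul_sub, smul_comm, add_right_comm q τ τ']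
  congr 2; abel

lemma DD_δ (l : List (Ioc (0:ℝ) 1)) (τ : Ioc (0:ℝ) 1) (f : ℝ →ᵇ E) :
    DD l ((dOps E).δ τ f) = (dOps E).δ τ (DD l f) := by
  induction l generalizing f with
  | nil => rfl
  | cons τ' l ih => simp only [Ops.D_cons]; rw [dOps_δδ, ih]

/-- Steklov average -/
def stek (τ : ℝ) (w : ℝ →ᵇ E) : ℝ →ᵇ E :=
  BoundedContinuousFunction.ofNormedAddCommGroup (fun q => ∫ s in (0:ℝ)..1, w (q + τ * s))
    (intervalIntegral.continuous_parametric_intervalIntegral_of_continuous'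
      (f := fun q s => w (q + τ * s)) (by unfold Function.uncurry; fun_prop) 0 1) ‖w‖
    (fun q => by
      have := intervalIntegral.norm_integral_le_of_norm_le_const (a := 0) (b := 1)
        (f := fun s => w (q + τ * s)) (C := ‖w‖) (fun s _ => w.norm_coe_le_norm _)
      simpa using this)

lemma stek_apply (τ : ℝ) (w : ℝ →ᵇ E) (q : ℝ) : stek τ w q = ∫ s in (0:ℝ)..1, w (q + τ * s) := rfl

lemma stek_HQ (τ : Ioc (0:ℝ) 1) (w : ℝ →ᵇ E) : HQ (stek τ w) ((dOps E).δ τ w) := by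
  intro q
  have hτ : (τ : ℝ) ≠ 0 := τ.2.1.ne'
  have e : (stek τ w : ℝ → E) = fun q => (τ:ℝ)⁻¹ • ((∫ x in (0:ℝ)..(q + τ), w x) - ∫ x in (0:ℝ)..q, w x) := by
    funext q
    have e := intervalIntegral.smul_integral_comp_add_mul (a := 0) (b := 1) (fun x => w x) (τ:ℝ) q
    rw [stek_apply, eq_inv_smul_iff₀ hτ, e,
      intervalIntegral.integral_interval_sub_left (w.continuous.intervalIntegrable _ _)
        (w.continuous.intervalIntegrable _ _)]
    simp
  rw [e, dOps_δ]
  have h1 : ∀ q, HasDerivAt (fun q => ∫ x in (0:ℝ)..q, w x) (w q) q := fun q =>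
    intervalIntegral.integral_hasDerivAt_right (w.continuous.intervalIntegrable _ _)
      (w.continuous.stronglyMeasurableAtFilter _ _) w.continuous.continuousAt
  have h2 : HasDerivAt (fun q => ∫ x in (0:ℝ)..(q + τ), w x) (w (q + τ)) q := by
    simpa using (h1 (q + τ)).comp_add_const q (τ:ℝ)
  exact (h2.sub (h1 q)).const_smul (τ:ℝ)⁻¹

lemma Md.int1_le (f : ℝ →ᵇ E) (q0 : ℝ) : (∫ q in q0..q0 + 1, M.m (f q)) ≤ M.U f := by
  have h := cs_int' (M.cm f) (continuous_const (y := (1:ℝ))) (by linarith : q0 ≤ q0 + 1)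
  have h2 : M.Uq f q0 ≤ M.U f := M.Uq_le f q0
  simp only [mul_one, one_pow, intervalIntegral.integral_const, add_sub_cancel_left, smul_eq_mul,
    Real.sqrt_one] at h
  exact (le_abs_self _).trans (h.trans h2)

lemma sob_C1 {u v : ℝ →ᵇ E} (h : HQ u v) (q : ℝ) : M.m (u q) ≤ M.U u + M.U v := by
  have h1 : ∀ q' ∈ Icc q (q + 1), M.m (u q) ≤ M.m (u q') + M.U v := by
    intro q' hq'
    have e := intervalIntegral.integral_eq_sub_of_hasDerivAt (a := q) (b := q') (fun x _ => h x)
      (v.continuous.intervalIntegrable _ _)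
    have h2 : M.m (u q) ≤ M.m (u q') + M.m (∫ x in q..q', v x) := by
      have : u q = u q' - ∫ x in q..q', v x := by rw [e]; abel
      conv_lhs => rw [this]
      exact map_sub_le_add M.m _ _
    have h3 := M.m_int_le v v.continuous hq'.1
    have h4 : (∫ x in q..q', M.m (v x)) ≤ ∫ x in q..q+1, M.m (v x) :=
      intervalIntegral.integral_mono_interval le_rfl hq'.1 hq'.2
        (Filter.Eventually.of_forall fun x => M.nn _) ((M.cm v).intervalIntegrable _ _)
    have h5 := M.int1_le v q
    linarith
  have h6 : (∫ q' in q..q+1, M.m (u q)) ≤ ∫ q' in q..q+1, (M.m (u q') + M.U v) := by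
    apply intervalIntegral.integral_mono_on (by linarith) _ _ h1
    · exact continuous_const.intervalIntegrable _ _
    · exact ((M.cm u).add continuous_const).intervalIntegrable _ _
  rw [intervalIntegral.integral_add ((M.cm u).intervalIntegrable _ _)
    (continuous_const.intervalIntegrable _ _)] at h6
  have h7 := M.int1_le u q
  simp at h6
  linarith

lemma sob_q {w : ℝ →ᵇ E} {C : ℝ} (hC : ∀ τ, M.U ((dOps E).δ τ w) ≤ C) : M.S w ≤ M.U w + C := by
  refine ciSup_le fun q => ?_
  have h1 : ∀ τ : Ioc (0:ℝ) 1, M.m (stek τ w q) ≤ M.U w + C := fun τ =>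
    (sob_C1 M (stek_HQ τ w) q).trans
      (add_le_add (M.U_avg (τ := τ) (fun q => stek_apply τ w q)) (hC τ))
  have hc : Continuous fun τ : ℝ => stek τ w q := by
    simp only [stek_apply]
    exact intervalIntegral.continuous_parametric_intervalIntegral_of_continuous'
      (f := fun τ s => w (q + τ * s)) (by unfold Function.uncurry; fun_prop) 0 1
  have ht : Filter.Tendsto (fun τ : ℝ => M.m (stek τ w q)) (nhdsWithin 0 (Ioi 0)) (nhds (M.m (w q))) := by
    have := (M.cont.comp hc).tendsto 0
    simp only [Function.comp, stek_apply] at this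
    simp only [zero_mul, add_zero, intervalIntegral.integral_const, sub_zero, one_smul] at this
    exact this.mono_left nhdsWithin_le_nhds
  refine le_of_tendsto ht ?_
  filter_upwards [Ioc_mem_nhdsGT (zero_lt_one (α := ℝ))] with τ hτ
  exact h1 ⟨τ, hτ⟩
end
end
end

section
open Set MeasureTheory
open scoped BoundedContinuousFunction
noncomputable section

abbrev AA (a b : ℝ) := C(Icc a b, ℝ)
abbrev FF (a b : ℝ) := ℝ →ᵇ C(Icc a b, ℝ)

section
variable {a b : ℝ} [hab : Fact (a < b)]

lemma hle : a ≤ b := hab.out.le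

instance neIcc : Nonempty (Icc a b) := ⟨⟨a, left_mem_Icc.2 hle⟩⟩

def ex (u : AA a b) : ℝ → ℝ := IccExtend (hle (a := a) (b := b)) u
lemma ex_cont (u : AA a b) : Continuous (ex u) := u.continuous.Icc_extend'
lemma ex_of (u : AA a b) (p : Icc a b) : ex u p = u p := IccExtend_val _ _ _
@[simp] lemma ex_add (u v : AA a b) (p : ℝ) : ex (u + v) p = ex u p + ex v p := rfl
@[simp] lemma ex_sub (u v : AA a b) (p : ℝ) : ex (u - v) p = ex u p - ex v p := rfl
@[simp] lemma ex_mul (u v : AA a b) (p : ℝ) : ex (u * v) p = ex u p * ex v p := rfl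
@[simp] lemma ex_smul (c : ℝ) (v : AA a b) (p : ℝ) : ex (c • v) p = c * ex v p := rfl
@[simp] lemma ex_neg (v : AA a b) (p : ℝ) : ex (-v) p = - ex v p := rfl
@[simp] lemma ex_zero (p : ℝ) : ex (0 : AA a b) p = 0 := rfl
@[simp] lemma ex_one (p : ℝ) : ex (1 : AA a b) p = 1 := rfl
lemma ex_le (u : AA a b) (p : ℝ) : |ex u p| ≤ ‖u‖ := u.norm_coe_le_norm _
lemma ex_ii (u : AA a b) (x y : ℝ) : IntervalIntegrable (ex u) volume x y := (ex_cont u).intervalIntegrable _ _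

def IA : AA a b →L[ℝ] ℝ := LinearMap.mkContinuous
  { toFun := fun u => ∫ p in a..b, ex u p
    map_add' := fun u v => by simp [intervalIntegral.integral_add (ex_ii u a b) (ex_ii v a b)]
    map_smul' := fun c u => by simp } (b - a) (fun u => by
      have := intervalIntegral.norm_integral_le_of_norm_le_const (a := a) (b := b)
        (f := ex u) (C := ‖u‖) (fun s _ => ex_le u s)
      rw [abs_of_pos (sub_pos.2 hab.out)] at this
      simpa [mul_comm] using this)

lemma IA_apply (u : AA a b) : IA u = ∫ p in a..b, ex u p := rfl

lemma IA_mono {u v : AA a b} (h : ∀ p, u p ≤ v p) : IA u ≤ IA v := by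
  rw [IA_apply, IA_apply]
  exact intervalIntegral.integral_mono_on hle (ex_ii u a b) (ex_ii v a b) fun p _ => h _

lemma IA_sq_nn (u : AA a b) : 0 ≤ IA (u * u) := by
  have := IA_mono (u := 0) (v := u * u) fun p => mul_self_nonneg (u p)
  simpa using this

lemma IA_cs (u v : AA a b) : |IA (u * v)| ≤ √(IA (u * u)) * √(IA (v * v)) := by
  have := cs_int' (ex_cont u) (ex_cont v) (hle (a := a) (b := b))
  simpa [IA_apply, sq] using this

def m2 (a b : ℝ) [hab : Fact (a < b)] : Md (AA a b) where
  m := Seminorm.of (fun u => √(IA (u * u)))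
    (fun u v => by
      have := mink_int (ex_cont u) (ex_cont v) (hle (a := a) (b := b))
      simpa [IA_apply, sq] using this)
    (fun c u => by
      have : IA ((c • u) * (c • u)) = c ^ 2 * IA (u * u) := by
        rw [smul_mul_smul_comm, map_smul, smul_eq_mul]; ring
      rw [this, Real.sqrt_mul (sq_nonneg c), Real.sqrt_sq_eq_abs]; rfl)
  c := √(b - a)
  c0 := Real.sqrt_nonneg _
  le := fun u => by
    show √(IA (u * u)) ≤ _
    rw [← Real.sqrt_sq (norm_nonneg u), ← Real.sqrt_mul (sub_pos.2 hab.out).le]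
    apply Real.sqrt_le_sqrt
    have : IA (u * u) ≤ ∫ p in a..b, ‖u‖ ^ 2 := by
      refine intervalIntegral.integral_mono_on hle (ex_ii _ a b) (continuous_const.intervalIntegrable _ _) fun p _ => ?_
      rw [ex_mul, ← sq]
      exact sq_le_sq' (abs_le.1 (ex_le u p)).1 (abs_le.1 (ex_le u p)).2
    simpa using this
  mul := fun u v => by
    show √(IA (u * v * (u * v))) ≤ ‖u‖ * √(IA (v * v))
    rw [← Real.sqrt_sq (norm_nonneg u), ← Real.sqrt_mul (by positivity)]
    apply Real.sqrt_le_sqrt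
    have h := IA_mono (u := u * v * (u * v)) (v := (‖u‖ ^ 2) • (v * v)) fun p => by
      have h1 : (u p) ^ 2 ≤ ‖u‖ ^ 2 := by
        have := u.norm_coe_le_norm p
        exact sq_le_sq' (abs_le.1 this).1 (abs_le.1 this).2
      have h2 := mlr h1 (mul_self_nonneg (v p))
      calc u p * v p * (u p * v p) = (u p) ^ 2 * (v p * v p) := by ring
        _ ≤ _ := h2
    simpa using h

lemma m2_sq (u : AA a b) : (m2 a b).m u ^ 2 = IA (u * u) := Real.sq_sqrt (IA_sq_nn u)

lemma IA_cs' (u v : AA a b) : |IA (u * v)| ≤ (m2 a b).m u * (m2 a b).m v := IA_cs u v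

def tp : AA a b →L[ℝ] ℝ := ContinuousMap.evalCLM ℝ ⟨b, right_mem_Icc.2 hle⟩
def bt : AA a b →L[ℝ] ℝ := ContinuousMap.evalCLM ℝ ⟨a, left_mem_Icc.2 hle⟩
lemma tp_ex (u : AA a b) : tp u = ex u b := (ex_of u ⟨b, right_mem_Icc.2 hle⟩).symm
lemma bt_ex (u : AA a b) : bt u = ex u a := (ex_of u ⟨a, left_mem_Icc.2 hle⟩).symm
lemma tp_le (u : AA a b) : |tp u| ≤ ‖u‖ := u.norm_coe_le_norm _
lemma tp_mul (u v : AA a b) : tp (u * v) = tp u * tp v := rfl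

/-- `v` is the `p`-derivative of `u` -/
def DP (u v : AA a b) : Prop := ∀ p ∈ Icc a b, ex u p = ex u a + ∫ t in a..p, ex v t

lemma prim_deriv (c : ℝ) (v : AA a b) (p : ℝ) : HasDerivAt (fun p => c + ∫ t in a..p, ex v t) (ex v p) p :=
  (intervalIntegral.integral_hasDerivAt_right (ex_ii v a p)
      ((ex_cont v).stronglyMeasurableAtFilter _ _) (ex_cont v).continuousAt).const_add c

lemma DP.add {u v u' v' : AA a b} (h : DP u v) (h' : DP u' v') : DP (u + u') (v + v') := by
  intro p hp
  simp only [ex_add, intervalIntegral.integral_add (ex_ii v a p) (ex_ii v' a p), h p hp, h' p hp]; ring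

lemma DP.smul {u v : AA a b} (h : DP u v) (c : ℝ) : DP (c • u) (c • v) := by
  intro p hp
  simp only [ex_smul, intervalIntegral.integral_const_mul]
  rw [h p hp]; ring

lemma DP.sub {u v u' v' : AA a b} (h : DP u v) (h' : DP u' v') : DP (u - u') (v - v') := by
  have := h.add (h'.smul (-1)); simpa [sub_eq_add_neg] using this

lemma DP.mul {u v u' v' : AA a b} (h : DP u v) (h' : DP u' v') : DP (u * u') (u * v' + v * u') := by
  intro p hp
  have h1 : ∀ x ∈ uIcc a p, HasDerivAt (fun p => (ex u a + ∫ t in a..p, ex v t) * (ex u' a + ∫ t in a..p, ex v' t))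
      (ex v x * (ex u' a + ∫ t in a..x, ex v' t) + (ex u a + ∫ t in a..x, ex v t) * ex v' x) x :=
    fun x _ => (prim_deriv _ v x).mul (prim_deriv _ v' x)
  have c1 : ∀ (c : ℝ) (v : AA a b), Continuous fun p => c + ∫ t in a..p, ex v t := fun c v =>
    continuous_iff_continuousAt.2 fun p => (prim_deriv c v p).continuousAt
  have h2 := intervalIntegral.integral_eq_sub_of_hasDerivAt h1
    ((((ex_cont v).mul (c1 _ v')).add ((c1 _ v).mul (ex_cont v'))).intervalIntegrable _ _)
  have h3 : (∫ t in a..p, ex (u * v' + v * u') t) = ∫ x in a..p, (ex v x * (ex u' a + ∫ t in a..x, ex v' t) + (ex u a + ∫ t in a..x, ex v t) * ex v' x) := by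
    apply intervalIntegral.integral_congr
    intro x hx
    rw [uIcc_of_le hp.1] at hx
    have hx' : x ∈ Icc a b := ⟨hx.1, hx.2.trans hp.2⟩
    simp only [ex_add, ex_mul]
    rw [← h x hx', ← h' x hx']; ring
  rw [h3, h2, ← h p hp, ← h' p hp]
  simp

lemma DP.parts {u v u' v' : AA a b} (h : DP u v) (h' : DP u' v') :
    IA (u * v' + v * u') = tp u * tp u' - bt u * bt u' := by
  have := (h.mul h') b (right_mem_Icc.2 hle)
  rw [IA_apply, tp_ex, tp_ex, bt_ex, bt_ex]
  simp only [ex_mul] at this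
  linarith

lemma DP.sob {u v : AA a b} (h : DP u v) {ε : ℝ} (hε : 0 < ε) :
    ‖u‖ ^ 2 ≤ (1 / (b - a) + 1 / ε) * (m2 a b).m u ^ 2 + ε * (m2 a b).m v ^ 2 := by
  have hba := sub_pos.2 hab.out
  rw [m2_sq, m2_sq]
  have hu := h.mul h
  have key : ∀ p ∈ Icc a b, (ex u p) ^ 2 ≤ (1 / (b - a) + 1 / ε) * IA (u * u) + ε * IA (v * v) := by
    intro p hp
    have h1 : ∀ p' ∈ Icc a b, ex u p ^ 2 ≤ ex u p' ^ 2 + (1 / ε * IA (u * u) + ε * IA (v * v)) := by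
      intro p' hp'
      have e1 := hu p hp
      have e2 := hu p' hp'
      have e3 : ex u p ^ 2 = ex u p' ^ 2 + ∫ t in p'..p, ex (u * v + v * u) t := by
        rw [← intervalIntegral.integral_interval_sub_left (ex_ii _ a p) (ex_ii _ a p')]
        simp only [ex_mul] at e1 e2
        nlinarith
      have e4 : |∫ t in p'..p, ex (u * v + v * u) t| ≤ ∫ t in a..b, (1 / ε * (ex u t * ex u t) + ε * (ex v t * ex v t)) := by
        have cc : Continuous fun t => (1 / ε * (ex u t * ex u t) + ε * (ex v t * ex v t)) := by
          have := ex_cont u; have := ex_cont v; fun_prop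
        refine (intervalIntegral.norm_integral_le_integral_norm_uIoc (f := ex (u * v + v * u))).trans ?_
        rw [intervalIntegral.integral_of_le hle]
        refine (setIntegral_mono_on (g := fun t => (1 / ε * (ex u t * ex u t) + ε * (ex v t * ex v t))) ?_ ?_ measurableSet_uIoc ?_).trans (setIntegral_mono_set ?_ ?_ ?_)
        · exact (((ex_cont _).norm).intervalIntegrable p' p).def'
        · exact (cc.intervalIntegrable p' p).def'
        · intro t _
          simp only [ex_add, ex_mul, Real.norm_eq_abs]
          rw [abs_le]
          have hi : 1 / ε * ε = 1 := by field_simp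
          have e5 : 1 / ε * (ex u t * ex u t) + ε * (ex v t * ex v t) - 2 * (ex u t * ex v t) = 1 / ε * (ex u t - ε * ex v t) ^ 2 := by
            field_simp; ring
          have e6 : 1 / ε * (ex u t * ex u t) + ε * (ex v t * ex v t) + 2 * (ex u t * ex v t) = 1 / ε * (ex u t + ε * ex v t) ^ 2 := by
            field_simp; ring
          have p5 : 0 ≤ 1 / ε * (ex u t - ε * ex v t) ^ 2 := by positivity
          have p6 : 0 ≤ 1 / ε * (ex u t + ε * ex v t) ^ 2 := by positivity
          constructor <;> linarith
        · exact (cc.intervalIntegrable a b).1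
        · exact Filter.Eventually.of_forall fun t => by
            have h1 := mul_self_nonneg (ex u t); have h2 := mul_self_nonneg (ex v t)
            show 0 ≤ 1 / ε * (ex u t * ex u t) + ε * (ex v t * ex v t)
            positivity
        · apply HasSubset.Subset.eventuallyLE
          rw [uIoc]
          exact Ioc_subset_Ioc (le_min hp'.1 hp.1) (max_le hp'.2 hp.2)
      have e7 : (∫ t in a..b, (1 / ε * (ex u t * ex u t) + ε * (ex v t * ex v t))) = 1 / ε * IA (u * u) + ε * IA (v * v) := by
        rw [intervalIntegral.integral_add, intervalIntegral.integral_const_mul, intervalIntegral.integral_const_mul]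
        · rfl
        · exact ((ex_ii (u * u) a b).const_mul _)
        · exact ((ex_ii (v * v) a b).const_mul _)
      have := (le_abs_self _).trans e4
      linarith
    have h2 := intervalIntegral.integral_mono_on (a := a) (b := b) (μ := volume) hle (intervalIntegrable_const (c := ex u p ^ 2))
      ((((ex_cont u).pow 2).add continuous_const).intervalIntegrable _ _) h1
    have h3 : (∫ t in a..b, (ex u t ^ 2 + (1 / ε * IA (u * u) + ε * IA (v * v)))) = IA (u * u) + (b - a) * (1 / ε * IA (u * u) + ε * IA (v * v)) := by
      have hc : Continuous fun t => ex u t ^ 2 := (ex_cont u).pow 2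
      rw [intervalIntegral.integral_add (hc.intervalIntegrable _ _) intervalIntegrable_const]
      simp [IA_apply, sq]; ring
    change _ ≤ ∫ t in a..b, (ex u t ^ 2 + (1 / ε * IA (u * u) + ε * IA (v * v))) at h2
    rw [h3] at h2
    simp only [intervalIntegral.integral_const, smul_eq_mul] at h2
    have h4 : (b - a) * (ex u p ^ 2 - (1 / ε * IA (u * u) + ε * IA (v * v))) ≤ IA (u * u) := by linarith
    rw [mul_comm, ← le_div_iff₀ hba] at h4
    have h5 : IA (u * u) / (b - a) = 1 / (b - a) * IA (u * u) := by ring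
    nlinarith
  have h0 : 0 ≤ (1 / (b - a) + 1 / ε) * IA (u * u) + ε * IA (v * v) :=
    (sq_nonneg _).trans (key a (left_mem_Icc.2 hle))
  rw [← Real.sqrt_le_sqrt_iff h0, Real.sqrt_sq (norm_nonneg _)] 
  rw [ContinuousMap.norm_le _ (Real.sqrt_nonneg _)]
  intro p
  apply Real.abs_le_sqrt
  have := key p p.2
  rwa [ex_of] at this

/-- boundary trace to the top, as a constant function of p -/
def R0 : FF a b →ₐ[ℝ] FF a b where
  toFun f := BoundedContinuousFunction.ofNormedAddCommGroup
    (fun q => algebraMap ℝ (AA a b) (tp (f q)))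
    ((continuous_algebraMap ℝ (AA a b)).comp (tp.continuous.comp f.continuous)) ‖f‖
    (fun q => by
      rw [norm_algebraMap']
      exact (tp_le _).trans (f.norm_coe_le_norm q))
  map_one' := by ext; rfl
  map_mul' _ _ := by ext; rfl
  map_zero' := by ext; rfl
  map_add' _ _ := by ext; rfl
  commutes' _ := by ext; rfl

lemma R0_apply (f : FF a b) (q : ℝ) : R0 f q = algebraMap ℝ (AA a b) (tp (f q)) := rfl

lemma norm_R0 (f : FF a b) (q : ℝ) : ‖R0 f q‖ = |tp (f q)| := by
  rw [R0_apply, norm_algebraMap']; rfl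

lemma DD_R0 (l : List (Ioc (0:ℝ) 1)) (f : FF a b) : DD l (R0 f) = R0 (DD l f) := by
  induction l generalizing f with
  | nil => rfl
  | cons τ l ih =>
    simp only [Ops.D_cons]
    rw [← ih]
    congr 1

lemma HQ.R0 {u v : FF a b} (h : HQ u v) : HQ (R0 u) (R0 v) := by
  intro q
  exact ((Algebra.linearMap ℝ (AA a b)).toContinuousLinearMap.comp tp).hasFDerivAt.comp_hasDerivAt q (h q)

lemma R0_norm_le (f : FF a b) : ‖R0 f‖ ≤ ‖f‖ :=
  (BoundedContinuousFunction.norm_le (norm_nonneg f)).2 fun q => by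
    rw [norm_R0]; exact (tp_le _).trans (f.norm_coe_le_norm q)

lemma R0_LI (f : FF a b) : (nmd (AA a b)).U (R0 f) ≤ (nmd (AA a b)).U f := by
  have := Md.U_mono (M := nmd (AA a b)) (M' := nmd (AA a b)) (f := R0 f) (g := f) zero_le_one fun q => by
    show ‖R0 f q‖ ≤ 1 * ‖f q‖
    rw [norm_R0, one_mul]; exact tp_le _
  linarith

end
end
end

section
open Set MeasureTheory
open scoped BoundedContinuousFunction
noncomputable section
section
variable {a b : ℝ} [hab : Fact (a < b)]

lemma hda_mul_zero {E : Type*} [NormedCommRing E] [NormedAlgebra ℝ E] {f g : ℝ → E} {g' : E} {q : ℝ}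
    (hf : ContinuousAt f q) (hg : HasDerivAt g g' q) (h0 : g q = 0) :
    HasDerivAt (fun x => f x * g x) (f q * g') q := by
  rw [hasDerivAt_iff_tendsto_slope] at hg ⊢
  have h1 : Filter.Tendsto f (nhdsWithin q {q}ᶜ) (nhds (f q)) := hf.mono_left nhdsWithin_le_nhds
  refine (h1.mul hg).congr fun x => ?_
  simp [slope, h0]

variable {u uq up v vp : FF a b}

lemma EN_deriv (h1 : HQ u uq) (h2 : HQ v up) (h3 : ∀ q, DP (u q) (up q)) (h4 : ∀ q, DP (v q) (vp q))
    (h5 : ∀ q, bt (u q) = 0) (q : ℝ) :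
    HasDerivAt (fun q => IA (up q * v q)) (IA (up q * up q) + tp (uq q) * tp (v q) - IA (uq q * vp q)) q := by
  have e : (fun q' => IA (up q' * v q')) = fun q' => IA (up q' * (v q' - v q)) + tp (u q' - u q) * tp (v q)
      - IA ((u q' - u q) * vp q) + IA (up q * v q) := by
    funext q'
    have := ((h3 q').sub (h3 q)).parts (h4 q)
    rw [map_sub bt, h5, h5, sub_zero, zero_mul, sub_zero, map_add, sub_mul (up q'), map_sub] at this
    rw [mul_sub, map_sub]
    linarith
  rw [e]
  have d1 : HasDerivAt (fun q' => IA (up q' * (v q' - v q))) (IA (up q * up q)) q :=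
    IA.hasFDerivAt.comp_hasDerivAt q (hda_mul_zero up.continuous.continuousAt ((h2 q).sub_const _) (sub_self _))
  have d2 : HasDerivAt (fun q' => tp (u q' - u q) * tp (v q)) (tp (uq q) * tp (v q)) q :=
    (tp.hasFDerivAt.comp_hasDerivAt q ((h1 q).sub_const _)).mul_const _
  have d3 : HasDerivAt (fun q' => IA ((u q' - u q) * vp q)) (IA (uq q * vp q)) q :=
    IA.hasFDerivAt.comp_hasDerivAt q (((h1 q).sub_const _).mul_const _)
  exact ((d1.add d2).sub d3).add_const _

set_option maxHeartbeats 1000000 in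
lemma EN {B G r : FF a b} {c0 : ℝ} (hc0 : 0 < c0)
    (h1 : HQ u uq) (h2 : HQ v up) (h3 : ∀ q, DP (u q) (up q)) (h4 : ∀ q, DP (v q) (vp q))
    (h5 : ∀ q, bt (u q) = 0) (h6 : vp = (2:ℝ) • (B * up) - G * uq + r)
    (h7 : ∀ q p (X Y : ℝ), c0 * (X ^ 2 + Y ^ 2) ≤ G q p * X ^ 2 - 2 * B q p * X * Y + Y ^ 2) :
    (m2 a b).U uq ^ 2 + (m2 a b).U up ^ 2 ≤ 2 * ((6 / c0) * ((1 / c0) * (m2 a b).U r ^ 2 + (9 / (2 * c0)) * (m2 a b).U v ^ 2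
      + 2 * ((nmd (AA a b)).U (R0 uq) * (nmd (AA a b)).U (R0 v)))) := by
  set K := (1 / c0) * (m2 a b).U r ^ 2 + (9 / (2 * c0)) * (m2 a b).U v ^ 2
      + 2 * ((nmd (AA a b)).U (R0 uq) * (nmd (AA a b)).U (R0 v)) with hK
  have n1 := (nmd (AA a b)).U_nn (R0 uq)
  have n2 := (nmd (AA a b)).U_nn (R0 v)
  have K0 : 0 ≤ K := by positivity
  -- pointwise
  set N : ℝ → ℝ := fun q => IA (up q * v q) with hN
  set N' : ℝ → ℝ := fun q => IA (up q * up q) + tp (uq q) * tp (v q) - IA (uq q * vp q) with hN'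
  have hNd : ∀ q, HasDerivAt N (N' q) q := EN_deriv h1 h2 h3 h4 h5
  set x : ℝ → ℝ := fun q => (m2 a b).m (uq q)
  set y : ℝ → ℝ := fun q => (m2 a b).m (up q)
  set e : ℝ → ℝ := fun q => (m2 a b).m (r q)
  set f : ℝ → ℝ := fun q => (m2 a b).m (v q)
  set t : ℝ → ℝ := fun q => ‖R0 uq q‖
  set s : ℝ → ℝ := fun q => ‖R0 v q‖
  have cx : Continuous x := (m2 a b).cm uq
  have cy : Continuous y := (m2 a b).cm up
  have ce : Continuous e := (m2 a b).cm r
  have cf : Continuous f := (m2 a b).cm v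
  have ct : Continuous t := (R0 uq).continuous.norm
  have cs : Continuous s := (R0 v).continuous.norm
  have cN' : Continuous N' := by
    have := up.continuous; have := uq.continuous; have := v.continuous; have := vp.continuous
    exact ((IA.continuous.comp (by fun_prop)).add ((tp.continuous.comp (by fun_prop)).mul (tp.continuous.comp (by fun_prop)))).sub
      (IA.continuous.comp (by fun_prop))
  have hN1 : ∀ q, |N q| ≤ y q * f q := fun q => IA_cs' _ _
  have hpw : ∀ q, c0 * (x q ^ 2 + y q ^ 2) ≤ N' q + t q * s q + x q * e q := by
    intro q
    have a1 : c0 * (x q ^ 2 + y q ^ 2) ≤ IA (up q * up q - uq q * vp q + uq q * r q) := by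
      have : c0 * (x q ^ 2 + y q ^ 2) = IA (c0 • (uq q * uq q + up q * up q)) := by
        simp only [x, y, m2_sq, map_smul, map_add, smul_eq_mul]
      rw [this]
      apply IA_mono
      intro p
      have h := h7 q p (uq q p) (up q p)
      have h8 : vp q p = 2 * (B q p * up q p) - G q p * uq q p + r q p := by rw [h6]; rfl
      show c0 * (uq q p * uq q p + up q p * up q p) ≤ up q p * up q p - uq q p * vp q p + uq q p * r q p
      rw [h8]; nlinarith
    rw [map_add, map_sub] at a1
    have a2 : |IA (uq q * r q)| ≤ x q * e q := IA_cs' _ _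
    have a3 : |tp (uq q) * tp (v q)| = t q * s q := by
      rw [abs_mul]; simp only [t, s, norm_R0]
    have := (abs_le.1 a3.le).1
    have := (abs_le.1 a2).2
    simp only [hN']; linarith
  have key : ∀ q0 : ℝ, (∫ q in q0..q0 + 1, (x q ^ 2 + y q ^ 2)) ≤ 6 / c0 * K := by
    intro q0
    set V : ℝ → ℝ := fun q => (q - q0 + 1) * (q0 + 2 - q)
    set V' : ℝ → ℝ := fun q => (q0 + 2 - q) - (q - q0 + 1)
    have cV : Continuous V := by fun_prop
    have cV' : Continuous V' := by fun_prop
    have hV : ∀ q, HasDerivAt V (V' q) q := by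
      intro q
      have := (((hasDerivAt_id q).sub_const q0).add_const 1).mul ((hasDerivAt_id q).const_sub (q0 + 2))
      refine this.congr_deriv ?_
      simp only [id, V']; ring
    have hw : ∀ q, HasDerivAt (fun q => V q ^ 2 / 4 * N q) (V q * V' q / 2 * N q + V q ^ 2 / 4 * N' q) q := by
      intro q
      have := (((hV q).pow 2).div_const 4).mul (hNd q)
      refine this.congr_deriv ?_
      simp only [Pi.pow_apply]; push_cast; ring
    have cN : Continuous N := continuous_iff_continuousAt.2 fun q => (hNd q).continuousAt
    have cw : Continuous fun q => V q * V' q / 2 * N q + V q ^ 2 / 4 * N' q := by fun_prop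
    have hI := intervalIntegral.integral_eq_sub_of_hasDerivAt (a := q0 - 1) (b := q0 + 2) (fun q _ => hw q) (cw.intervalIntegrable _ _)
    have hI0 : (∫ q in (q0 - 1)..(q0 + 2), (V q * V' q / 2 * N q + V q ^ 2 / 4 * N' q)) = 0 := by
      rw [hI]; simp only [V]; ring
    set R : ℝ → ℝ := fun q => 1 / c0 * e q ^ 2 + 9 / (2 * c0) * f q ^ 2 + 2 * (t q * s q)
    have cR : Continuous R := by fun_prop
    have pw2 : ∀ q ∈ Icc (q0 - 1) (q0 + 2), c0 / 2 * (V q ^ 2 / 4 * (x q ^ 2 + y q ^ 2)) ≤ (V q * V' q / 2 * N q + V q ^ 2 / 4 * N' q) + R q := by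
      intro q hq
      have V0 : 0 ≤ V q := mul_nonneg (by linarith [hq.1]) (by linarith [hq.2])
      have V1 : V q ^ 2 / 4 ≤ 2 := by
        have : V q ≤ 9 / 4 := by simp only [V]; nlinarith [sq_nonneg (q - q0 - 1 / 2)]
        nlinarith
      have V2 : |V' q| ≤ 3 := abs_le.2 ⟨by simp only [V']; linarith [hq.2], by simp only [V']; linarith [hq.1]⟩
      have x0 : 0 ≤ x q := (m2 a b).nn _
      have y0 : 0 ≤ y q := (m2 a b).nn _
      have e0 : 0 ≤ e q := (m2 a b).nn _
      have f0 : 0 ≤ f q := (m2 a b).nn _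
      have ts : 0 ≤ t q * s q := mul_nonneg (norm_nonneg _) (norm_nonneg _)
      have b1 : |V q * V' q / 2 * N q| ≤ V q * 3 / 2 * (y q * f q) := by
        rw [abs_mul, abs_div, abs_mul, abs_of_nonneg V0, abs_two]
        have := hN1 q
        gcongr
      have b2 : V q * 3 / 2 * (y q * f q) ≤ c0 / 2 * (V q ^ 2 / 4 * y q ^ 2) + 9 / (2 * c0) * f q ^ 2 := by
        have : c0 / 2 * (V q ^ 2 / 4 * y q ^ 2) + 9 / (2 * c0) * f q ^ 2 - V q * 3 / 2 * (y q * f q) = 1 / (8 * c0) * (c0 * V q * y q - 6 * f q) ^ 2 := by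
          field_simp; ring
        have : 0 ≤ 1 / (8 * c0) * (c0 * V q * y q - 6 * f q) ^ 2 := by positivity
        linarith
      have b3 : x q * e q ≤ c0 / 2 * x q ^ 2 + 1 / (2 * c0) * e q ^ 2 := by
        have : c0 / 2 * x q ^ 2 + 1 / (2 * c0) * e q ^ 2 - x q * e q = 1 / (2 * c0) * (c0 * x q - e q) ^ 2 := by
          field_simp; ring
        have : 0 ≤ 1 / (2 * c0) * (c0 * x q - e q) ^ 2 := by positivity
        linarith
      have b4 := hpw q
      have b5 : V q ^ 2 / 4 * (c0 * (x q ^ 2 + y q ^ 2)) ≤ V q ^ 2 / 4 * (N' q + t q * s q + (c0 / 2 * x q ^ 2 + 1 / (2 * c0) * e q ^ 2)) :=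
        mll (by linarith) (by positivity)
      have b6 : V q ^ 2 / 4 * (t q * s q) ≤ 2 * (t q * s q) := mlr V1 ts
      have b7 : V q ^ 2 / 4 * (1 / (2 * c0) * e q ^ 2) ≤ 2 * (1 / (2 * c0) * e q ^ 2) := mlr V1 (by positivity)
      have b8 : 2 * (1 / (2 * c0) * e q ^ 2) = 1 / c0 * e q ^ 2 := by field_simp
      have := (abs_le.1 b1).1
      simp only [R]
      linarith
    have cxy : Continuous fun q => c0 / 2 * (V q ^ 2 / 4 * (x q ^ 2 + y q ^ 2)) := by fun_prop
    have hint := intervalIntegral.integral_mono_on (μ := volume) (by linarith : q0 - 1 ≤ q0 + 2) (cxy.intervalIntegrable _ _)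
      ((cw.add cR).intervalIntegrable _ _) pw2
    have hadd : (∫ q in (q0 - 1)..(q0 + 2), (V q * V' q / 2 * N q + V q ^ 2 / 4 * N' q + R q)) = ∫ q in (q0 - 1)..(q0 + 2), R q := by
      rw [intervalIntegral.integral_add (cw.intervalIntegrable _ _) (cR.intervalIntegrable _ _), hI0, zero_add]
    change _ ≤ ∫ q in (q0 - 1)..(q0 + 2), (V q * V' q / 2 * N q + V q ^ 2 / 4 * N' q + R q) at hint
    rw [hadd] at hint
    have hR1 : ∀ z : ℝ, (∫ q in z..z + 1, R q) ≤ K := by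
      intro z
      have i1 : (∫ q in z..z + 1, e q ^ 2) ≤ (m2 a b).U r ^ 2 := (m2 a b).int_le r z
      have i2 : (∫ q in z..z + 1, f q ^ 2) ≤ (m2 a b).U v ^ 2 := (m2 a b).int_le v z
      have i3 : |∫ q in z..z + 1, t q * s q| ≤ (nmd (AA a b)).U (R0 uq) * (nmd (AA a b)).U (R0 v) := by
        refine (cs_int' ct cs (by linarith)).trans ?_
        exact mul_le_mul ((nmd (AA a b)).Uq_le (R0 uq) z) ((nmd (AA a b)).Uq_le (R0 v) z) (Real.sqrt_nonneg _) n1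
      have : (∫ q in z..z + 1, R q) = 1 / c0 * (∫ q in z..z + 1, e q ^ 2) + 9 / (2 * c0) * (∫ q in z..z + 1, f q ^ 2)
          + 2 * (∫ q in z..z + 1, t q * s q) := by
        simp only [R]
        rw [intervalIntegral.integral_add, intervalIntegral.integral_add, intervalIntegral.integral_const_mul,
          intervalIntegral.integral_const_mul, intervalIntegral.integral_const_mul]
        all_goals exact Continuous.intervalIntegrable (by fun_prop) _ _
      rw [this, hK]
      have := (le_abs_self _).trans i3
      gcongr
    have hR3 : (∫ q in (q0 - 1)..(q0 + 2), R q) ≤ 3 * K := by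
      have j1 := intervalIntegral.integral_add_adjacent_intervals (cR.intervalIntegrable (μ := volume) (q0 - 1) q0) (cR.intervalIntegrable q0 (q0 + 2))
      have j2 := intervalIntegral.integral_add_adjacent_intervals (cR.intervalIntegrable (μ := volume) q0 (q0 + 1)) (cR.intervalIntegrable (q0 + 1) (q0 + 2))
      have k1 := hR1 (q0 - 1)
      have k2 := hR1 q0
      have k3 := hR1 (q0 + 1)
      rw [show q0 - 1 + 1 = q0 by ring] at k1
      rw [show q0 + 1 + 1 = q0 + 2 by ring] at k3
      linarith
    have hlow : c0 / 2 * (∫ q in q0..q0 + 1, (x q ^ 2 + y q ^ 2)) ≤ ∫ q in (q0 - 1)..(q0 + 2), c0 / 2 * (V q ^ 2 / 4 * (x q ^ 2 + y q ^ 2)) := by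
      rw [← intervalIntegral.integral_const_mul]
      refine (intervalIntegral.integral_mono_on (μ := volume) (g := fun q => c0 / 2 * (V q ^ 2 / 4 * (x q ^ 2 + y q ^ 2))) (by linarith) ?_ (cxy.intervalIntegrable _ _) ?_).trans ?_
      · exact Continuous.intervalIntegrable (by fun_prop) _ _
      · intro q hq
        have : 2 ≤ V q := by simp only [V]; nlinarith [hq.1, hq.2]
        have : 1 ≤ V q ^ 2 / 4 := by nlinarith
        have : x q ^ 2 + y q ^ 2 ≤ V q ^ 2 / 4 * (x q ^ 2 + y q ^ 2) := le_mul_of_one_le_left (by positivity) this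
        gcongr
      · apply intervalIntegral.integral_mono_interval (by linarith) (by linarith) (by linarith)
        · exact Filter.Eventually.of_forall fun q => by simp only [Pi.zero_apply]; positivity
        · exact cxy.intervalIntegrable _ _
    have : c0 / 2 * (∫ q in q0..q0 + 1, (x q ^ 2 + y q ^ 2)) ≤ 3 * K := by linarith
    calc _ = 2 / c0 * (c0 / 2 * (∫ q in q0..q0 + 1, (x q ^ 2 + y q ^ 2))) := by field_simp
      _ ≤ 2 / c0 * (3 * K) := by gcongr
      _ = _ := by ring
  have P0 : 0 ≤ 6 / c0 * K := by positivity
  have f1 : (m2 a b).U uq ≤ √(6 / c0 * K) := by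
    refine (m2 a b).U_le_of (Real.sqrt_nonneg _) fun q0 => ?_
    rw [Real.sq_sqrt P0]
    refine le_trans ?_ (key q0)
    refine intervalIntegral.integral_mono_on (by linarith) ?_ ?_ ?_
    · exact (cx.pow 2).intervalIntegrable _ _
    · exact Continuous.intervalIntegrable (by fun_prop) _ _
    · intro q _; exact le_add_of_nonneg_right (sq_nonneg _)
  have f2 : (m2 a b).U up ≤ √(6 / c0 * K) := by
    refine (m2 a b).U_le_of (Real.sqrt_nonneg _) fun q0 => ?_
    rw [Real.sq_sqrt P0]
    refine le_trans ?_ (key q0)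
    refine intervalIntegral.integral_mono_on (by linarith) ?_ ?_ ?_
    · exact (cy.pow 2).intervalIntegrable _ _
    · exact Continuous.intervalIntegrable (by fun_prop) _ _
    · intro q _; exact le_add_of_nonneg_left (sq_nonneg _)
  have g1 := pow_le_pow_left₀ ((m2 a b).U_nn _) f1 2
  have g2 := pow_le_pow_left₀ ((m2 a b).U_nn _) f2 2
  rw [Real.sq_sqrt P0] at g1 g2
  linarith
end
end
end

section
open Set MeasureTheory
open scoped BoundedContinuousFunction
noncomputable section
section
variable {E : Type*} [NormedCommRing E] [NormedAlgebra ℝ E]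

lemma Md.S_add (M : Md E) (f g : ℝ →ᵇ E) : M.S (f + g) ≤ M.S f + M.S g :=
  ciSup_le fun q => (map_add_le_add M.m (f q) (g q)).trans (add_le_add (M.le_S f q) (M.le_S g q))
lemma Md.S_mul (M : Md E) (f g : ℝ →ᵇ E) : M.S (f * g) ≤ ‖f‖ * M.S g :=
  ciSup_le fun q => (M.mul (f q) (g q)).trans
    (mul_le_mul (f.norm_coe_le_norm q) (M.le_S g q) (M.nn _) (norm_nonneg _))
lemma Md.S_le_nmd (M : Md E) (f : ℝ →ᵇ E) : M.S f ≤ M.c * (nmd E).S f := by rw [Md.nmd_S]; exact M.S_le f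
lemma Md.S_smul_le (M : Md E) (c : ℝ) (f : ℝ →ᵇ E) : M.S (c • f) ≤ |c| * M.S f :=
  ciSup_le fun q => by
    have : M.m ((c • f) q) = |c| * M.m (f q) := by
      show M.m (c • f q) = _
      rw [map_smul_eq_mul]; rfl
    rw [this]; exact mll (M.le_S f q) (abs_nonneg _)
lemma Md.U_Tl (M : Md E) (l : List (Ioc (0:ℝ) 1)) (f : ℝ →ᵇ E) : M.U ((dOps E).Tl l f) = M.U f := by
  induction l generalizing f with
  | nil => rfl
  | cons τ l ih => exact (ih _).trans (M.U_Tr _ f)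
lemma Md.S_Tl (M : Md E) (l : List (Ioc (0:ℝ) 1)) (f : ℝ →ᵇ E) : M.S ((dOps E).Tl l f) = M.S f := by
  induction l generalizing f with
  | nil => rfl
  | cons τ l ih => exact (ih _).trans (M.S_Tr _ f)
lemma norm_Tl (l : List (Ioc (0:ℝ) 1)) (f : ℝ →ᵇ E) : ‖(dOps E).Tl l f‖ = ‖f‖ := by
  rw [← Md.nmd_S, ← Md.nmd_S, Md.S_Tl]

structure CW (M : Md E) (K : ℕ) (r C : ℝ) (w : ℝ →ᵇ E) : Prop where
  nn : 0 ≤ C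
  nrm : ‖w‖ ≤ C
  mid : ∀ τ l, l.length ≤ K → M.U (DD l ((dOps E).δ τ w)) ≤ C * xw r l.length
  sup : ∀ l : List (Ioc (0:ℝ) 1), l.length ≤ K → M.S (DD l w) ≤ C * xw r l.length

variable {M : Md E} {K : ℕ} {r : ℝ}

lemma CW.mono {C C' : ℝ} {w : ℝ →ᵇ E} (hr : 1 ≤ r) (h : CW M K r C w) (hC : C ≤ C') : CW M K r C' w :=
  ⟨h.nn.trans hC, h.nrm.trans hC, fun τ l hl => (h.mid τ l hl).trans (mlr hC (xw_pos hr _).le),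
   fun l hl => (h.sup l hl).trans (mlr hC (xw_pos hr _).le)⟩

lemma CW.of_nmd {C : ℝ} {w : ℝ →ᵇ E} (hr : 1 ≤ r) (h : CW (nmd E) K r C w) : CW M K r ((1 + M.c) * C) w := by
  have := h.nn; have := M.c0
  refine ⟨by positivity, h.nrm.trans (by nlinarith), fun τ l hl => ?_, fun l hl => ?_⟩
  · have h1 := h.mid τ l hl
    have h2 := M.U_le_nmd (DD l ((dOps E).δ τ w))
    have h3 := mll h1 M.c0
    have h4 : 0 ≤ C * xw r l.length := mul_nonneg h.nn (xw_pos hr _).le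
    nlinarith
  · have h1 := h.sup l hl
    have h2 := M.S_le_nmd (DD l w)
    have h3 := mll h1 M.c0
    have h4 : 0 ≤ C * xw r l.length := mul_nonneg h.nn (xw_pos hr _).le
    nlinarith

lemma CW.add {C C' : ℝ} {u w : ℝ →ᵇ E} (h : CW M K r C u) (h' : CW M K r C' w) : CW M K r (C + C') (u + w) := by
  refine ⟨add_nonneg h.nn h'.nn, (norm_add_le _ _).trans (add_le_add h.nrm h'.nrm), fun τ l hl => ?_, fun l hl => ?_⟩
  · rw [map_add, map_add, add_mul]
    exact (M.U_add _ _).trans (add_le_add (h.mid τ l hl) (h'.mid τ l hl))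
  · rw [map_add, add_mul]
    exact (M.S_add _ _).trans (add_le_add (h.sup l hl) (h'.sup l hl))

lemma CW.smul {C : ℝ} {u : ℝ →ᵇ E} (h : CW M K r C u) (c : ℝ) : CW M K r (|c| * C) (c • u) := by
  refine ⟨mul_nonneg (abs_nonneg _) h.nn, ?_, fun τ l hl => ?_, fun l hl => ?_⟩
  · rw [norm_smul]; exact mll h.nrm (abs_nonneg _)
  · rw [map_smul, map_smul, mul_assoc]
    exact (M.U_smul_le _ _).trans (mll (h.mid τ l hl) (abs_nonneg _))
  · rw [map_smul, mul_assoc]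
    exact (M.S_smul_le _ _).trans (mll (h.sup l hl) (abs_nonneg _))

lemma conv_w (hr : 1 ≤ r) {n1 n2 n3 : (ℝ →ᵇ E) → ℝ} (h3 : ∀ f g, n3 (f + g) ≤ n3 f + n3 g)
    (h12 : ∀ f g, n3 (f * g) ≤ n1 f * n2 g) (hn1 : ∀ f, 0 ≤ n1 f)
    (hn2 : ∀ f, 0 ≤ n2 f) (hT : ∀ τ g, n2 (Tr τ g) = n2 g) {C1 C2 : ℝ} (hC1 : 0 ≤ C1) (hC2 : 0 ≤ C2)
    (l : List (Ioc (0:ℝ) 1)) (hl : l.length ≤ K) (f g : ℝ →ᵇ E)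
    (hx : ∀ l : List (Ioc (0:ℝ) 1), l.length ≤ K → n1 (DD l f) ≤ C1 * xw r l.length)
    (hy : ∀ l : List (Ioc (0:ℝ) 1), l.length ≤ K → n2 (DD l g) ≤ C2 * xw r l.length) :
    n3 (DD l (f * g)) ≤ 10 * (C1 * C2) * xw r l.length := by
  refine ((dOps E).conv_bound h3 h12 hn1 hn2 (fun i g => hT _ g) l f g (fun i => C1 * xw r i) (fun i => C2 * xw r i)
    (fun l' h => hx l' (h.length_le.trans hl)) (fun l' h => hy l' (h.length_le.trans hl))).trans ?_
  rw [cv_smul]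
  have := mll (cv_xw hr l.length) (mul_nonneg hC1 hC2)
  linarith

lemma mid_w (hr : 1 ≤ r) {n1 n2 n3 : (ℝ →ᵇ E) → ℝ} (h3 : ∀ f g, n3 (f + g) ≤ n3 f + n3 g) (h30 : n3 0 ≤ 0)
    (h12 : ∀ f g, n3 (f * g) ≤ n1 f * n2 g) (hn1 : ∀ f, 0 ≤ n1 f)
    (hn2 : ∀ f, 0 ≤ n2 f) (hT : ∀ τ g, n2 (Tr τ g) = n2 g) {C1 C2 : ℝ} (hC1 : 0 ≤ C1) (hC2 : 0 ≤ C2)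
    (l : List (Ioc (0:ℝ) 1)) (hl : l.length = K + 1) (f g : ℝ →ᵇ E)
    (hx : ∀ l : List (Ioc (0:ℝ) 1), l.length ≤ K → n1 (DD l f) ≤ C1 * xw r l.length)
    (hy : ∀ l : List (Ioc (0:ℝ) 1), l.length ≤ K → n2 (DD l g) ≤ C2 * xw r l.length) :
    n3 (DD l (f * g) - f * DD l g - DD l f * (dOps E).Tl l g) ≤ 8 * (C1 * C2) * (ew r (K + 1) * xw r (K + 1)) := by
  refine ((dOps E).mid_bound h3 h30 h12 hn1 hn2 (fun i g => hT _ g) l (by omega) f g (fun i => C1 * xw r i) (fun i => C2 * xw r i)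
    (fun l' _ h => hx l' (by omega)) (fun l' _ h => hy l' (by omega))).trans ?_
  have e : ∀ c : ℝ, z0 (fun i => c * xw r i) = fun i => c * z0 (xw r) i := by
    intro c; funext i; simp [z0]
  rw [e, e, cv_smul, hl]
  have := mll (cv_mid_xw hr (K + 1)) (mul_nonneg hC1 hC2)
  linarith

lemma CW.mul {C C' : ℝ} {u w : ℝ →ᵇ E} (hr : 1 ≤ r) (h : CW (nmd E) K r C u) (h' : CW M K r C' w) :
    CW M K r (20 * (C * C')) (u * w) := by
  have n1 := h.nn; have n2 := h'.nn; have n3 : 0 ≤ C * C' := mul_nonneg n1 n2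
  refine ⟨by positivity, ?_, fun τ l hl => ?_, fun l hl => ?_⟩
  · refine (norm_mul_le _ _).trans ((mul_le_mul h.nrm h'.nrm (norm_nonneg _) n1).trans (by linarith))
  · rw [(dOps E).leib, map_add]
    refine (M.U_add _ _).trans ?_
    have a1 := conv_w (K := K) hr (n1 := fun f => ‖f‖) (n2 := M.U) (n3 := M.U) M.U_add M.U_mul (fun _ => norm_nonneg _) M.U_nn
      M.U_Tr n1 n2 l hl u ((dOps E).δ τ w) (fun l hl => by rw [← Md.nmd_S]; exact h.sup l hl) (fun l hl => h'.mid τ l hl)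
    have a2 := conv_w (K := K) hr (n1 := (nmd E).U) (n2 := M.S) (n3 := M.U) M.U_add M.U_mulS (nmd E).U_nn M.S_nn
      M.S_Tr n1 n2 l hl ((dOps E).δ τ u) ((dOps E).T τ w) (fun l hl => h.mid τ l hl)
      (fun l hl => by rw [(dOps E).D_T]; exact (M.S_Tr _ _).le.trans (h'.sup l hl))
    linarith
  · have := conv_w (K := K) hr (n1 := fun f => ‖f‖) (n2 := M.S) (n3 := M.S) M.S_add M.S_mul (fun _ => norm_nonneg _) M.S_nn
      M.S_Tr n1 n2 l hl u w (fun l hl => by rw [← Md.nmd_S]; exact h.sup l hl) h'.sup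
    have : 0 ≤ (C * C') * xw r l.length := mul_nonneg n3 (xw_pos hr _).le
    linarith

lemma CW.rem {C C' : ℝ} {u w : ℝ →ᵇ E} (hr : 1 ≤ r) (h : CW (nmd E) K r C u) (hd : ∀ τ, ‖(dOps E).δ τ u‖ ≤ C) (h' : CW M K r C' w)
    (τ : Ioc (0:ℝ) 1) (l : List (Ioc (0:ℝ) 1)) (hl : l.length = K + 1) :
    M.U (DD (τ :: l) (u * w) - u * DD (τ :: l) w) ≤ C' * M.U (DD (τ :: l) u) + 24 * (C * C') * (ew r (K + 1) * xw r (K + 1)) := by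
  have n1 := h.nn; have n2 := h'.nn; have n3 : 0 ≤ C * C' := mul_nonneg n1 n2
  have hx := xw_pos hr (K + 1)
  have he := ew_pos hr (K + 1)
  have hp := xw_pred hr K
  set X := ew r (K + 1) * xw r (K + 1) with hX
  have X0 : 0 < X := mul_pos he hx
  simp only [Ops.D_cons]
  rw [(dOps E).leib, map_add]
  have a1 := mid_w (K := K) hr (n1 := fun f => ‖f‖) (n2 := M.U) (n3 := M.U) M.U_add M.U_zero.le M.U_mul (fun _ => norm_nonneg _) M.U_nn
      M.U_Tr n1 n2 l hl u ((dOps E).δ τ w) (fun l hl => by rw [← Md.nmd_S]; exact h.sup l hl) (fun l hl => h'.mid τ l hl)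
  have a2 := mid_w (K := K) hr (n1 := (nmd E).U) (n2 := M.S) (n3 := M.U) M.U_add M.U_zero.le M.U_mulS (nmd E).U_nn M.S_nn
      M.S_Tr n1 n2 l hl ((dOps E).δ τ u) ((dOps E).T τ w) (fun l hl => h.mid τ l hl)
      (fun l hl => by rw [(dOps E).D_T]; exact (M.S_Tr _ _).le.trans (h'.sup l hl))
  have b1 : M.U (DD l u * (dOps E).Tl l ((dOps E).δ τ w)) ≤ 4 * (C * C') * X := by
    rcases K with _ | K
    · obtain ⟨τ', rfl⟩ := List.length_eq_one_iff.1 hl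
      refine (M.U_mul _ _).trans ?_
      rw [M.U_Tl]
      have c1 := hd τ'
      have c2 := h'.mid τ [] (by simp)
      simp only [List.length_nil, xw_zero, mul_one, Ops.D_nil] at c2
      have c3 : 1 ≤ 4 * X := by rw [xw_zero] at hp; exact hp
      calc _ ≤ C * C' := mul_le_mul c1 c2 (M.U_nn _) n1
        _ ≤ (C * C') * (4 * X) := le_mul_of_one_le_right n3 c3
        _ = _ := by ring
    · refine (M.U_mulS _ _).trans ?_
      rw [M.S_Tl]
      have c2 := h'.sup [τ] (by simp)
      simp only [Ops.D_cons, Ops.D_nil, List.length_singleton, xw_one] at c2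
      obtain ⟨τ', l', rfl⟩ := List.exists_cons_of_length_eq_add_one hl
      have c1 := h.mid τ' l' (by simpa using (Nat.le_of_lt_succ (by simpa using hl.le)))
      have hl' : l'.length = K + 1 := by simpa using hl
      rw [hl'] at c1
      calc _ ≤ (C * xw r (K + 1)) * (C' * (1 / 4)) := mul_le_mul c1 c2 (M.S_nn _) (mul_nonneg n1 (xw_pos hr _).le)
        _ = (C * C') * (1 / 4 * xw r (K + 1)) := by ring
        _ ≤ (C * C') * (4 * X) := by
          apply mll _ n3
          have := xw_pos hr (K + 1)
          linarith
        _ = _ := by ring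
  have b2 : M.U ((dOps E).δ τ u * DD l ((dOps E).T τ w)) ≤ 4 * (C * C') * X := by
    refine (M.U_mul _ _).trans ?_
    rw [(dOps E).D_T]
    obtain ⟨τ', l', rfl⟩ := List.exists_cons_of_length_eq_add_one hl
    have hl' : l'.length = K := by simpa using hl
    have c1 := h'.mid τ' l' hl'.le
    rw [hl'] at c1
    calc _ ≤ C * (C' * xw r K) := mul_le_mul (hd τ) ((M.U_Tr _ _).le.trans c1) (M.U_nn _) n1
      _ = (C * C') * xw r K := by ring
      _ ≤ (C * C') * (4 * X) := mll hp n3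
      _ = _ := by ring
  have b3 : M.U (DD l ((dOps E).δ τ u) * (dOps E).Tl l ((dOps E).T τ w)) ≤ C' * M.U (DD l ((dOps E).δ τ u)) := by
    refine (M.U_mul' _ _).trans ?_
    rw [norm_Tl, mul_comm]
    exact mlr ((Md.norm_Tr _ w).le.trans h'.nrm) (M.U_nn _)
  have e : DD l (u * (dOps E).δ τ w) + DD l ((dOps E).δ τ u * (dOps E).T τ w) - u * DD l ((dOps E).δ τ w)
     = (DD l (u * (dOps E).δ τ w) - u * DD l ((dOps E).δ τ w) - DD l u * (dOps E).Tl l ((dOps E).δ τ w))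
      + (DD l ((dOps E).δ τ u * (dOps E).T τ w) - (dOps E).δ τ u * DD l ((dOps E).T τ w) - DD l ((dOps E).δ τ u) * (dOps E).Tl l ((dOps E).T τ w))
      + DD l u * (dOps E).Tl l ((dOps E).δ τ w) + (dOps E).δ τ u * DD l ((dOps E).T τ w)
      + DD l ((dOps E).δ τ u) * (dOps E).Tl l ((dOps E).T τ w) := by ring
  rw [e]
  refine ((M.U_add _ _).trans (add_le_add ((M.U_add _ _).trans (add_le_add ((M.U_add _ _).trans (add_le_add (M.U_add _ _) le_rfl)) le_rfl)) le_rfl)).trans ?_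
  linarith
end
end
end

section
open Set MeasureTheory
open scoped BoundedContinuousFunction
noncomputable section
section
variable {E : Type*} [NormedCommRing E] [NormedAlgebra ℝ E] [CompleteSpace E]

def UW (P : ℝ → ℕ → Prop) (M : Md E) (w : ℝ →ᵇ E) : Prop := ∃ C, ∀ r K, 1 ≤ r → P r K → CW M K r C w
def DB (u : ℝ →ᵇ E) : Prop := ∃ C, ∀ τ, ‖(dOps E).δ τ u‖ ≤ C
def XX (r : ℝ) (K : ℕ) : ℝ := ew r (K + 1) * xw r (K + 1)
def UT (P : ℝ → ℕ → Prop) (M : Md E) (w : ℝ →ᵇ E) : Prop :=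
  ∃ C, ∀ r K, 1 ≤ r → P r K → ∀ l : List (Ioc (0:ℝ) 1), l.length = K + 2 → M.U (DD l w) ≤ C * XX r K

lemma XX_pos {r : ℝ} (hr : 1 ≤ r) (K : ℕ) : 0 < XX r K := mul_pos (ew_pos hr _) (xw_pos hr _)

variable {P : ℝ → ℕ → Prop} {M : Md E} {u v w : ℝ →ᵇ E}

lemma UW.add (h : UW P M u) (h' : UW P M w) : UW P M (u + w) := by
  obtain ⟨C, h⟩ := h; obtain ⟨C', h'⟩ := h'
  exact ⟨C + C', fun r K hr hP => (h r K hr hP).add (h' r K hr hP)⟩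
lemma UW.smul (h : UW P M u) (c : ℝ) : UW P M (c • u) := by
  obtain ⟨C, h⟩ := h
  exact ⟨|c| * C, fun r K hr hP => (h r K hr hP).smul c⟩
lemma UW.mul (h : UW P (nmd E) u) (h' : UW P M w) : UW P M (u * w) := by
  obtain ⟨C, h⟩ := h; obtain ⟨C', h'⟩ := h'
  exact ⟨20 * (C * C'), fun r K hr hP => (h r K hr hP).mul hr (h' r K hr hP)⟩
lemma UW.of_nmd (h : UW P (nmd E) u) : UW P M u := by
  obtain ⟨C, h⟩ := h
  exact ⟨(1 + M.c) * C, fun r K hr hP => (h r K hr hP).of_nmd hr⟩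

lemma DB.add (h : DB u) (h' : DB w) : DB (u + w) := by
  obtain ⟨C, h⟩ := h; obtain ⟨C', h'⟩ := h'
  exact ⟨C + C', fun τ => by rw [map_add]; exact (norm_add_le _ _).trans (add_le_add (h τ) (h' τ))⟩
lemma DB.smul (h : DB u) (c : ℝ) : DB (c • u) := by
  obtain ⟨C, h⟩ := h
  exact ⟨|c| * C, fun τ => by rw [map_smul, norm_smul]; exact mll (h τ) (abs_nonneg _)⟩
lemma DB.mul (h : DB u) (h' : DB w) : DB (u * w) := by
  obtain ⟨C, h⟩ := h; obtain ⟨C', h'⟩ := h'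
  refine ⟨‖u‖ * C' + C * ‖w‖, fun τ => ?_⟩
  rw [(dOps E).leib]
  refine (norm_add_le _ _).trans (add_le_add ((norm_mul_le _ _).trans ?_) ((norm_mul_le _ _).trans ?_))
  · exact mll (h' τ) (norm_nonneg _)
  · exact mul_le_mul (h τ) (Md.norm_Tr _ w).le (norm_nonneg _) ((norm_nonneg _).trans (h τ))
lemma DB.of_HQ (h : HQ u v) : DB u := ⟨‖v‖, fun τ => h.norm_δ τ⟩

lemma UT.add (h : UT P M u) (h' : UT P M w) : UT P M (u + w) := by
  obtain ⟨C, h⟩ := h; obtain ⟨C', h'⟩ := h'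
  exact ⟨C + C', fun r K hr hP l hl => by
    rw [map_add, add_mul]; exact (M.U_add _ _).trans (add_le_add (h r K hr hP l hl) (h' r K hr hP l hl))⟩
lemma UT.smul (h : UT P M u) (c : ℝ) : UT P M (c • u) := by
  obtain ⟨C, h⟩ := h
  exact ⟨|c| * C, fun r K hr hP l hl => by
    rw [map_smul, mul_assoc]; exact (M.U_smul_le _ _).trans (mll (h r K hr hP l hl) (abs_nonneg _))⟩

lemma U_rem (h : UW P (nmd E) u) (hd : DB u) (h' : UW P M w) :
    ∃ C, 0 ≤ C ∧ ∀ r K, 1 ≤ r → P r K → ∀ l : List (Ioc (0:ℝ) 1), l.length = K + 2 →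
      M.U (DD l (u * w) - u * DD l w) ≤ C * M.U (DD l u) + C * XX r K := by
  obtain ⟨C, h⟩ := h; obtain ⟨C', h'⟩ := h'; obtain ⟨C'', hd⟩ := hd
  refine ⟨|C'| + 24 * (|max C C''| * |C'|), by positivity, fun r K hr hP l hl => ?_⟩
  obtain ⟨τ, l', rfl⟩ := List.exists_cons_of_length_eq_add_one hl
  have := ((h r K hr hP).mono hr (le_max_left C C'')).rem hr (fun τ => (hd τ).trans (le_max_right _ _)) (h' r K hr hP) τ l' (by simpa using hl)
  refine this.trans (add_le_add (mlr ?_ (M.U_nn _)) (mlr ?_ (XX_pos hr K).le))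
  all_goals
    have a0 : 0 ≤ C' := (h' r K hr hP).nn
    have a1 : 0 ≤ max C C'' := (h r K hr hP).nn.trans (le_max_left _ _)
    rw [abs_of_nonneg a0, abs_of_nonneg a1]
    have := mul_nonneg a1 a0
    linarith

lemma UT.mul (h : UW P (nmd E) u) (hd : DB u) (h' : UW P M w) (t : UT P M u) (t' : UT P M w) : UT P M (u * w) := by
  obtain ⟨C, C0, h⟩ := U_rem h hd h'
  obtain ⟨A, t⟩ := t; obtain ⟨A', t'⟩ := t'
  refine ⟨C * A + C + ‖u‖ * A', fun r K hr hP l hl => ?_⟩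
  have e : DD l (u * w) = (DD l (u * w) - u * DD l w) + u * DD l w := by ring
  rw [e]
  refine (M.U_add _ _).trans ?_
  have h1 := h r K hr hP l hl
  have h2 := mll (t r K hr hP l hl) C0
  have h3 := M.U_mul u (DD l w)
  have h4 := mll (t' r K hr hP l hl) (norm_nonneg u)
  linarith

lemma UT_rem (h : UW P (nmd E) u) (hd : DB u) (h' : UW P M w) (t : UT P M u) :
    ∃ C, 0 ≤ C ∧ ∀ r K, 1 ≤ r → P r K → ∀ l : List (Ioc (0:ℝ) 1), l.length = K + 2 →
      M.U (DD l (u * w) - u * DD l w) ≤ C * XX r K := by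
  obtain ⟨C, C0, h⟩ := U_rem h hd h'
  obtain ⟨A, t⟩ := t
  refine ⟨C * |A| + C, by positivity, fun r K hr hP l hl => ?_⟩
  have h1 := h r K hr hP l hl
  have h2 := mll ((t r K hr hP l hl).trans (mlr (le_abs_self A) (XX_pos hr K).le)) C0
  linarith

lemma UT.of_HQ (h : HQ u v) (hv : UW P M v) : UT P M u := by
  obtain ⟨C, hv⟩ := hv
  refine ⟨4 * C, fun r K hr hP l hl => ?_⟩
  obtain ⟨τ, l1, rfl⟩ := List.exists_cons_of_length_eq_add_one hl
  have hl1 : l1.length = K + 1 := by simpa using hl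
  obtain ⟨τ', l', rfl⟩ := List.exists_cons_of_length_eq_add_one hl1
  have hl' : l'.length = K := by simpa using hl1
  have h0 := hv r K hr hP
  have h1 := h0.mid τ' l' hl'.le
  have h2 : M.U (DD (τ :: τ' :: l') u) ≤ M.U (DD (τ' :: l') v) := by
    have := (h.D (τ' :: l')).U_δ M τ
    rwa [← DD_δ] at this
  rw [hl'] at h1
  have h3 := mll (xw_pred hr K) h0.nn
  refine (h2.trans h1).trans (h3.trans ?_)
  unfold XX; linarith

lemma UW.of_HQ (h : HQ u v) (hv : UW P (nmd E) v) : UW P (nmd E) u := by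
  obtain ⟨C, hv⟩ := hv
  refine ⟨4 * C + ‖u‖, fun r K hr hP => ?_⟩
  have h0 := hv r K hr hP
  have hn := norm_nonneg u
  have hC := h0.nn
  have hx := fun k => xw_pos hr k
  refine ⟨by positivity, by linarith, fun τ l hl => ?_, fun l hl => ?_⟩
  · have h1 := (h.D l).U_δ (nmd E) τ
    rw [← DD_δ] at h1
    refine (h1.trans (Md.U_le_S _ _)).trans ((h0.sup l hl).trans ?_)
    exact mlr (by linarith) (hx _).le
  · rcases l with _ | ⟨τ, l⟩
    · simp only [List.length_nil, xw_zero, mul_one, Ops.D_nil, Md.nmd_S]; linarith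
    · have h1 := (h.D l).S_δ (nmd E) τ
      rw [← DD_δ] at h1
      refine h1.trans ((h0.sup l (by simp at hl; omega)).trans ?_)
      have := mll (xw_pred' hr l.length) hC
      have := mul_nonneg hn (hx (l.length + 1)).le
      rw [List.length_cons]
      linarith

lemma DD_zero_of (h : ∀ τ, (dOps E).δ τ u = 0) (l : List (Ioc (0:ℝ) 1)) (hl : l ≠ []) : DD l u = 0 := by
  rcases l with _ | ⟨τ, l⟩
  · exact absurd rfl hl
  · rw [Ops.D_cons, h, map_zero]

lemma UW.of_const (h : ∀ τ, (dOps E).δ τ u = 0) : UW P (nmd E) u := by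
  refine ⟨‖u‖, fun r K hr hP => ⟨norm_nonneg _, le_rfl, fun τ l hl => ?_, fun l hl => ?_⟩⟩
  · rw [h, map_zero, Md.U_zero]; exact mul_nonneg (norm_nonneg _) (xw_pos hr _).le
  · by_cases hl0 : l = []
    · subst hl0; simp [xw_zero, Md.nmd_S]
    · rw [DD_zero_of h l hl0, Md.nmd_S, norm_zero]; exact mul_nonneg (norm_nonneg _) (xw_pos hr _).le
lemma DB.of_const (h : ∀ τ, (dOps E).δ τ u = 0) : DB u := ⟨0, fun τ => by rw [h, norm_zero]⟩
lemma UT.of_const (h : ∀ τ, (dOps E).δ τ u = 0) : UT P M u := ⟨0, fun r K hr hP l hl => by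
  rw [DD_zero_of h l (by rintro rfl; simp at hl), M.U_zero, zero_mul]⟩
lemma δ_one (τ : Ioc (0:ℝ) 1) : (dOps E).δ τ 1 = 0 := by
  ext q; rw [dOps_δ]; simp

lemma CW.of_mid {K : ℕ} {r C : ℝ} (hr : 1 ≤ r) (hC : 0 ≤ C) (hn : ‖w‖ ≤ C)
    (hm : ∀ τ l, l.length ≤ K → M.U (DD l ((dOps E).δ τ w)) ≤ C * xw r l.length) : CW M K r ((5 + M.c) * C) w := by
  have hc := M.c0
  have hx := fun k => xw_pos hr k
  have hcc := mul_nonneg hc hC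
  refine ⟨by positivity, by nlinarith, fun τ l hl => (hm τ l hl).trans ?_, fun l hl => ?_⟩
  · exact mlr (by nlinarith) (hx _).le
  · have h1 := sob_q M (w := DD l w) (C := C * xw r l.length) (fun τ => by rw [← DD_δ]; exact hm τ l hl)
    refine h1.trans ?_
    rcases l with _ | ⟨τ, l⟩
    · simp only [List.length_nil, xw_zero, mul_one, Ops.D_nil]
      have := (M.U_le w).trans (mll hn hc)
      linarith
    · have h2 := hm τ l (by simp at hl; omega)
      have := mll (xw_pred' hr l.length) hC
      have := mul_nonneg hcc (hx (l.length + 1)).le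
      rw [List.length_cons]
      simp only [Ops.D_cons]
      linarith
end

section
variable {a b : ℝ} [hab : Fact (a < b)]

lemma DP_DD {u v : FF a b} (h : ∀ q, DP (u q) (v q)) (l : List (Ioc (0:ℝ) 1)) (q : ℝ) : DP (DD l u q) (DD l v q) := by
  induction l generalizing u v with
  | nil => exact h q
  | cons τ l ih =>
    refine ih fun q => ?_
    rw [dOps_δ, dOps_δ]
    exact ((h _).sub (h q)).smul _

lemma LI_sob {u v : FF a b} (h : ∀ q, DP (u q) (v q)) {ε : ℝ} (hε : 0 < ε) :
    (nmd (AA a b)).U u ^ 2 ≤ (1 / (b - a) + 1 / ε) * (m2 a b).U u ^ 2 + ε * (m2 a b).U v ^ 2 := by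
  have hba := sub_pos.2 hab.out
  set A := 1 / (b - a) + 1 / ε with hA
  have A0 : 0 ≤ A := by positivity
  set T := A * (m2 a b).U u ^ 2 + ε * (m2 a b).U v ^ 2 with hT
  have T0 : 0 ≤ T := by positivity
  have : (nmd (AA a b)).U u ≤ √T := by
    refine (nmd (AA a b)).U_le_of (Real.sqrt_nonneg _) fun q0 => ?_
    rw [Real.sq_sqrt T0]
    have c1 : Continuous fun q => (m2 a b).m (u q) ^ 2 := ((m2 a b).cm u).pow 2
    have c2 : Continuous fun q => (m2 a b).m (v q) ^ 2 := ((m2 a b).cm v).pow 2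
    have i1 := (m2 a b).int_le u q0
    have i2 := (m2 a b).int_le v q0
    have h1 : (∫ q in q0..q0 + 1, (nmd (AA a b)).m (u q) ^ 2) ≤ ∫ q in q0..q0 + 1, (A * (m2 a b).m (u q) ^ 2 + ε * (m2 a b).m (v q) ^ 2) := by
      refine intervalIntegral.integral_mono_on (by linarith) ?_ ?_ fun q _ => (h q).sob hε
      · exact (((nmd (AA a b)).cm u).pow 2).intervalIntegrable _ _
      · exact ((c1.const_mul A).add (c2.const_mul ε)).intervalIntegrable _ _
    rw [intervalIntegral.integral_add ((c1.const_mul A).intervalIntegrable _ _) ((c2.const_mul ε).intervalIntegrable _ _),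
      intervalIntegral.integral_const_mul, intervalIntegral.integral_const_mul] at h1
    exact h1.trans (add_le_add (mll i1 A0) (mll i2 hε.le))
  have := pow_le_pow_left₀ (Md.U_nn _ _) this 2
  rwa [Real.sq_sqrt T0] at this

lemma LI_sob1 {u v : FF a b} (h : ∀ q, DP (u q) (v q)) :
    (nmd (AA a b)).U u ≤ (1 / (b - a) + 1) * ((m2 a b).U u + (m2 a b).U v) := by
  have hba := sub_pos.2 hab.out
  have h1 := LI_sob h one_pos
  have n1 := (m2 a b).U_nn u
  have n2 := (m2 a b).U_nn v
  have n3 : 0 < 1 / (b - a) := by positivity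
  refine le_of_sq_le_sq ?_ (by positivity)
  rw [div_one] at h1
  refine h1.trans ?_
  set t := 1 / (b - a)
  set X := (m2 a b).U u
  set Y := (m2 a b).U v
  have a1 : (t + 1) * X ^ 2 ≤ (t + 1) ^ 2 * X ^ 2 := mlr (by nlinarith) (sq_nonneg _)
  have a2 : 1 * Y ^ 2 ≤ (t + 1) ^ 2 * Y ^ 2 := mlr (by nlinarith) (sq_nonneg _)
  have a3 : 0 ≤ (t + 1) ^ 2 * (X * Y) := by positivity
  nlinarith

lemma UW.of_DP {P : ℝ → ℕ → Prop} {u v w : FF a b} (h : HQ u v) (h' : ∀ q, DP (u q) (w q))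
    (hv : UW P (m2 a b) v) (hw : UW P (m2 a b) w) : UW P (nmd (AA a b)) u := by
  obtain ⟨C, hv⟩ := hv; obtain ⟨C', hw⟩ := hw
  have hba := sub_pos.2 hab.out
  set A := 1 / (b - a) + 1 with hA
  have A0 : 0 < A := by positivity
  refine ⟨(5 + (nmd (AA a b)).c) * (A * (C + C') + ‖u‖), fun r K hr hP => ?_⟩
  have g1 := hv r K hr hP
  have g2 := hw r K hr hP
  have n1 := g1.nn; have n2 := g2.nn; have n3 := norm_nonneg u
  refine CW.of_mid hr (by positivity) ?_ fun τ l hl => ?_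
  · have : 0 ≤ A * (C + C') := by positivity
    linarith
  · have k1 := LI_sob1 (fun q => DP_DD h' (τ :: l) q)
    simp only [Ops.D_cons] at k1
    have k2 := (h.D l).U_δ (m2 a b) τ
    rw [← DD_δ] at k2
    have k3 := (k2.trans (Md.U_le_S _ _)).trans (g1.sup l hl)
    have k4 := g2.mid τ l hl
    have k5 := mll (add_le_add k3 k4) A0.le
    have := mul_nonneg n3 (xw_pos hr l.length).le
    linarith
lemma UW.R0 {P : ℝ → ℕ → Prop} {u : FF a b} (h : UW P (nmd (AA a b)) u) : UW P (nmd (AA a b)) (R0 u) := by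
  obtain ⟨C, h⟩ := h
  refine ⟨C, fun r K hr hP => ?_⟩
  have g := h r K hr hP
  refine ⟨g.nn, (R0_norm_le u).trans g.nrm, fun τ l hl => ?_, fun l hl => ?_⟩
  · have := DD_R0 (τ :: l) u
    simp only [Ops.D_cons] at this
    rw [this]; exact (R0_LI _).trans (g.mid τ l hl)
  · rw [DD_R0, Md.nmd_S]
    have := g.sup l hl
    rw [Md.nmd_S] at this
    exact (R0_norm_le _).trans this
lemma DB.R0 {u : FF a b} (h : DB u) : DB (R0 u) := by
  obtain ⟨C, h⟩ := h
  refine ⟨C, fun τ => ?_⟩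
  have := DD_R0 [τ] u
  simp only [Ops.D_cons, Ops.D_nil] at this
  rw [this]; exact (R0_norm_le _).trans (h τ)
end
end
end

section
open Set MeasureTheory
open scoped BoundedContinuousFunction
noncomputable section

lemma absorb {c α β γ κ h D : ℝ} (hc : 1 ≤ c) (hα : 0 ≤ α) (hβ : 0 ≤ β) (hγ : 0 ≤ γ) (hh : 0 ≤ h) (hD : 0 ≤ D)
    (h1 : γ ≤ c * (α + β + D)) (h2 : α ^ 2 + β ^ 2 ≤ c * (D ^ 2 + (κ + D) * h)) (h3 : κ ≤ c * (D + h))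
    (h4 : ∀ ε > 0, h ^ 2 ≤ (c + 1 / ε) * D ^ 2 + ε * γ ^ 2) :
    α ≤ 17 * c ^ 4 * D ∧ β ≤ 17 * c ^ 4 * D ∧ γ ≤ 17 * c ^ 4 * D ∧ κ ≤ 17 * c ^ 4 * D := by
  have c0 : 0 < c := by linarith
  have p2 : 1 ≤ c ^ 2 := one_le_pow₀ hc
  have p3 : 1 ≤ c ^ 3 := one_le_pow₀ hc
  have p4 : 1 ≤ c ^ 4 := one_le_pow₀ hc
  have D2 := sq_nonneg D
  set S := α ^ 2 + β ^ 2 with hS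
  have S0 : 0 ≤ S := by positivity
  have a1 : S ≤ 2 * c ^ 2 * D ^ 2 + 2 * c ^ 2 * h ^ 2 := by
    have e1 : (κ + D) * h ≤ (c * (D + h) + D) * h := mlr (by linarith) hh
    have e2 : (c * (D + h) + D) * h ≤ c * D ^ 2 + 2 * c * h ^ 2 := by
      have : D * h ≤ c * (D * h) := le_mul_of_one_le_left (mul_nonneg hD hh) hc
      nlinarith [mul_nonneg c0.le (sq_nonneg (D - h))]
    have e3 : c * (D ^ 2 + (κ + D) * h) ≤ c * (D ^ 2 + (c * D ^ 2 + 2 * c * h ^ 2)) := mll (by linarith) c0.le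
    have e4 : c * D ^ 2 ≤ c ^ 2 * D ^ 2 := mlr (by nlinarith) D2
    nlinarith
  have a2 : γ ^ 2 ≤ 3 * c ^ 2 * (S + D ^ 2) := by
    have e1 := pow_le_pow_left₀ hγ h1 2
    have e2 : (α + β + D) ^ 2 ≤ 3 * (S + D ^ 2) := by nlinarith [sq_nonneg (α - β), sq_nonneg (α - D), sq_nonneg (β - D)]
    rw [mul_pow] at e1
    have e3 := mll e2 (sq_nonneg c)
    linarith
  have a3 : h ^ 2 ≤ (c + 12 * c ^ 4) * D ^ 2 + 1 / (12 * c ^ 4) * γ ^ 2 := by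
    have := h4 (1 / (12 * c ^ 4)) (by positivity)
    rwa [one_div_one_div] at this
  have a4 : 1 / (12 * c ^ 4) * γ ^ 2 ≤ 1 / (4 * c ^ 2) * (S + D ^ 2) := by
    refine (mll a2 (by positivity)).trans (le_of_eq ?_)
    field_simp; ring
  have a5 : S ≤ 57 * c ^ 6 * D ^ 2 := by
    have e1 : 2 * c ^ 2 * h ^ 2 ≤ 2 * c ^ 2 * ((c + 12 * c ^ 4) * D ^ 2 + 1 / (4 * c ^ 2) * (S + D ^ 2)) :=
      mll (by linarith) (by positivity)
    have e2 : 2 * c ^ 2 * ((c + 12 * c ^ 4) * D ^ 2 + 1 / (4 * c ^ 2) * (S + D ^ 2)) = (2 * c ^ 3 + 24 * c ^ 6) * D ^ 2 + 1 / 2 * (S + D ^ 2) := by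
      field_simp; ring
    have q2 : c ^ 2 ≤ c ^ 6 := pow_le_pow_right₀ hc (by norm_num)
    have q3 : c ^ 3 ≤ c ^ 6 := pow_le_pow_right₀ hc (by norm_num)
    have q0 : 1 ≤ c ^ 6 := one_le_pow₀ hc
    have := mlr q2 D2
    have := mlr q3 D2
    have := mlr q0 D2
    linarith
  have d1 : (8 * c ^ 3 * D) ^ 2 = 64 * c ^ 6 * D ^ 2 := by ring
  have d0 : 0 ≤ c ^ 6 * D ^ 2 := by positivity
  have b1 : α ≤ 8 * c ^ 3 * D := le_of_sq_le_sq (by rw [d1]; nlinarith [sq_nonneg β]) (by positivity)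
  have b2 : β ≤ 8 * c ^ 3 * D := le_of_sq_le_sq (by rw [d1]; nlinarith [sq_nonneg α]) (by positivity)
  have q34 : c ^ 3 ≤ c ^ 4 := pow_le_pow_right₀ hc (by norm_num)
  have r34 := mlr q34 hD
  have b3 : γ ≤ 17 * c ^ 4 * D := by
    refine h1.trans ?_
    have : D ≤ c ^ 3 * D := le_mul_of_one_le_left hD p3
    have := mll (by linarith : α + β + D ≤ 17 * c ^ 3 * D) c0.le
    linarith [this, (by ring : c * (17 * c ^ 3 * D) = 17 * c ^ 4 * D)]
  have b4 : h ≤ 7 * c ^ 2 * D := by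
    apply le_of_sq_le_sq _ (by positivity)
    have e1 := pow_le_pow_left₀ hγ b3 2
    have e2 : 1 / (12 * c ^ 4) * γ ^ 2 ≤ 1 / (12 * c ^ 4) * (17 * c ^ 4 * D) ^ 2 := mll e1 (by positivity)
    have e3 : 1 / (12 * c ^ 4) * (17 * c ^ 4 * D) ^ 2 = 289 / 12 * c ^ 4 * D ^ 2 := by field_simp; ring
    have q1 : c ≤ c ^ 4 := le_self_pow₀ hc (by norm_num)
    have := mlr q1 D2
    have : 0 ≤ c ^ 4 * D ^ 2 := by positivity
    have : (7 * c ^ 2 * D) ^ 2 = 49 * c ^ 4 * D ^ 2 := by ring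
    linarith
  refine ⟨by nlinarith, by nlinarith, b3, h3.trans ?_⟩
  have : D ≤ c ^ 2 * D := le_mul_of_one_le_left hD p2
  have := mll (by linarith : D + h ≤ 8 * c ^ 2 * D) c0.le
  have e : c * (8 * c ^ 2 * D) = 8 * (c ^ 3 * D) := by ring
  have : 0 ≤ c ^ 3 * D := by positivity
  linarith

lemma alg1 {R : Type*} [CommRing R] {v h z : R} (e : v * h = 1) : (h * h) * ((v * v) * z) = z := by
  linear_combination (z * (v * h + 1)) * e
lemma alg2 {R : Type*} [CommRing R] {w A x B Y C X : R} (e : w * A = 1) :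
    x = (w * B * Y + w * B * Y) - w * C * X + w * (A * x - (B * Y + B * Y) + C * X) := by
  linear_combination (-x) * e
lemma alg3 {R : Type*} [CommRing R] {v h x y : R} (e : v * h = 1) : x = (v * v) * (y - (y - (h * h) * x)) := by
  linear_combination (-x * (v * h + 1)) * e

structure Sys (a b : ℝ) [hab : Fact (a < b)] where
  (Z H Y Zq Zp Hp c1 c2 V W J : FF a b)
  (sg k1 k2 : ℝ)
  hZq : HQ Z Zq
  hHq : HQ H Zp
  hYq : HQ Y Z
  hZp : ∀ q, DP (Z q) (Zp q)
  hHp : ∀ q, DP (H q) (Hp q)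
  hYp : ∀ q, DP (Y q) (H q)
  hc1 : ∀ τ, (dOps (AA a b)).δ τ c1 = 0
  hc2 : ∀ τ, (dOps (AA a b)).δ τ c2 = 0
  pde : (1 + Z * Z) * Hp - (2:ℝ) • ((Z * H) * Zp) + (H * H) * Zq = (c1 + c2 * Y) * (H * (H * H))
  VH : V * H = 1
  WZ : W * (1 + Z * Z) = 1
  bot : ∀ q, bt (Z q) = 0
  hJ : HQ J ((R0 Z * (1 + R0 Z * R0 Z)) * (sg • ((R0 V * R0 V) * (1 + R0 Z * R0 Z)) + (k1 • R0 Y + k2 • 1)))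
  top : R0 Zq = (J * (1 + R0 Z * R0 Z)) * (sg • ((R0 V * R0 V) * (1 + R0 Z * R0 Z)) + (k1 • R0 Y + k2 • 1))

namespace Sys
variable {a b : ℝ} [hab : Fact (a < b)] (S : Sys a b)

def g1 : FF a b := S.sg • ((R0 S.V * R0 S.V) * (1 + R0 S.Z * R0 S.Z))
def D1 : FF a b := S.k1 • R0 S.Y + S.k2 • 1
def PJ : FF a b := S.J * (1 + R0 S.Z * R0 S.Z)

lemma top' : R0 S.Zq = S.PJ * (S.g1 + S.D1) := S.top
lemma V0H0 : R0 S.V * R0 S.H = 1 := by rw [← map_mul, S.VH, map_one]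
lemma g1_eq : (R0 S.H * R0 S.H) * S.g1 = S.sg • (1 + R0 S.Z * R0 S.Z) := by
  have h := S.V0H0
  unfold g1
  rw [mul_smul_comm]
  congr 1
  exact alg1 (R := FF a b) h

lemma coer : ∃ c0 > 0, ∀ q p (X Y : ℝ), c0 * (X ^ 2 + Y ^ 2) ≤
    (S.W * (S.H * S.H)) q p * X ^ 2 - 2 * (S.W * (S.Z * S.H)) q p * X * Y + Y ^ 2 := by
  set m := ‖(1 + S.Z * S.Z) * S.V‖ with hm
  set k := ‖S.W * (S.Z * S.H)‖ with hk
  have pt : ∀ (f : FF a b) q p, |f q p| ≤ ‖f‖ := fun f q p => ((f q).norm_coe_le_norm p).trans (f.norm_coe_le_norm q)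
  have m0 : 0 ≤ m := norm_nonneg ((1 + S.Z * S.Z) * S.V)
  have k0 : 0 ≤ k := norm_nonneg (S.W * (S.Z * S.H))
  refine ⟨1 / (2 + (1 + 2 * k ^ 2) * m ^ 2), by positivity, fun q p X Y => ?_⟩
  rw [one_div, inv_mul_le_iff₀ (by positivity)]
  have e1 : S.W q p * (1 + S.Z q p * S.Z q p) = 1 := by
    have := congrArg (fun f : FF a b => f q p) S.WZ; exact this
  have e2 : S.V q p * S.H q p = 1 := by
    have := congrArg (fun f : FF a b => f q p) S.VH; exact this
  have e3 : |(1 + S.Z q p * S.Z q p) * S.V q p| ≤ m := pt ((1 + S.Z * S.Z) * S.V) q p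
  have e4 : |S.W q p * (S.Z q p * S.H q p)| ≤ k := pt (S.W * (S.Z * S.H)) q p
  show X ^ 2 + Y ^ 2 ≤ (2 + (1 + 2 * k ^ 2) * m ^ 2) * (S.W q p * (S.H q p * S.H q p) * X ^ 2 - 2 * (S.W q p * (S.Z q p * S.H q p)) * X * Y + Y ^ 2)
  generalize S.W q p = w at *
  generalize S.V q p = v at *
  generalize S.Z q p = z at *
  generalize S.H q p = h at *
  set B := w * (z * h) with hB
  set t := (1 + z * z) * v with ht
  have f1 : w * (h * h) = B ^ 2 + (w * h) ^ 2 := by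
    rw [hB]; linear_combination (-w * h * h) * e1
  have f2 : (w * h) * t = 1 := by rw [ht]; linear_combination h * v * e1 + e2
  have f3 : t ^ 2 ≤ m ^ 2 := sq_le_sq' (abs_le.1 e3).1 (abs_le.1 e3).2
  have f4 : B ^ 2 ≤ k ^ 2 := sq_le_sq' (abs_le.1 e4).1 (abs_le.1 e4).2
  rw [f1]
  have f5 : (B ^ 2 + (w * h) ^ 2) * X ^ 2 - 2 * B * X * Y + Y ^ 2 = (Y - B * X) ^ 2 + (w * h * X) ^ 2 := by ring
  rw [f5]
  have f6 : X ^ 2 ≤ m ^ 2 * (w * h * X) ^ 2 := by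
    calc X ^ 2 = t ^ 2 * (w * h * X) ^ 2 := by linear_combination (-X ^ 2 * ((w * h) * t + 1)) * f2
      _ ≤ _ := mlr f3 (sq_nonneg _)
  have f7 : Y ^ 2 ≤ 2 * (Y - B * X) ^ 2 + 2 * (B ^ 2 * X ^ 2) := by nlinarith [sq_nonneg (Y - 2 * B * X)]
  have f8 : B ^ 2 * X ^ 2 ≤ k ^ 2 * X ^ 2 := mlr f4 (sq_nonneg _)
  have f9 : (1 + 2 * k ^ 2) * X ^ 2 ≤ (1 + 2 * k ^ 2) * (m ^ 2 * (w * h * X) ^ 2) := mll f6 (by positivity)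
  have g1 : 0 ≤ (1 + 2 * k ^ 2) * m ^ 2 * (Y - B * X) ^ 2 := by positivity
  have g2 := sq_nonneg (w * h * X)
  nlinarith

abbrev N (f : FF a b) : ℝ := (m2 a b).U f
abbrev L (f : FF a b) : ℝ := (nmd (AA a b)).U f

lemma bt_DD (l : List (Ioc (0:ℝ) 1)) (f : FF a b) (h : ∀ q, bt (f q) = 0) (q : ℝ) : bt (DD l f q) = 0 := by
  induction l generalizing f with
  | nil => exact h q
  | cons τ l ih => exact ih _ fun q => by rw [dOps_δ, map_smul, map_sub, h, h]; simp

structure RB (l : List (Ioc (0:ℝ) 1)) (Cm D : ℝ) : Prop where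
  r1 : N (DD l ((1 + S.Z * S.Z) * S.Hp) - (1 + S.Z * S.Z) * DD l S.Hp) ≤ D
  r2 : N (DD l ((S.Z * S.H) * S.Zp) - (S.Z * S.H) * DD l S.Zp) ≤ D
  r3 : N (DD l ((S.H * S.H) * S.Zq) - (S.H * S.H) * DD l S.Zq) ≤ D
  r4 : N (DD l ((S.c1 + S.c2 * S.Y) * (S.H * (S.H * S.H)))) ≤ D
  r5 : N (DD l S.H) ≤ D
  t1 : L (DD l (S.PJ * (S.g1 + S.D1)) - S.PJ * DD l S.g1) ≤ D
  t2 : L (DD l ((R0 S.H * R0 S.H) * S.g1) - (R0 S.H * R0 S.H) * DD l S.g1) ≤ Cm * L (DD l (R0 S.H)) + D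
  t3 : L (DD l (1 + R0 S.Z * R0 S.Z)) ≤ D

def rt (l : List (Ioc (0:ℝ) 1)) : FF a b :=
  DD l ((S.c1 + S.c2 * S.Y) * (S.H * (S.H * S.H))) - (DD l ((1 + S.Z * S.Z) * S.Hp) - (1 + S.Z * S.Z) * DD l S.Hp)
    + (2:ℝ) • (DD l ((S.Z * S.H) * S.Zp) - (S.Z * S.H) * DD l S.Zp) - (DD l ((S.H * S.H) * S.Zq) - (S.H * S.H) * DD l S.Zq)

lemma hvp (l : List (Ioc (0:ℝ) 1)) : DD l S.Hp = (2:ℝ) • (S.W * (S.Z * S.H) * DD l S.Zp) - S.W * (S.H * S.H) * DD l S.Zq + S.W * S.rt l := by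
  have e1 : (1 + S.Z * S.Z) * DD l S.Hp - (2:ℝ) • ((S.Z * S.H) * DD l S.Zp) + (S.H * S.H) * DD l S.Zq = S.rt l := by
    have := congrArg (DD l) S.pde
    rw [map_add, map_sub, map_smul] at this
    rw [rt, ← this, smul_sub]; abel
  rw [← e1]
  have h2 : ∀ x : FF a b, (2:ℝ) • x = x + x := fun x => two_smul ℝ x
  rw [h2, h2]
  exact alg2 (R := FF a b) S.WZ

lemma nr {l : List (Ioc (0:ℝ) 1)} {Cm D : ℝ} (hR : S.RB l Cm D) : N (S.W * S.rt l) ≤ 5 * ‖S.W‖ * D := by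
  have nrt : (m2 a b).U (S.rt l) ≤ 5 * D := by
    refine ((m2 a b).U_sub _ _).trans ?_
    have a1 := ((m2 a b).U_add (DD l ((S.c1 + S.c2 * S.Y) * (S.H * (S.H * S.H))) - (DD l ((1 + S.Z * S.Z) * S.Hp) - (1 + S.Z * S.Z) * DD l S.Hp)) ((2:ℝ) • (DD l ((S.Z * S.H) * S.Zp) - (S.Z * S.H) * DD l S.Zp)))
    have a2 := (m2 a b).U_sub (DD l ((S.c1 + S.c2 * S.Y) * (S.H * (S.H * S.H)))) (DD l ((1 + S.Z * S.Z) * S.Hp) - (1 + S.Z * S.Z) * DD l S.Hp)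
    have a3 := (m2 a b).U_smul_le 2 (DD l ((S.Z * S.H) * S.Zp) - (S.Z * S.H) * DD l S.Zp)
    rw [abs_two] at a3
    have r2 := mll hR.r2 zero_le_two
    refine (add_le_add (a1.trans (add_le_add (a2.trans (add_le_add hR.r4 hR.r1)) (a3.trans r2))) hR.r3).trans (le_of_eq ?_)
    ring
  refine ((m2 a b).U_mul _ _).trans ((mll nrt (norm_nonneg S.W)).trans (le_of_eq ?_))
  ring

lemma hg {l : List (Ioc (0:ℝ) 1)} {Cm D : ℝ} (hCm : 0 ≤ Cm) (hD : 0 ≤ D) (hR : S.RB l Cm D) :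
    L (DD l S.g1) ≤ ‖R0 S.V * R0 S.V‖ * (|S.sg| + 1 + Cm) * (D + L (R0 (DD l S.H))) := by
  have f1 : DD l S.g1 = (R0 S.V * R0 S.V) * (S.sg • DD l (1 + R0 S.Z * R0 S.Z) - (DD l ((R0 S.H * R0 S.H) * S.g1) - (R0 S.H * R0 S.H) * DD l S.g1)) := by
    have h1 := congrArg (DD l) S.g1_eq
    rw [map_smul] at h1
    rw [h1]
    exact alg3 (R := FF a b) S.V0H0
  have f2 := (nmd (AA a b)).U_mul (R0 S.V * R0 S.V) (S.sg • DD l (1 + R0 S.Z * R0 S.Z) - (DD l ((R0 S.H * R0 S.H) * S.g1) - (R0 S.H * R0 S.H) * DD l S.g1))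
  rw [← f1] at f2
  refine f2.trans ?_
  rw [mul_assoc]
  refine mll (((nmd (AA a b)).U_sub _ _).trans ?_) (norm_nonneg _)
  have f3 := (nmd (AA a b)).U_smul_le S.sg (DD l (1 + R0 S.Z * R0 S.Z))
  have sg0 := abs_nonneg S.sg
  have f4 := mll hR.t3 sg0
  have f5 := hR.t2
  rw [DD_R0] at f5
  refine (add_le_add (f3.trans f4) f5).trans ?_
  have f6 : 0 ≤ L (R0 (DD l S.H)) := Md.U_nn _ _
  generalize L (R0 (DD l S.H)) = x at *
  have f7 := mul_nonneg hCm hD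
  have f8 := mul_nonneg sg0 f6
  nlinarith

lemma hu0 {l : List (Ioc (0:ℝ) 1)} {Cm D : ℝ} (hD : 0 ≤ D) (hR : S.RB l Cm D) : L (R0 (DD l S.Zq)) ≤ (‖S.PJ‖ + 1) * (L (DD l S.g1) + D) := by
  rw [← DD_R0, S.top']
  have f1 : DD l (S.PJ * (S.g1 + S.D1)) = (DD l (S.PJ * (S.g1 + S.D1)) - S.PJ * DD l S.g1) + S.PJ * DD l S.g1 := by abel
  rw [f1]
  refine (((nmd (AA a b)).U_add _ _).trans (add_le_add hR.t1 ((nmd (AA a b)).U_mul S.PJ (DD l S.g1)))).trans ?_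
  have f6 : 0 ≤ L (DD l S.g1) := Md.U_nn _ _
  have := mul_nonneg (norm_nonneg S.PJ) hD
  simp only [L] at *
  linarith

lemma hγ {l : List (Ioc (0:ℝ) 1)} {Cm D : ℝ} (hD : 0 ≤ D) (hR : S.RB l Cm D) :
    N (DD l S.Hp) ≤ (2 * ‖S.W * (S.Z * S.H)‖ + ‖S.W * (S.H * S.H)‖ + 5 * ‖S.W‖) * (N (DD l S.Zq) + N (DD l S.Zp) + D) := by
  rw [S.hvp]
  have nr := S.nr hR
  generalize S.W * (S.Z * S.H) = B at *
  generalize S.W * (S.H * S.H) = G at *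
  generalize S.W * S.rt l = R at *
  have f1 := ((m2 a b).U_add ((2:ℝ) • (B * DD l S.Zp) - G * DD l S.Zq) R)
  have f2 := (m2 a b).U_sub ((2:ℝ) • (B * DD l S.Zp)) (G * DD l S.Zq)
  have f3 := (m2 a b).U_smul_le 2 (B * DD l S.Zp)
  have f4 := (m2 a b).U_mul B (DD l S.Zp)
  have f5 := (m2 a b).U_mul G (DD l S.Zq)
  rw [abs_two] at f3
  have f6 := mll f4 zero_le_two
  refine (f1.trans (add_le_add (f2.trans (add_le_add (f3.trans f6) f5)) nr)).trans ?_
  have g1 := Md.U_nn (m2 a b) (DD l S.Zq)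
  have g2 := Md.U_nn (m2 a b) (DD l S.Zp)
  simp only [N] at *
  have B0 := norm_nonneg B
  have G0 := norm_nonneg G
  have w0 := norm_nonneg S.W
  generalize (m2 a b).U (DD l S.Zq) = x at *
  generalize (m2 a b).U (DD l S.Zp) = y at *
  generalize ‖B‖ = B' at *
  generalize ‖G‖ = G' at *
  generalize ‖S.W‖ = W' at *
  have k1 := mul_nonneg B0 g1
  have k2 := mul_nonneg B0 hD
  have k3 := mul_nonneg G0 g2
  have k4 := mul_nonneg G0 hD
  have k5 := mul_nonneg w0 g1
  have k6 := mul_nonneg w0 g2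
  clear * - k1 k2 k3 k4 k5 k6
  linarith

lemma num1 {c0 w R D x pj u0 κ h : ℝ} (hc0 : 0 < c0) (hpj : 0 ≤ pj) (hR0 : 0 ≤ R) (hR : R ≤ 5 * w * D) (hx0 : 0 ≤ x) (hx : x ≤ D)
    (hκ : 0 ≤ κ) (hh : 0 ≤ h) (hu : u0 ≤ (pj + 1) * (κ + D)) :
    1 / c0 * R ^ 2 + 9 / (2 * c0) * x ^ 2 + 2 * (u0 * h) ≤ (1 / c0 * (5 * w) ^ 2 + 9 / (2 * c0) + 2 * (pj + 1)) * (D ^ 2 + (κ + D) * h) := by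
  have D0 : 0 ≤ D := hx0.trans hx
  have k1 := pow_le_pow_left₀ hR0 hR 2
  have k2 := pow_le_pow_left₀ hx0 hx 2
  have k3 := mll k1 (by positivity : 0 ≤ 1 / c0)
  have k4 := mll k2 (by positivity : 0 ≤ 9 / (2 * c0))
  have k5 := mlr hu hh
  have Q0 : 0 ≤ (κ + D) * h := by positivity
  have k6 : 0 ≤ (1 / c0 * (5 * w) ^ 2 + 9 / (2 * c0)) * ((κ + D) * h) := by positivity
  have k7 : 0 ≤ 2 * (pj + 1) * D ^ 2 := by positivity
  rw [mul_pow] at k3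
  linarith

lemma step (Cm : ℝ) (hCm : 0 ≤ Cm) : ∃ C, 0 ≤ C ∧ ∀ l D, S.RB l Cm D →
    N (DD l S.Zq) ≤ C * D ∧ N (DD l S.Zp) ≤ C * D ∧ N (DD l S.Hp) ≤ C * D ∧ L (DD l S.g1) ≤ C * D := by
  obtain ⟨c0, hc0, hco⟩ := S.coer
  have hba := sub_pos.2 hab.out
  have w0 := norm_nonneg S.W
  have B0 := norm_nonneg (S.W * (S.Z * S.H))
  have G0 := norm_nonneg (S.W * (S.H * S.H))
  have v20 := norm_nonneg (R0 S.V * R0 S.V)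
  have pj0 := norm_nonneg S.PJ
  have sg0 := abs_nonneg S.sg
  obtain ⟨cA, hcA⟩ : ∃ x, x = 2 * ‖S.W * (S.Z * S.H)‖ + ‖S.W * (S.H * S.H)‖ + 5 * ‖S.W‖ := ⟨_, rfl⟩
  obtain ⟨cB, hcB⟩ : ∃ x, x = 2 * ((6 / c0) * ((1 / c0) * (5 * ‖S.W‖) ^ 2 + 9 / (2 * c0) + 2 * (‖S.PJ‖ + 1))) := ⟨_, rfl⟩
  obtain ⟨cC, hcC⟩ : ∃ x, x = ‖R0 S.V * R0 S.V‖ * (|S.sg| + 1 + Cm) := ⟨_, rfl⟩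
  have cA0 : 0 ≤ cA := by rw [hcA]; positivity
  have cB0 : 0 ≤ cB := by rw [hcB]; positivity
  have cC0 : 0 ≤ cC := by rw [hcC]; positivity
  have cD0 : 0 ≤ 1 / (b - a) := by positivity
  obtain ⟨c, hc⟩ : ∃ x, x = 1 + cA + cB + cC + 1 / (b - a) := ⟨_, rfl⟩
  have c0' : 0 ≤ c := by rw [hc]; positivity
  refine ⟨17 * c ^ 4, by positivity, fun l D hR => ?_⟩
  have D0 : 0 ≤ D := (Md.U_nn _ _).trans hR.r5
  have hEN := EN (u := DD l S.Z) (uq := DD l S.Zq) (up := DD l S.Zp) (v := DD l S.H) (vp := DD l S.Hp) hc0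
    (S.hZq.D l) (S.hHq.D l) (DP_DD S.hZp l) (DP_DD S.hHp l) (bt_DD l S.Z S.bot) (S.hvp l) hco
  have hκ0 : 0 ≤ L (DD l S.g1) := Md.U_nn _ _
  have hh0 : 0 ≤ L (R0 (DD l S.H)) := Md.U_nn _ _
  have g1 : 0 ≤ N (DD l S.Zq) := Md.U_nn _ _
  have g2 : 0 ≤ N (DD l S.Zp) := Md.U_nn _ _
  have h2 : N (DD l S.Zq) ^ 2 + N (DD l S.Zp) ^ 2 ≤ cB * (D ^ 2 + (L (DD l S.g1) + D) * L (R0 (DD l S.H))) := by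
    refine hEN.trans ?_
    rw [hcB, mul_assoc, mul_assoc]
    refine mll (mll ?_ (by positivity)) (by norm_num)
    exact num1 hc0 pj0 (Md.U_nn _ _) (S.nr hR) (Md.U_nn _ _) hR.r5 hκ0 hh0 (S.hu0 D0 hR)
  refine absorb (c := c) (h := L (R0 (DD l S.H))) (by rw [hc]; linarith) g1 g2 (Md.U_nn _ _) hh0 D0 ?_ ?_ ?_ ?_
  · have := S.hγ D0 hR
    rw [← hcA] at this
    exact this.trans (mlr (by rw [hc]; linarith) (by positivity))
  · exact h2.trans (mlr (by rw [hc]; linarith) (by positivity))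
  · have := S.hg hCm D0 hR
    rw [← hcC] at this
    exact this.trans (mlr (by rw [hc]; linarith) (by positivity))
  · intro ε hε
    have k1 := LI_sob (DP_DD S.hHp l) hε
    have k2 := pow_le_pow_left₀ (Md.U_nn _ _) (R0_LI (DD l S.H)) 2
    have k3 := pow_le_pow_left₀ (Md.U_nn _ _) hR.r5 2
    refine k2.trans (k1.trans (add_le_add ?_ le_rfl))
    refine mul_le_mul (by rw [hc]; linarith) k3 (sq_nonneg _) (by positivity)
end Sys
end
end

section
open Set MeasureTheory
open scoped BoundedContinuousFunction
noncomputable section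
section
variable {E : Type*} [NormedCommRing E] [NormedAlgebra ℝ E] [CompleteSpace E]

def BX (P : ℝ → ℕ → Prop) (F : List (Ioc (0:ℝ) 1) → ℝ) : Prop :=
  ∃ C, 0 ≤ C ∧ ∀ r K, 1 ≤ r → P r K → ∀ l : List (Ioc (0:ℝ) 1), l.length = K + 2 → F l ≤ C * XX r K

variable {P : ℝ → ℕ → Prop} {M : Md E} {u v w : ℝ →ᵇ E}
lemma UT.bx (h : UT P M u) : BX P (fun l => M.U (DD l u)) := by
  obtain ⟨C, h⟩ := h
  exact ⟨|C|, abs_nonneg _, fun r K hr hP l hl => (h r K hr hP l hl).trans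
    (mlr (le_abs_self _) (XX_pos hr K).le)⟩

lemma UW.of_IH {B : ℝ} (h : ∀ r K, 1 ≤ r → P r K → ∀ τ l, l.length ≤ K → M.U (DD l ((dOps E).δ τ w)) ≤ B * xw r l.length) :
    UW P M w := by
  refine ⟨(5 + M.c) * (|B| + ‖w‖), fun r K hr hP => CW.of_mid hr (by positivity) (by linarith [abs_nonneg B]) fun τ l hl => ?_⟩
  exact (h r K hr hP τ l hl).trans (mlr (by linarith [le_abs_self B, norm_nonneg w]) (xw_pos hr _).le)

lemma base_rem (M : Md E) (hd : DB u) (w : ℝ →ᵇ E) : ∃ C, 0 ≤ C ∧ ∀ τ : Ioc (0:ℝ) 1, M.U (DD [τ] (u * w) - u * DD [τ] w) ≤ C := by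
  obtain ⟨C, hd⟩ := hd
  refine ⟨M.c * (|C| * ‖w‖), mul_nonneg M.c0 (by positivity), fun τ => (M.U_le _).trans (mll ?_ M.c0)⟩
  simp only [Ops.D_cons, Ops.D_nil]
  rw [(dOps E).leib, add_sub_cancel_left]
  exact (norm_mul_le _ _).trans (mul_le_mul ((hd τ).trans (le_abs_self C)) (Md.norm_Tr _ w).le (norm_nonneg _) (abs_nonneg _))
lemma base_U (M : Md E) (hd : DB u) : ∃ C, 0 ≤ C ∧ ∀ τ : Ioc (0:ℝ) 1, M.U (DD [τ] u) ≤ C := by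
  obtain ⟨C, hd⟩ := hd
  refine ⟨M.c * |C|, mul_nonneg M.c0 (abs_nonneg _), fun τ => (M.U_le _).trans (mll ?_ M.c0)⟩
  exact (hd τ).trans (le_abs_self C)
lemma DD_mul_add (l : List (Ioc (0:ℝ) 1)) : DD l (u * (v + w)) - u * DD l v = (DD l (u * v) - u * DD l v) + DD l (u * w) := by
  rw [mul_add, map_add]; abel
end

namespace Sys
variable {a b : ℝ} [hab : Fact (a < b)] (S : Sys a b)

def IH (B r : ℝ) (K : ℕ) : Prop := ∀ (τ : Ioc (0:ℝ) 1) (l : List (Ioc (0:ℝ) 1)), l.length ≤ K →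
  N (DD (τ :: l) S.Zq) ≤ B * xw r l.length ∧ N (DD (τ :: l) S.Zp) ≤ B * xw r l.length ∧
  N (DD (τ :: l) S.Hp) ≤ B * xw r l.length ∧ L (DD (τ :: l) S.g1) ≤ B * xw r l.length

variable {S} {B : ℝ}
lemma uZq : UW (S.IH B) (m2 a b) S.Zq := UW.of_IH fun r K _ h τ l hl => (h τ l hl).1
lemma uZp : UW (S.IH B) (m2 a b) S.Zp := UW.of_IH fun r K _ h τ l hl => (h τ l hl).2.1
lemma uHp : UW (S.IH B) (m2 a b) S.Hp := UW.of_IH fun r K _ h τ l hl => (h τ l hl).2.2.1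
lemma ug1 : UW (S.IH B) (nmd (AA a b)) S.g1 := UW.of_IH fun r K _ h τ l hl => (h τ l hl).2.2.2
lemma uZ : UW (S.IH B) (nmd (AA a b)) S.Z := UW.of_DP S.hZq S.hZp uZq uZp
lemma uH : UW (S.IH B) (nmd (AA a b)) S.H := UW.of_DP S.hHq S.hHp uZp uHp
lemma uY : UW (S.IH B) (nmd (AA a b)) S.Y := UW.of_HQ S.hYq uZ
lemma u1 : UW (S.IH B) (nmd (AA a b)) 1 := UW.of_const δ_one
lemma dZ : DB S.Z := .of_HQ S.hZq
lemma dH : DB S.H := .of_HQ S.hHq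
lemma dY : DB S.Y := .of_HQ S.hYq
lemma dJ : DB S.J := .of_HQ S.hJ
lemma d1 : DB (1 : FF a b) := .of_const δ_one
lemma tZ : UT (S.IH B) (m2 a b) S.Z := .of_HQ S.hZq uZq
lemma tH : UT (S.IH B) (m2 a b) S.H := .of_HQ S.hHq uZp
lemma tY : UT (S.IH B) (m2 a b) S.Y := .of_HQ S.hYq uZ.of_nmd
lemma t1 {M : Md (AA a b)} : UT (S.IH B) M 1 := .of_const δ_one
lemma uD1 : UW (S.IH B) (nmd (AA a b)) S.D1 := (uY.R0.smul _).add (u1.smul _)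
lemma dD1 : DB S.D1 := (dY.R0.smul _).add (d1.smul _)
lemma tD1 : UT (S.IH B) (nmd (AA a b)) S.D1 := ((UT.of_HQ S.hYq.R0 uZ.R0).smul _).add (t1.smul _)
lemma uP0 : UW (S.IH B) (nmd (AA a b)) (1 + R0 S.Z * R0 S.Z) := u1.add (uZ.R0.mul uZ.R0)
lemma dP0 : DB (1 + R0 S.Z * R0 S.Z) := d1.add (dZ.R0.mul dZ.R0)
lemma uJ' : UW (S.IH B) (nmd (AA a b)) ((R0 S.Z * (1 + R0 S.Z * R0 S.Z)) * (S.g1 + S.D1)) := (uZ.R0.mul uP0).mul (ug1.add uD1)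
lemma uJ : UW (S.IH B) (nmd (AA a b)) S.J := UW.of_HQ S.hJ uJ'
lemma tJ : UT (S.IH B) (nmd (AA a b)) S.J := UT.of_HQ S.hJ uJ'
lemma uPJ : UW (S.IH B) (nmd (AA a b)) S.PJ := uJ.mul uP0
lemma dPJ : DB S.PJ := dJ.mul dP0
lemma tZ0 : UT (S.IH B) (nmd (AA a b)) (R0 S.Z) := by
  have h := S.hZq.R0
  rw [S.top'] at h
  exact UT.of_HQ h (uPJ.mul (ug1.add uD1))
lemma tP0 : UT (S.IH B) (nmd (AA a b)) (1 + R0 S.Z * R0 S.Z) := t1.add (UT.mul uZ.R0 dZ.R0 uZ.R0 tZ0 tZ0)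
lemma tPJ : UT (S.IH B) (nmd (AA a b)) S.PJ := UT.mul uJ dJ uP0 tJ tP0
lemma tHH : UT (S.IH B) (m2 a b) (S.H * S.H) := UT.mul uH dH uH.of_nmd tH tH

variable (S) (B)
lemma main : ∃ C, 0 ≤ C ∧ ∀ r K, 1 ≤ r → S.IH B r K → ∀ l : List (Ioc (0:ℝ) 1), l.length = K + 2 →
    N (DD l S.Zq) ≤ C * XX r K ∧ N (DD l S.Zp) ≤ C * XX r K ∧ N (DD l S.Hp) ≤ C * XX r K ∧ L (DD l S.g1) ≤ C * XX r K := by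
  obtain ⟨C1, p1, h1⟩ := UT_rem (P := S.IH B) (u1.add (uZ.mul uZ)) (d1.add (dZ.mul dZ)) uHp (t1.add (UT.mul uZ dZ uZ.of_nmd tZ tZ))
  obtain ⟨C2, p2, h2⟩ := UT_rem (P := S.IH B) (uZ.mul uH) (dZ.mul dH) uZp (UT.mul uZ dZ uH.of_nmd tZ tH)
  obtain ⟨C3, p3, h3⟩ := UT_rem (P := S.IH B) (uH.mul uH) (dH.mul dH) uZq tHH
  have uc : UW (S.IH B) (nmd (AA a b)) (S.c1 + S.c2 * S.Y) := (UW.of_const S.hc1).add ((UW.of_const S.hc2).mul uY)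
  have dc : DB (S.c1 + S.c2 * S.Y) := (DB.of_const S.hc1).add ((DB.of_const S.hc2).mul dY)
  have tc : UT (S.IH B) (m2 a b) (S.c1 + S.c2 * S.Y) :=
    (UT.of_const S.hc1).add (UT.mul (UW.of_const S.hc2) (DB.of_const S.hc2) uY.of_nmd (UT.of_const S.hc2) tY)
  obtain ⟨C4, p4, h4⟩ := (UT.mul (P := S.IH B) uc dc (uH.mul (uH.mul uH)).of_nmd tc (UT.mul uH dH (uH.mul uH).of_nmd tH tHH)).bx
  obtain ⟨C5, p5, h5⟩ := (tH (S := S) (B := B)).bx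
  obtain ⟨C6, p6, h6⟩ := UT_rem (P := S.IH B) uPJ dPJ ug1 tPJ
  obtain ⟨C7, p7, h7⟩ := (UT.mul (P := S.IH B) uPJ dPJ uD1 tPJ tD1).bx
  obtain ⟨C8, p8, h8⟩ := (tP0 (S := S) (B := B)).bx
  obtain ⟨A, pA, hA⟩ := U_rem (P := S.IH B) (uH.R0.mul uH.R0) (dH.R0.mul dH.R0) ug1
  obtain ⟨A', pA', hA'⟩ := U_rem (P := S.IH B) uH.R0 dH.R0 uH.R0
  have n0 := norm_nonneg (R0 S.H)
  obtain ⟨C, C0, hC⟩ := S.step (A * (A' + ‖R0 S.H‖)) (by positivity)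
  obtain ⟨G, hG⟩ : ∃ x, x = C1 + C2 + C3 + C4 + C5 + C6 + C7 + C8 + A + A * A' := ⟨_, rfl⟩
  have pAA := mul_nonneg pA pA'
  have G0 : 0 ≤ G := by rw [hG]; positivity
  refine ⟨C * G, by positivity, fun r K hr hP l hl => ?_⟩
  have X0 := (XX_pos hr K).le
  simp only [mul_assoc C]
  refine hC l _ ?_
  have up : ∀ {c x : ℝ}, x ≤ c * XX r K → c ≤ G → x ≤ G * XX r K := fun h h' => h.trans (mlr h' X0)
  refine ⟨up (h1 r K hr hP l hl) ?_, up (h2 r K hr hP l hl) ?_, up (h3 r K hr hP l hl) ?_, up (h4 r K hr hP l hl) ?_,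
    up (h5 r K hr hP l hl) ?_, up (c := C6 + C7) ?_ ?_, ?_, up (h8 r K hr hP l hl) ?_⟩
  all_goals try (rw [hG]; linarith)
  · have e : DD l (S.PJ * (S.g1 + S.D1)) - S.PJ * DD l S.g1 = (DD l (S.PJ * S.g1) - S.PJ * DD l S.g1) + DD l (S.PJ * S.D1) := DD_mul_add l
    rw [e, add_mul]
    exact ((nmd (AA a b)).U_add _ _).trans (add_le_add (h6 r K hr hP l hl) (h7 r K hr hP l hl))
  · have e : DD l (R0 S.H * R0 S.H) = (DD l (R0 S.H * R0 S.H) - R0 S.H * DD l (R0 S.H)) + R0 S.H * DD l (R0 S.H) := by abel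
    have k1 := ((nmd (AA a b)).U_add _ _).trans (add_le_add (hA' r K hr hP l hl) ((nmd (AA a b)).U_mul (R0 S.H) (DD l (R0 S.H))))
    rw [← e] at k1
    have k2 := mll k1 pA
    refine (hA r K hr hP l hl).trans ((add_le_add k2 le_rfl).trans ?_)
    have k3 : (A * A' + A) * XX r K ≤ G * XX r K := mlr (by rw [hG]; linarith) X0
    simp only [L]
    linarith

lemma base : ∃ B0, 0 ≤ B0 ∧ ∀ r, S.IH B0 r 0 := by
  obtain ⟨C, C0, hC⟩ := S.step 0 le_rfl
  obtain ⟨C1, p1, h1⟩ := base_rem (m2 a b) (d1.add (dZ.mul dZ)) S.Hp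
  obtain ⟨C2, p2, h2⟩ := base_rem (m2 a b) (dZ.mul dH) S.Zp
  obtain ⟨C3, p3, h3⟩ := base_rem (m2 a b) (dH.mul dH) S.Zq
  have dc : DB (S.c1 + S.c2 * S.Y) := (DB.of_const S.hc1).add ((DB.of_const S.hc2).mul dY)
  obtain ⟨C4, p4, h4⟩ := base_U (m2 a b) (dc.mul (dH.mul (dH.mul dH)))
  obtain ⟨C5, p5, h5⟩ := base_U (m2 a b) (dH (S := S))
  obtain ⟨C6, p6, h6⟩ := base_rem (nmd (AA a b)) (dPJ (S := S)) S.g1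
  obtain ⟨C7, p7, h7⟩ := base_U (nmd (AA a b)) ((dPJ (S := S)).mul (dD1 (S := S)))
  obtain ⟨C8, p8, h8⟩ := base_U (nmd (AA a b)) (dP0 (S := S))
  obtain ⟨C9, p9, h9⟩ := base_rem (nmd (AA a b)) (dH.R0.mul dH.R0) S.g1
  obtain ⟨G, hG⟩ : ∃ x, x = C1 + C2 + C3 + C4 + C5 + C6 + C7 + C8 + C9 := ⟨_, rfl⟩
  have G0 : 0 ≤ G := by rw [hG]; positivity
  refine ⟨C * G, by positivity, fun r τ l hl => ?_⟩
  obtain rfl : l = [] := List.length_eq_zero_iff.1 (by omega)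
  rw [List.length_nil, xw_zero, mul_one]
  refine hC [τ] G ⟨(h1 τ).trans ?_, (h2 τ).trans ?_, (h3 τ).trans ?_, (h4 τ).trans ?_, (h5 τ).trans ?_, ?_,
    (h9 τ).trans ?_, (h8 τ).trans ?_⟩
  all_goals try (rw [hG]; linarith)
  have e : DD [τ] (S.PJ * (S.g1 + S.D1)) - S.PJ * DD [τ] S.g1 = (DD [τ] (S.PJ * S.g1) - S.PJ * DD [τ] S.g1) + DD [τ] (S.PJ * S.D1) := DD_mul_add _
  rw [e]
  refine (((nmd (AA a b)).U_add _ _).trans (add_le_add (h6 τ) (h7 τ))).trans ?_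
  rw [hG]; linarith

lemma qana : ∃ C r : ℝ, 0 ≤ C ∧ 1 ≤ r ∧ ∀ l : List (Ioc (0:ℝ) 1),
    ‖DD l S.Z‖ ≤ C * (r ^ l.length * l.length.factorial) ∧ ‖DD l S.H‖ ≤ C * (r ^ l.length * l.length.factorial) ∧ ‖DD l S.Y‖ ≤ C * (r ^ l.length * l.length.factorial) := by
  obtain ⟨B0, hB0, b0⟩ := S.base
  obtain ⟨C0, hC0, c0⟩ := S.main B0
  obtain ⟨B, hB⟩ : ∃ x, x = 1 + B0 + C0 := ⟨_, rfl⟩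
  have B1 : 1 ≤ B := by linarith
  obtain ⟨C1, hC1, c1⟩ := S.main B
  obtain ⟨r, hr⟩ : ∃ x, x = 1 + C1 := ⟨_, rfl⟩
  have r1 : 1 ≤ r := by linarith
  have i1 : S.IH B r 1 := by
    intro τ l hl
    have up : ∀ {c : ℝ}, c ≤ B → c * xw r l.length ≤ B * xw r l.length := fun h => mlr h (xw_pos r1 _).le
    rcases Nat.le_one_iff_eq_zero_or_eq_one.1 hl with h | h
    · obtain ⟨a1, a2, a3, a4⟩ := b0 r τ l h.le
      have := up (by linarith : B0 ≤ B)
      exact ⟨a1.trans this, a2.trans this, a3.trans this, a4.trans this⟩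
    · obtain ⟨a1, a2, a3, a4⟩ := c0 r 0 r1 (b0 r) (τ :: l) (by simp [h])
      have := up (by linarith : C0 ≤ B)
      rw [h] at this ⊢
      have e : XX r 0 = xw r 1 := by simp [XX, ew]
      rw [e] at a1 a2 a3 a4
      exact ⟨a1.trans this, a2.trans this, a3.trans this, a4.trans this⟩
  have iK : ∀ K, S.IH B r (K + 1) := by
    intro K
    induction K with
    | zero => exact i1
    | succ K ih =>
      intro τ l hl
      rcases Nat.lt_or_ge l.length (K + 2) with h | h
      · exact ih τ l (by omega)
      · have hl' : l.length = K + 2 := by omega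
        obtain ⟨a1, a2, a3, a4⟩ := c1 r (K + 1) r1 ih (τ :: l) (by simp [hl'])
        have e : XX r (K + 1) = r⁻¹ * xw r (K + 2) := by simp [XX, ew]
        have : C1 * XX r (K + 1) ≤ B * xw r l.length := by
          rw [e, hl', ← mul_assoc]
          refine mlr ?_ (xw_pos r1 _).le
          rw [← div_eq_mul_inv, div_le_iff₀ (by linarith)]
          nlinarith
        exact ⟨a1.trans this, a2.trans this, a3.trans this, a4.trans this⟩
  have fin : ∀ u : FF a b, UW (S.IH B) (nmd (AA a b)) u → ∃ C, 0 ≤ C ∧ ∀ l : List (Ioc (0:ℝ) 1), ‖DD l u‖ ≤ C * (r ^ l.length * l.length.factorial) := by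
    rintro u ⟨C, h⟩
    refine ⟨C, (h r 1 r1 i1).nn, fun l => ?_⟩
    have h1 := h r (l.length + 1) r1 (iK _)
    have h2 := h1.sup l (Nat.le_succ _)
    rw [Md.nmd_S] at h2
    refine h2.trans (mll ?_ h1.nn)
    unfold xw
    refine (div_le_self (by positivity) (one_le_pow₀ (by linarith [(Nat.cast_nonneg l.length : (0:ℝ) ≤ _)]))).trans ?_
    exact mlr (pow_le_pow_right₀ r1 (Nat.sub_le _ _)) (by positivity)
  obtain ⟨A1, q1, f1⟩ := fin _ uZ
  obtain ⟨A2, q2, f2⟩ := fin _ uH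
  obtain ⟨A3, q3, f3⟩ := fin _ uY
  refine ⟨A1 + A2 + A3, r, by positivity, r1, fun l => ⟨(f1 l).trans ?_, (f2 l).trans ?_, (f3 l).trans ?_⟩⟩ <;>
    exact mlr (by linarith) (by positivity)
end Sys
end
end

section
open Set MeasureTheory
open scoped BoundedContinuousFunction
noncomputable section

section
variable {E : Type*} [NormedCommRing E] [NormedAlgebra ℝ E] [CompleteSpace E]

lemma stek_tendsto (w : ℝ →ᵇ E) (q : ℝ) : Continuous fun τ : ℝ => stek τ w q := by
  simp only [stek_apply]
  exact intervalIntegral.continuous_parametric_intervalIntegral_of_continuous'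
    (f := fun τ s => w (q + τ * s)) (by unfold Function.uncurry; fun_prop) 0 1

lemma DD_cont (l : List (Ioc (0:ℝ) 1)) : Continuous (DD (E := E) l) := by
  induction l with
  | nil => exact continuous_id
  | cons τ l ih =>
    refine ih.comp ?_
    have : Continuous (Tr (E := E) (τ:ℝ)) :=
      AddMonoidHomClass.continuous_of_bound (Tr (E := E) (τ:ℝ)) 1 (fun f => by rw [Md.norm_Tr, one_mul])
    exact (this.sub continuous_id).const_smul _

lemma Q_step {u : ℝ →ᵇ E} {B : ℕ → ℝ} (h : ∀ l, ‖DD l u‖ ≤ B l.length) :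
    ∃ v, HQ u v ∧ ∀ l, ‖DD l v‖ ≤ B (l.length + 1) := by
  obtain ⟨t, ht⟩ : ∃ t : ℕ → Ioc (0:ℝ) 1, ∀ n, (t n : ℝ) = (1/2) ^ n :=
    ⟨fun n => ⟨(1/2) ^ n, by positivity, pow_le_one₀ (by norm_num) (by norm_num)⟩, fun n => rfl⟩
  have hd : ∀ n, dist ((dOps E).δ (t n) u) ((dOps E).δ (t (n+1)) u) ≤ B 2 * (1/2) ^ n := by
    intro n
    have e : (dOps E).δ (t n) u - (dOps E).δ (t (n+1)) u = ((1/2) ^ n / 4 : ℝ) • DD [t (n+1), t (n+1)] u := by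
      ext q
      simp only [Ops.D_cons, Ops.D_nil, BoundedContinuousFunction.coe_sub, Pi.sub_apply,
        BoundedContinuousFunction.coe_smul, Pi.smul_apply, dOps_δ, ht]
      have e2 : q + (1/2:ℝ) ^ (n+1) + (1/2) ^ (n+1) = q + (1/2) ^ n := by ring
      have hp : ((1/2:ℝ) ^ n) ≠ 0 := by positivity
      have hp' : ((1/2:ℝ) ^ (n+1)) ≠ 0 := by positivity
      rw [e2]
      have a1 : ((1/2:ℝ) ^ (n+1))⁻¹ = 2 * ((1/2:ℝ)^n)⁻¹ := by rw [pow_succ]; field_simp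
      rw [a1]
      simp only [smul_sub, smul_smul]
      have a2 : (1/2:ℝ) ^ n / 4 * (2 * ((1/2:ℝ)^n)⁻¹) * (2 * ((1/2:ℝ)^n)⁻¹) = ((1/2:ℝ)^n)⁻¹ := by field_simp; norm_num
      rw [← mul_assoc, a2]
      module
    rw [dist_eq_norm, e, norm_smul, Real.norm_of_nonneg (by positivity)]
    have := h [t (n+1), t (n+1)]
    have h2 : (0:ℝ) < (1/2) ^ n := by positivity
    have h3 : ‖DD [t (n+1), t (n+1)] u‖ ≤ B 2 := this
    have h4 := norm_nonneg (DD [t (n+1), t (n+1)] u)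
    nlinarith
  obtain ⟨v, hv⟩ := cauchySeq_tendsto_of_complete (cauchySeq_of_le_geometric _ _ (by norm_num) hd)
  have tt : Filter.Tendsto (fun n => (t n : ℝ)) Filter.atTop (nhds 0) := by
    simp only [ht]
    exact tendsto_pow_atTop_nhds_zero_of_lt_one (by norm_num) (by norm_num)
  refine ⟨v, fun q => ?_, fun l => ?_⟩
  · refine hasDerivAt_of_tendstoUniformly (l := Filter.atTop) (f := fun n => ⇑(stek (t n) u)) (f' := fun n => ⇑((dOps E).δ (t n) u))
      (BoundedContinuousFunction.tendsto_iff_tendstoUniformly.1 hv)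
      (Filter.Eventually.of_forall fun n x => stek_HQ (t n) u x) (fun x => ?_) q
    have := ((stek_tendsto u x).tendsto 0).comp tt
    have e : stek 0 u x = u x := by rw [stek_apply]; simp
    rwa [e] at this
  · refine le_of_tendsto ((((DD_cont l).tendsto v).comp hv).norm) (Filter.Eventually.of_forall fun n => ?_)
    exact h (t n :: l)

lemma Q_seq {u : ℝ →ᵇ E} {B : ℕ → ℝ} (h : ∀ l, ‖DD l u‖ ≤ B l.length) :
    ∃ v : ℕ → ℝ →ᵇ E, v 0 = u ∧ (∀ k, HQ (v k) (v (k+1))) ∧ ∀ k, ‖v k‖ ≤ B k := by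
  choose f hf1 hf2 using fun (n : ℕ) (x : {u : ℝ →ᵇ E // ∀ l : List (Ioc (0:ℝ) 1), ‖DD l u‖ ≤ B (l.length + n)}) =>
    Q_step (B := fun m => B (m + n)) x.2
  let w : ∀ n, {u : ℝ →ᵇ E // ∀ l : List (Ioc (0:ℝ) 1), ‖DD l u‖ ≤ B (l.length + n)} := fun n =>
    Nat.rec ⟨u, h⟩ (fun n x => ⟨f n x, fun l => by
      have := hf2 n x l
      rwa [add_assoc, add_comm 1 n] at this⟩) n
  exact ⟨fun n => (w n).1, rfl, fun n => hf1 n (w n), fun n => by simpa using (w n).2 []⟩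

lemma HQ.add {u v u' v' : ℝ →ᵇ E} (h : HQ u v) (h' : HQ u' v') : HQ (u + u') (v + v') := fun q => (h q).add (h' q)
lemma HQ.mul {u v u' v' : ℝ →ᵇ E} (h : HQ u v) (h' : HQ u' v') : HQ (u * u') (u * v' + v * u') := fun q => by
  have := (h q).mul (h' q)
  rw [add_comm] at this
  exact this
lemma HQ.const (c : ℝ) : HQ (algebraMap ℝ (ℝ →ᵇ E) c) 0 := fun q => hasDerivAt_const q _

lemma HQ.inv {w u v : ℝ →ᵇ E} (h : HQ u v) (hw : w * u = 1) : HQ w (-(w * w * v)) := by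
  intro q
  have hw' : ∀ q, w q * u q = 1 := fun q => congrArg (fun f : ℝ →ᵇ E => f q) hw
  let U : ℝ → Eˣ := fun q => ⟨u q, w q, by rw [mul_comm, hw'], hw' q⟩
  have h1 : ∀ q, Ring.inverse (u q) = w q := fun q => Ring.inverse_unit (U q)
  have h2 := (hasFDerivAt_ringInverse (𝕜 := ℝ) (U q)).comp_hasDerivAt q (h q)
  have h3 : (w : ℝ → E) = Ring.inverse ∘ u := funext fun q => (h1 q).symm
  rw [h3]
  have h4 : -(w q * v q * w q) = -(w q * w q * v q) := by ring
  have h5 : HasDerivAt (Ring.inverse ∘ ⇑u) (-(w q * v q * w q)) q := h2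
  rw [h4] at h5; exact h5

lemma HQ.uniq {u v v' : ℝ →ᵇ E} (h : HQ u v) (h' : HQ u v') : v = v' := by
  ext q; exact (h q).unique (h' q)

end

section
variable {a b : ℝ} [hab : Fact (a < b)]

lemma DP_deriv {u v : AA a b} (h : DP u v) {p : ℝ} (hp : p ∈ Icc a b) : HasDerivWithinAt (ex u) (ex v p) (Icc a b) p :=
  (prim_deriv _ v p).hasDerivWithinAt.congr (fun x hx => h x hx) (h p hp)

lemma DP_of {u v : AA a b} (h : ∀ p ∈ Ioo a b, HasDerivAt (ex u) (ex v p) p) : DP u v := by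
  intro p hp
  have := intervalIntegral.integral_eq_sub_of_hasDerivAt_of_le hp.1 (ex_cont u).continuousOn
    (fun x hx => h x ⟨hx.1, hx.2.trans_le hp.2⟩) (ex_ii v a p)
  rw [this]; ring

lemma DP_const (c : ℝ) : DP (algebraMap ℝ (AA a b) c) 0 :=
  DP_of fun p _ => hasDerivAt_const p c

lemma DP.inv {w u v : AA a b} (h : DP u v) (hw : w * u = 1) : DP w (-(w * w * v)) := by
  refine DP_of fun p hp => ?_
  have hw' : ∀ p, ex w p * ex u p = 1 := fun p => by rw [← ex_mul, hw]; simp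
  have h1 := (DP_deriv h (Ioo_subset_Icc_self hp)).hasDerivAt (Icc_mem_nhds hp.1 hp.2)
  have h2 := h1.inv (right_ne_zero_of_mul_eq_one (hw' p))
  have h3 : ex w = (ex u)⁻¹ := funext fun p => eq_inv_of_mul_eq_one_left (hw' p)
  rw [h3]
  have h4 : -ex v p / ex u p ^ 2 = ex (-(w * w * v)) p := by
    rw [ex_neg, ex_mul, ex_mul, h3, Pi.inv_apply]; field_simp
  exact h4 ▸ h2

lemma DP_HQ {u v u' v' : FF a b} (h : ∀ q, DP (u q) (v q)) (hu : HQ u u') (hv : HQ v v') (q : ℝ) : DP (u' q) (v' q) := by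
  intro p hp
  let I : AA a b →L[ℝ] ℝ := LinearMap.mkContinuous
    { toFun := fun u => ∫ t in a..p, ex u t
      map_add' := fun u v => intervalIntegral.integral_add (ex_ii u a p) (ex_ii v a p)
      map_smul' := fun c u => intervalIntegral.integral_const_mul c _ } |p - a| (fun u => by
        rw [mul_comm]
        exact intervalIntegral.norm_integral_le_of_norm_le_const fun t _ => ex_le u t)
  let e : ℝ → AA a b →L[ℝ] ℝ := fun p => ContinuousMap.evalCLM ℝ (projIcc a b hle p)
  have h1 := (((e p).hasFDerivAt.comp_hasDerivAt q (hu q)).sub ((e a).hasFDerivAt.comp_hasDerivAt q (hu q))).sub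
    (I.hasFDerivAt.comp_hasDerivAt q (hv q))
  have h2 : ∀ q, e p (u q) - e a (u q) - I (v q) = 0 := fun q => by
    show ex (u q) p - ex (u q) a - (∫ t in a..p, ex (v q) t) = 0
    rw [h q p hp]; ring
  have h3 : e p (u' q) - e a (u' q) - I (v' q) = 0 :=
    h1.unique ((hasDerivAt_const q (0:ℝ)).congr_of_eventuallyEq (Filter.Eventually.of_forall h2))
  have h4 : ex (u' q) p - ex (u' q) a - (∫ t in a..p, ex (v' q) t) = 0 := h3
  linarith
end
end
end

section
open Set MeasureTheory
open scoped BoundedContinuousFunction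
noncomputable section

/-- jet generators -/
inductive Gn where
  | Z (k : ℕ) | H (k : ℕ) | Y | E | V | c (i : Fin 3) (k : ℕ)

abbrev PR := MvPolynomial Gn ℝ
namespace PR
open MvPolynomial

abbrev x (g : Gn) : PR := X g

def dq : Derivation ℝ PR PR := mkDerivation ℝ fun
  | .Z k => x (.Z (k+1))
  | .H k => x (.H (k+1))
  | .Y => x (.Z 0)
  | .E => -(x .E * x .E * (2 * x (.Z 0) * x (.Z 1)))
  | .V => -(x .V * x .V * x (.H 1))
  | .c _ _ => 0

def hp : PR := x .E * ((2 * (x (.Z 0) * (x (.H 0) * x (.H 1))) - x (.H 0) * (x (.H 0) * x (.Z 1)))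
  + (x (.c 0 0) + x (.c 1 0) * x .Y) * (x (.H 0) * (x (.H 0) * x (.H 0))))

def dp : Derivation ℝ PR PR := mkDerivation ℝ fun
  | .Z k => x (.H (k+1))
  | .H k => dq^[k] hp
  | .Y => x (.H 0)
  | .E => -(x .E * x .E * (2 * x (.Z 0) * x (.H 1)))
  | .V => -(x .V * x .V * hp)
  | .c i k => x (.c i (k+1))

lemma dq_X (g : Gn) : dq (X g) = match g with
  | .Z k => x (.Z (k+1))
  | .H k => x (.H (k+1))
  | .Y => x (.Z 0)
  | .E => -(x .E * x .E * (2 * x (.Z 0) * x (.Z 1)))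
  | .V => -(x .V * x .V * x (.H 1))
  | .c _ _ => 0 := mkDerivation_X ..

lemma dp_X (g : Gn) : dp (X g) = match g with
  | .Z k => x (.H (k+1))
  | .H k => dq^[k] hp
  | .Y => x (.H 0)
  | .E => -(x .E * x .E * (2 * x (.Z 0) * x (.H 1)))
  | .V => -(x .V * x .V * hp)
  | .c i k => x (.c i (k+1)) := mkDerivation_X ..

lemma two_d (D : Derivation ℝ PR PR) : D 2 = 0 := D.map_natCast 2

lemma dq_dp (f : PR) : dq (dp f) = dp (dq f) := by
  have h : ⁅dq, dp⁆ = 0 := by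
    ext g : 1
    rw [Derivation.commutator_apply]
    rcases g with k | k | _ | _ | _ | ⟨i, k⟩ <;>
      simp only [dq_X, dp_X, map_neg, Derivation.leibniz, two_d, smul_eq_mul, Derivation.coe_zero, Pi.zero_apply, map_zero,
        Function.iterate_succ_apply', Function.iterate_zero, id, Nat.zero_add, mul_assoc, sub_self, Function.iterate_one] <;>
      ring
  have := congrArg (fun D => D f) h
  rw [Derivation.commutator_apply] at this
  exact sub_eq_zero.1 this

variable {a b : ℝ} [hab : Fact (a < b)]

/-- a family of functions realising the jet -/
structure Jet (v : Gn → FF a b) : Prop where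
  hq : ∀ g, HQ (v g) (aeval v (dq (X g)))
  hp : ∀ g q, DP (v g q) (aeval v (dp (X g)) q)

lemma jq {v : Gn → FF a b} (h : ∀ g, HQ (v g) (aeval v (dq (X g)))) (f : PR) : HQ (aeval v f) (aeval v (dq f)) := by
  induction f using MvPolynomial.induction_on with
  | C r => simpa using HQ.const (E := AA a b) r
  | add f g hf hg => simpa only [map_add] using hf.add hg
  | mul_X f g hf =>
    have := hf.mul (h g)
    simpa only [map_mul, Derivation.leibniz, map_add, aeval_X, smul_eq_mul, mul_comm (aeval v (dq f)) (v g)] using this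

lemma Jet.p {v : Gn → FF a b} (h : Jet v) (f : PR) (q : ℝ) : DP (aeval v f q) (aeval v (dp f) q) := by
  induction f using MvPolynomial.induction_on with
  | C r => rw [aeval_C, derivation_C, map_zero]; exact DP_const (a := a) (b := b) r
  | add f g hf hg => rw [map_add, map_add, map_add]; exact hf.add hg
  | mul_X f g hf =>
    have := hf.mul (h.hp g q)
    have e : aeval v (dp (f * X g)) = aeval v f * aeval v (dp (X g)) + aeval v (dp f) * v g := by
      simp only [map_mul, Derivation.leibniz, map_add, aeval_X, smul_eq_mul, mul_comm (aeval v (dp f)) (v g)]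
    rw [e, map_mul, aeval_X]
    exact this

/-- scaled derivations -/
def O (R Θ : ℝ) : Ops Bool PR where
  δ i := if i then Θ⁻¹ • (dp : PR →ₗ[ℝ] PR) else R⁻¹ • (dq : PR →ₗ[ℝ] PR)
  T _ := AlgHom.id ℝ PR
  leib i f g := by cases i <;> simp [mul_comm, add_comm, smul_add]
  comm _ _ _ := rfl

variable {R Θ : ℝ}
lemma O_t (f : PR) : (O R Θ).δ true f = Θ⁻¹ • dp f := rfl
lemma O_f (f : PR) : (O R Θ).δ false f = R⁻¹ • dq f := rfl

lemma O_comm (i j : Bool) (f : PR) : (O R Θ).δ i ((O R Θ).δ j f) = (O R Θ).δ j ((O R Θ).δ i f) := by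
  cases i <;> cases j <;> simp only [O_t, O_f, map_smul, dq_dp, smul_comm R⁻¹ Θ⁻¹]

lemma O_perm {l l' : List Bool} (h : l.Perm l') (f : PR) : (O R Θ).D l f = (O R Θ).D l' f := by
  induction h generalizing f with
  | nil => rfl
  | cons i _ ih => exact ih _
  | swap i j l => simp only [Ops.D_cons, O_comm]
  | trans _ _ h1 h2 => exact (h1 f).trans (h2 f)

lemma yw_succ {s : ℝ} (hs : 1 ≤ s) (k : ℕ) : yw s k ≤ 4 * yw s (k+1) := by
  unfold yw
  have h1 : (k.factorial : ℝ) ^ s ≤ ((k+1).factorial : ℝ) ^ s :=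
    Real.rpow_le_rpow (by positivity) (by exact_mod_cast Nat.factorial_le (Nat.le_succ k)) (by linarith)
  rw [← mul_div_assoc, div_le_div_iff₀ (by positivity) (by positivity)]
  push_cast
  have h2 : ((k:ℝ) + 1 + 1) ^ 2 ≤ 4 * ((k:ℝ)+1) ^ 2 := by nlinarith [(Nat.cast_nonneg k : (0:ℝ) ≤ k)]
  have h0 : (0:ℝ) ≤ (k.factorial : ℝ) ^ s := by positivity
  calc _ ≤ ((k+1).factorial : ℝ) ^ s * (4 * ((k:ℝ)+1) ^ 2) := mul_le_mul h1 h2 (by positivity) (by positivity)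
    _ = _ := by ring

lemma cv_yw_add {s : ℝ} (hs : 1 ≤ s) (m k : ℕ) : cv (yw s) (fun k => yw s (k + m)) k ≤ 8 * yw s (k + m) := by
  refine le_trans ?_ (cv_yw hs (k + m))
  unfold cv
  rw [Finset.Nat.sum_antidiagonal_eq_sum_range_succ_mk, Finset.Nat.sum_antidiagonal_eq_sum_range_succ_mk]
  have nn : ∀ i j, 0 ≤ yw s i * yw s j := fun i j => (mul_pos (yw_pos s i) (yw_pos s j)).le
  refine le_trans (Finset.sum_le_sum (g := fun i => ((k+m).choose i : ℝ) * (yw s i * yw s (k + m - i))) fun i hi => ?_)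
    (Finset.sum_le_sum_of_subset_of_nonneg (Finset.range_subset_range.2 (by omega)) fun i _ _ => mul_nonneg (by positivity) (nn _ _))
  have : k - i + m = k + m - i := by have := Finset.mem_range.1 hi; omega
  simp only [this]
  exact mlr (by exact_mod_cast Nat.choose_le_choose i (by omega)) (nn _ _)

lemma bcf_ns {E : Type*} [NormedCommRing E] [NormedAlgebra ℝ E] (c : ℝ) (f : ℝ →ᵇ E) : ‖c • f‖ ≤ |c| * ‖f‖ := norm_smul_le c f

/-- word bounds -/
def Bd (v : Gn → FF a b) (R Θ s : ℝ) (P : List Bool → Prop) (m : ℕ) (A : ℝ) (f : PR) : Prop :=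
  ∀ w, P w → ‖aeval v ((O R Θ).D w f)‖ ≤ A * yw s (w.length + m)

section
variable {v : Gn → FF a b} {s : ℝ} {P : List Bool → Prop} {m : ℕ} {A B : ℝ} {f g : PR}

lemma Bd.nn (h : Bd v R Θ s P m A f) {w : List Bool} (hw : P w) : 0 ≤ A :=
  nonneg_of_mul_nonneg_left ((norm_nonneg (aeval v ((O R Θ).D w f))).trans (h w hw)) (yw_pos s _)

lemma Bd.mul (hs : 1 ≤ s) (hP : ∀ w w', P w → List.Sublist w' w → P w') (hf : Bd v R Θ s P 0 A f) (hg : Bd v R Θ s P m B g) :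
    Bd v R Θ s P m (8 * A * B) (f * g) := by
  intro w hw
  have h := Ops.conv_bound (O := O R Θ) (n1 := fun f => ‖aeval v f‖) (n2 := fun f => ‖aeval v f‖) (n3 := fun f => ‖aeval v f‖)
    (fun f g => by rw [map_add]; exact norm_add_le (aeval v f) (aeval v g))
    (fun f g => by rw [map_mul]; exact norm_mul_le (aeval v f) (aeval v g))
    (fun f => norm_nonneg (aeval v f)) (fun f => norm_nonneg (aeval v f)) (fun i g => rfl) w f g
    (fun k => A * yw s k) (fun k => B * yw s (k + m)) (fun l hl => hf l (hP _ _ hw hl)) (fun l hl => hg l (hP _ _ hw hl))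
  refine h.trans ?_
  have e : cv (fun k => A * yw s k) (fun k => B * yw s (k + m)) w.length = A * B * cv (yw s) (fun k => yw s (k + m)) w.length := by
    unfold cv; rw [Finset.mul_sum]; exact Finset.sum_congr rfl fun _ _ => by ring
  rw [e]
  have := mll (cv_yw_add hs m w.length) (mul_nonneg (hf.nn hw) (hg.nn hw))
  linarith

lemma Bd.add (hf : Bd v R Θ s P m A f) (hg : Bd v R Θ s P m B g) : Bd v R Θ s P m (A + B) (f + g) := by
  intro w hw
  rw [map_add, map_add, add_mul]
  exact (norm_add_le (aeval v ((O R Θ).D w f)) _).trans (add_le_add (hf w hw) (hg w hw))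

lemma Bd.smul (c : ℝ) (hf : Bd v R Θ s P m A f) : Bd v R Θ s P m (|c| * A) (c • f) := by
  intro w hw
  rw [map_smul, map_smul, mul_assoc]
  refine (bcf_ns c (aeval v ((O R Θ).D w f))).trans ?_
  exact mll (hf w hw) (abs_nonneg c)

lemma Bd.neg (hf : Bd v R Θ s P m A f) : Bd v R Θ s P m A (-f) := by
  have := hf.smul (-1)
  simpa using this

lemma Bd.two (hf : Bd v R Θ s P m A f) : Bd v R Θ s P m (2 * A) (2 * f) := by
  rw [two_mul, two_mul]; exact hf.add hf

lemma Bd.mono (hAB : A ≤ B) (hf : Bd v R Θ s P m A f) : Bd v R Θ s P m B f :=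
  fun w hw => (hf w hw).trans (mlr hAB (yw_pos s _).le)

lemma Bd.up (hs : 1 ≤ s) (hf : Bd v R Θ s P 0 A f) : Bd v R Θ s P 1 (4 * A) f := by
  intro w hw
  have := mll (yw_succ hs w.length) (hf.nn hw)
  have h2 := hf w hw
  simp only [add_zero] at h2
  linarith

lemma Bd.δ {P' : List Bool → Prop} (i : Bool) (hP : ∀ w, P w → P' (i :: w)) (hf : Bd v R Θ s P' m A f) :
    Bd v R Θ s P (m+1) A ((O R Θ).δ i f) := by
  intro w hw
  have := hf _ (hP w hw)
  rw [List.length_cons, add_assoc, add_comm 1 m] at this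
  exact this
end
end PR
end
end

section
open Set MeasureTheory
open scoped BoundedContinuousFunction
noncomputable section
namespace PR
open MvPolynomial
variable {a b : ℝ} [hab : Fact (a < b)] {v : Gn → FF a b} {s R Θ : ℝ}

lemma bcf_n0 {E : Type*} [NormedCommRing E] : ‖(0 : ℝ →ᵇ E)‖ = 0 := norm_zero
lemma asE (e z h : PR) : -(e * e * (2 * z * h)) = -(e * (e * (2 * (z * h)))) := by ring

lemma sq_two (k : ℕ) : ((k:ℝ) + 1) ^ 2 ≤ 4 * 2 ^ k := by
  induction k with
  | zero => norm_num
  | succ k ih =>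
    rcases k with _ | _ | k
    · norm_num
    · norm_num
    · push_cast at ih ⊢
      rw [pow_succ (2:ℝ)]
      have : (0:ℝ) ≤ k := Nat.cast_nonneg k
      nlinarith

lemma geo_yw {s : ℝ} (hs : 1 ≤ s) (k : ℕ) : (1/2:ℝ) ^ k * (k.factorial:ℝ) ^ s ≤ 4 * yw s k := by
  unfold yw
  rw [← mul_div_assoc, le_div_iff₀ (by positivity), one_div, inv_pow]
  have h := sq_two k
  have h0 : (0:ℝ) ≤ (k.factorial : ℝ) ^ s := by positivity
  have h1 : (0:ℝ) < 2 ^ k := by positivity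
  calc _ = (k.factorial : ℝ) ^ s * (((k:ℝ)+1) ^ 2 / 2 ^ k) := by field_simp
    _ ≤ (k.factorial : ℝ) ^ s * 4 := mll (by rw [div_le_iff₀ h1]; linarith) h0
    _ = _ := by ring

lemma fact_rpow {s : ℝ} (hs : 1 ≤ s) (k : ℕ) : (k.factorial:ℝ) ≤ (k.factorial:ℝ) ^ s :=
  Real.self_le_rpow_of_one_le (by exact_mod_cast k.factorial_pos) hs

/-- pure q words -/
def Pq (n : ℕ) (w : List Bool) : Prop := true ∉ w ∧ w.length ≤ n

lemma Pq_sub (n : ℕ) (w w' : List Bool) (h : Pq n w) (h' : List.Sublist w' w) : Pq n w' :=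
  ⟨fun h2 => h.1 (h'.subset h2), h'.length_le.trans h.2⟩

/-- chain of generators -/
lemma chain_q {Cc r : ℝ} (hs : 1 ≤ s) (hr : 1 ≤ r) (hC : 0 ≤ Cc) (hR : 2 * r ≤ R) (u : ℕ → PR) (hu : ∀ k, dq (u k) = u (k+1))
    (hn : ∀ k, ‖aeval v (u k)‖ ≤ Cc * (r ^ k * k.factorial)) (n : ℕ) :
    Bd v R Θ s (Pq n) 0 (4 * Cc) (u 0) ∧ Bd v R Θ s (Pq n) 1 (8 * Cc * r / R) ((O R Θ).δ false (u 0)) := by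
  have R0 : 0 < R := by linarith
  have key : ∀ w : List Bool, true ∉ w → ∀ k, (O R Θ).D w (u k) = (R⁻¹) ^ w.length • u (k + w.length) := by
    intro w
    induction w with
    | nil => intro _ k; simp
    | cons i w ih =>
      intro h k
      cases i
      · have h' : true ∉ w := fun h2 => h (List.mem_cons_of_mem _ h2)
        rw [Ops.D_cons, O_f, hu, map_smul, ih h', smul_smul, List.length_cons, pow_succ', add_assoc, add_comm 1]
      · simp at h
  have b : ∀ k, ‖aeval v ((R⁻¹) ^ k • u k)‖ ≤ Cc * ((r/R) ^ k * (k.factorial:ℝ) ^ s) := by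
    intro k
    rw [map_smul]
    refine (bcf_ns _ (aeval v (u k))).trans ?_
    rw [abs_of_nonneg (by positivity)]
    calc _ ≤ R⁻¹ ^ k * (Cc * (r ^ k * (k.factorial:ℝ) ^ s)) := by
          refine mll ((hn k).trans ?_) (by positivity)
          exact mll (mll (fact_rpow hs k) (by positivity)) hC
      _ = _ := by rw [div_pow, inv_pow]; field_simp
  have hh : r / R ≤ 1/2 := by rw [div_le_iff₀ R0]; linarith
  have h0 : 0 ≤ r / R := by positivity
  have e : ∀ k, (r/R) ^ k * (k.factorial:ℝ) ^ s ≤ 4 * yw s k := fun k =>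
    (mlr (pow_le_pow_left₀ h0 hh k) (by positivity)).trans (geo_yw hs k)
  have e' : ∀ k, (r/R) ^ (k+1) * ((k+1).factorial:ℝ) ^ s ≤ 8 * (r/R) * yw s (k+1) := fun k => by
    have h1 := geo_yw hs (k+1)
    have h2 : (r/R) ^ k ≤ (1/2:ℝ) ^ k := pow_le_pow_left₀ h0 hh k
    have h3 : (0:ℝ) ≤ ((k+1).factorial:ℝ) ^ s := by positivity
    calc _ = (r/R) * ((r/R) ^ k * ((k+1).factorial:ℝ) ^ s) := by ring
      _ ≤ (r/R) * ((1/2) ^ k * ((k+1).factorial:ℝ) ^ s) := by gcongr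
      _ = 2 * (r/R) * ((1/2) ^ (k+1) * ((k+1).factorial:ℝ) ^ s) := by ring
      _ ≤ 2 * (r/R) * (4 * yw s (k+1)) := by gcongr
      _ = _ := by ring
  constructor
  · intro w hw
    rw [key w hw.1, zero_add, add_zero]
    refine (b _).trans ?_
    have := mll (e w.length) hC
    linarith
  · intro w hw
    have := key (false :: w) (by simpa using hw.1) 0
    rw [Ops.D_cons] at this
    rw [this, zero_add, List.length_cons]
    refine (b _).trans ?_
    have := mll (e' w.length) hC
    refine this.trans (le_of_eq ?_); ring

/-- the data: sequence bounds -/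
structure Dat (v : Gn → FF a b) (s C r M : ℝ) : Prop where
  hs : 1 ≤ s
  hr : 1 ≤ r
  hC : 1 ≤ C
  hM : 1 ≤ M
  Z : ∀ k, ‖v (.Z k)‖ ≤ C * (r ^ k * k.factorial)
  H : ∀ k, ‖v (.H k)‖ ≤ C * (r ^ k * k.factorial)
  Y : ‖v .Y‖ ≤ C
  E : ‖v .E‖ ≤ C
  V : ‖v .V‖ ≤ C
  c : ∀ i k, ‖v (.c i k)‖ ≤ M ^ (k+1) * (k.factorial:ℝ) ^ s

lemma yw0 (s : ℝ) : yw s 0 = 1 := by simp [yw]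

variable {C r M : ℝ}

lemma base_q (h : Dat v s C r M) : ∃ R0, 1 ≤ R0 ∧ ∀ Θ n, ∀ g ∈ ({.Z 0, .H 0, .Y, .E, .V} : Set Gn),
    Bd v R0 Θ s (Pq n) 0 (4 * C) (X g) := by
  have hC := h.hC; have hr := h.hr; have hs := h.hs
  obtain ⟨R, hR⟩ : ∃ R, R = 131072 * C ^ 3 * r := ⟨_, rfl⟩
  have hC3 : 1 ≤ C ^ 3 := one_le_pow₀ hC
  have h1 : 1 ≤ C ^ 3 * r := one_le_mul_of_one_le_of_one_le hC3 hr
  have h2 : r ≤ C ^ 3 * r := le_mul_of_one_le_left (by linarith) hC3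
  have R1 : 1 ≤ R := by rw [hR]; linarith
  have R2 : 2 * r ≤ R := by rw [hR]; linarith
  refine ⟨R, R1, fun Θ n => ?_⟩
  have cZ := chain_q (Cc := C) (v := v) (Θ := Θ) (R := R) hs hr (by linarith) R2 (fun k => X (.Z k)) (fun k => dq_X _) (fun k => by rw [aeval_X]; exact h.Z k)
  have cH := chain_q (Cc := C) (v := v) (Θ := Θ) (R := R) hs hr (by linarith) R2 (fun k => X (.H k)) (fun k => dq_X _) (fun k => by rw [aeval_X]; exact h.H k)
  have cY := chain_q (Cc := C) (v := v) (Θ := Θ) (R := R) hs hr (by linarith) R2 (fun k => Nat.casesOn k (X .Y) (fun k => X (.Z k)))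
    (fun k => by cases k <;> exact dq_X _) (fun k => by
      cases k with
      | zero => simpa using h.Y
      | succ k =>
        simp only [aeval_X]
        refine (h.Z k).trans (mll ?_ (by linarith))
        exact mul_le_mul (pow_le_pow_right₀ hr (Nat.le_succ k)) (by exact_mod_cast Nat.factorial_le (Nat.le_succ k)) (by positivity) (by positivity))
  obtain ⟨ε, hε⟩ : ∃ ε, ε = 8 * C * r / R := ⟨_, rfl⟩
  have hε' : 16384 * C ^ 2 * ε = 1 := by
    have : r ≠ 0 := by linarith
    have : C ≠ 0 := by linarith
    rw [hε, hR]; field_simp; norm_num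
  have ε0 : 0 ≤ ε := by rw [hε]; positivity
  simp only [← hε] at cZ cH
  have EV : Bd v R Θ s (Pq n) 0 (4 * C) (X .E) ∧ Bd v R Θ s (Pq n) 0 (4 * C) (X .V) := by
    clear cY
    induction n with
    | zero =>
      constructor
      · rintro w ⟨_, hw⟩
        obtain rfl := List.eq_nil_of_length_eq_zero (Nat.le_zero.1 hw)
        simp only [Ops.D_nil, aeval_X, List.length_nil, yw0, add_zero]; linarith [h.E]
      · rintro w ⟨_, hw⟩
        obtain rfl := List.eq_nil_of_length_eq_zero (Nat.le_zero.1 hw)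
        simp only [Ops.D_nil, aeval_X, List.length_nil, yw0, add_zero]; linarith [h.V]
    | succ n ih =>
      have red : ∀ g : Gn, ‖v g‖ ≤ C → Bd v R Θ s (Pq n) 1 (4 * C) ((O R Θ).δ false (X g)) → Bd v R Θ s (Pq (n+1)) 0 (4 * C) (X g) := by
        rintro g hg hb w ⟨h1, h2⟩
        rcases w with _ | ⟨i, w⟩
        · simp only [Ops.D_nil, aeval_X, List.length_nil, yw0, add_zero]; linarith
        · cases i
          · exact hb w ⟨fun h => h1 (List.mem_cons_of_mem _ h), by simpa using h2⟩
          · simp at h1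
      have eE : (O R Θ).δ false (X .E) = -(x .E * (x .E * (2 * (x (.Z 0) * (O R Θ).δ false (X (.Z 0)))))) := by
        simp only [O_f, dq_X, smul_neg, mul_smul_comm]; congr 2; ring
      have eV : (O R Θ).δ false (X .V) = -(x .V * (x .V * (O R Θ).δ false (X (.H 0)))) := by
        simp only [O_f, dq_X, smul_neg, mul_smul_comm]; congr 2; ring
      constructor
      · refine red _ h.E ?_
        rw [eE]
        refine (ih.1.mul hs (Pq_sub n) (ih.1.mul hs (Pq_sub n) ((cZ n).1.mul hs (Pq_sub n) (cZ n).2).two)).neg.mono ?_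
        nlinarith
      · refine red _ h.V ?_
        rw [eV]
        refine (ih.2.mul hs (Pq_sub n) (ih.2.mul hs (Pq_sub n) (cH n).2)).neg.mono ?_
        nlinarith
  rintro g (rfl | rfl | rfl | rfl | rfl)
  exacts [(cZ n).1, (cH n).1, (cY n).1, EV.1, EV.2]

lemma c_word (h : Dat v s C r M) (hΘ : 2 * M ≤ Θ) (i : Fin 3) (w : List Bool) :
    ‖aeval v ((O R Θ).D w (X (.c i 0)))‖ ≤ 4 * M * yw s w.length := by
  have Θ0 : 0 < Θ := by linarith [h.hM]
  have M0 : 0 < M := by linarith [h.hM]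
  have key : ∀ j, ‖aeval v ((O R Θ).D w (X (.c i j)))‖ ≤ (Θ⁻¹) ^ w.length * ‖v (.c i (j + w.length))‖ := by
    induction w with
    | nil => intro j; simp
    | cons t w ih =>
      intro j
      cases t
      · rw [Ops.D_cons, O_f, dq_X, smul_zero, map_zero, map_zero, bcf_n0]; exact mul_nonneg (by positivity) (norm_nonneg (v _))
      · rw [Ops.D_cons, O_t, dp_X, map_smul, map_smul]
        refine (bcf_ns _ (aeval v ((O R Θ).D w (x (.c i (j+1)))))).trans ?_
        rw [abs_of_pos (by positivity), List.length_cons, pow_succ', mul_assoc, add_comm w.length 1, ← add_assoc]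
        exact mll (ih (j+1)) (by positivity)
  refine (key 0).trans ?_
  rw [zero_add]
  have hh : Θ⁻¹ * M ≤ 1/2 := by rw [inv_mul_le_iff₀ Θ0]; linarith
  calc _ ≤ Θ⁻¹ ^ w.length * (M ^ (w.length+1) * (w.length.factorial:ℝ) ^ s) := mll (h.c i _) (by positivity)
    _ = M * ((Θ⁻¹ * M) ^ w.length * (w.length.factorial:ℝ) ^ s) := by ring
    _ ≤ M * ((1/2) ^ w.length * (w.length.factorial:ℝ) ^ s) := by gcongr
    _ ≤ M * (4 * yw s w.length) := mll (geo_yw h.hs _) M0.le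
    _ = _ := by ring

def Pn (n : ℕ) (w : List Bool) : Prop := w.count true ≤ n
lemma Pn_sub (n : ℕ) (w w' : List Bool) (h : Pn n w) (h' : List.Sublist w' w) : Pn n w' := (h'.count_le true).trans h

lemma hp_bd (hs : 1 ≤ s) {P : List Bool → Prop} (hP : ∀ w w', P w → List.Sublist w' w → P w') (hPf : ∀ w, P w → P (false :: w)) {A : ℝ} (hR : 1 ≤ R)
    (hb : ∀ g ∈ ({.Z 0, .H 0, .Y, .E, .V, .c 0 0, .c 1 0} : Set Gn), Bd v R Θ s P 0 A (X g)) :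
    Bd v R Θ s P 1 (R * A) (x (.H 1)) ∧
    Bd v R Θ s P 1 (8 * A * (((2 * (8 * A * (8 * A * (R * A)))) + 8 * A * (8 * A * (R * A))) + 8 * (A + 8 * A * A) * (8 * A * (8 * A * (4 * A))))) hp := by
  have R0 : R ≠ 0 := by linarith
  have s1 : ∀ g g' : Gn, dq (X g) = x g' → Bd v R Θ s P 0 A (X g) → Bd v R Θ s P 1 (R * A) (x g') := by
    intro g g' e h
    have := (h.δ false hPf).smul R
    rw [O_f, e, smul_smul, mul_inv_cancel₀ R0, one_smul, abs_of_nonneg (by linarith)] at this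
    exact this
  have Z := hb (.Z 0) (by simp)
  have H := hb (.H 0) (by simp)
  have E := hb (.E) (by simp)
  have Y := hb (.Y) (by simp)
  have c0 := hb (.c 0 0) (by simp)
  have c1 := hb (.c 1 0) (by simp)
  have H1 := s1 _ _ (dq_X (.H 0)) H
  have Z1 := s1 _ _ (dq_X (.Z 0)) Z
  refine ⟨H1, ?_⟩
  have h1 := (Z.mul hs hP (H.mul hs hP H1)).two.add (H.mul hs hP (H.mul hs hP Z1)).neg
  have h2 := (c0.add (c1.mul hs hP Y)).mul hs hP (H.mul hs hP (H.mul hs hP (H.up hs)))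
  have h3 := E.mul hs hP (h1.add h2)
  rw [← sub_eq_add_neg] at h3
  exact h3

lemma all_words (h : Dat v s C r M) : ∃ R Θ A : ℝ, 1 ≤ R ∧ 1 ≤ Θ ∧ 1 ≤ A ∧ ∀ w, ∀ g ∈ ({.Z 0, .H 0, .Y, .E, .V, .c 0 0, .c 1 0, .c 2 0} : Set Gn),
    ‖aeval v ((O R Θ).D w (X g))‖ ≤ A * yw s w.length := by
  obtain ⟨R, R1, hq⟩ := base_q h
  have hs := h.hs; have hM := h.hM; have hC := h.hC
  obtain ⟨A, hA⟩ : ∃ A, A = 4 * C + 4 * M := ⟨_, rfl⟩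
  have A1 : 1 ≤ A := by linarith
  obtain ⟨K, hK⟩ : ∃ K, K = 8 * A * (((2 * (8 * A * (8 * A * (R * A)))) + 8 * A * (8 * A * (R * A))) + 8 * (A + 8 * A * A) * (8 * A * (8 * A * (4 * A)))) := ⟨_, rfl⟩
  have K0 : 0 ≤ K := by rw [hK]; positivity
  obtain ⟨L, hL⟩ : ∃ L, L = 8 * A * (8 * A * (2 * (8 * A * (R * A)))) := ⟨_, rfl⟩
  have L0 : 0 ≤ L := by rw [hL]; positivity
  obtain ⟨Θ, hΘ⟩ : ∃ Θ, Θ = 2 * M + R * A + 4 * A + K + L + 8 * A * (8 * A * K) := ⟨_, rfl⟩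
  have q1 : 0 ≤ 8 * A * (8 * A * K) := by positivity
  have q2 : 0 ≤ R * A := by positivity
  have Θ1 : 1 ≤ Θ := by rw [hΘ]; linarith
  have Θ0 : 0 < Θ := by linarith
  have cw : ∀ n i, Bd v R Θ s (Pn n) 0 A (X (.c i 0)) := fun n i w _ =>
    (c_word h (by rw [hΘ]; linarith) i w).trans (mlr (by linarith) (yw_pos s _).le)
  have key : ∀ n, ∀ g ∈ ({.Z 0, .H 0, .Y, .E, .V} : Set Gn), Bd v R Θ s (Pn n) 0 A (X g) := by
    intro n
    induction n with
    | zero =>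
      intro g hg w hw
      have hw' : true ∉ w := List.count_eq_zero.1 (Nat.le_zero.1 hw)
      exact ((hq Θ w.length g hg).mono (by linarith : 4 * C ≤ A)) w ⟨hw', le_rfl⟩
    | succ n ih =>
      have red : ∀ g B, Bd v R Θ s (Pn n) 0 A (X g) → Bd v R Θ s (Pn n) 1 B (dp (X g)) → B ≤ Θ → Bd v R Θ s (Pn (n+1)) 0 A (X g) := by
        intro g B hg hb hB w hw
        by_cases hn : w.count true ≤ n
        · exact hg w hn
        have hm : true ∈ w := List.count_pos_iff.1 (by omega)
        have hp := List.perm_cons_erase hm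
        rw [O_perm hp, hp.length_eq, Ops.D_cons, O_t]
        have hc : (w.erase true).count true ≤ n := by
          rw [List.count_erase_self]; have : w.count true ≤ n + 1 := hw; omega
        have := ((hb.smul Θ⁻¹).mono (B := A) (by
          rw [abs_of_pos (by positivity), inv_mul_le_iff₀ Θ0]; nlinarith)) _ hc
        simpa using this
      have ih' : ∀ g ∈ ({.Z 0, .H 0, .Y, .E, .V, .c 0 0, .c 1 0} : Set Gn), Bd v R Θ s (Pn n) 0 A (X g) := by
        rintro g (rfl | rfl | rfl | rfl | rfl | rfl | rfl)
        exacts [ih _ (by simp), ih _ (by simp), ih _ (by simp), ih _ (by simp), ih _ (by simp), cw n 0, cw n 1]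
      have hPf : ∀ w, Pn n w → Pn n (false :: w) := fun w hw => by unfold Pn at *; simpa using hw
      obtain ⟨H1, hpb⟩ := hp_bd hs (Pn_sub n) hPf R1 ih'
      rw [← hK] at hpb
      have Z := ih (.Z 0) (by simp)
      have H := ih (.H 0) (by simp)
      have E := ih (.E) (by simp)
      have V := ih (.V) (by simp)
      rintro g (rfl | rfl | rfl | rfl | rfl)
      · exact red _ _ Z (by rw [dp_X]; exact H1) (by rw [hΘ]; linarith)
      · exact red _ _ H (by rw [dp_X]; exact hpb) (by rw [hΘ]; linarith)
      · exact red _ _ (ih .Y (by simp)) (by rw [dp_X]; exact H.up hs) (by rw [hΘ]; linarith)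
      · refine red _ L E ?_ (by rw [hΘ]; linarith)
        rw [dp_X, hL]
        simp only [asE]
        exact (E.mul hs (Pn_sub n) (E.mul hs (Pn_sub n) (Z.mul hs (Pn_sub n) H1).two)).neg
      · refine red _ (8 * A * (8 * A * K)) V ?_ (by rw [hΘ]; linarith)
        rw [dp_X]
        simp only [mul_assoc (x .V)]
        exact (V.mul hs (Pn_sub n) (V.mul hs (Pn_sub n) hpb)).neg
  refine ⟨R, Θ, A, R1, Θ1, A1, fun w g hg => ?_⟩
  have := fun g hg => key (w.count true) g hg w le_rfl
  have c := fun i => cw (w.count true) i w le_rfl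
  rcases hg with (rfl | rfl | rfl | rfl | rfl | rfl | rfl | rfl)
  exacts [this _ (by simp), this _ (by simp), this _ (by simp), this _ (by simp), this _ (by simp), c 0, c 1, c 2]

/-- derivatives in physical coordinates: `false` is `x`, `true` is `y` -/
def Dx : Bool → PR → PR
  | false, f => dq f - x (.Z 0) * (x .V * dp f)
  | true, f => x .V * dp f

def DW : List Bool → PR → PR
  | [], f => f
  | i :: w, f => Dx i (DW w f)

theorem phys (h : Dat v s C r M) : ∃ A K : ℝ, 1 ≤ A ∧ 1 ≤ K ∧ ∀ w, ‖aeval v (DW w (X (.c 2 0)))‖ ≤ A * K ^ w.length * (w.length.factorial:ℝ) ^ s := by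
  obtain ⟨R, Θ, A, R1, Θ1, A1, hb⟩ := all_words h
  have hs := h.hs
  obtain ⟨K, hK⟩ : ∃ K, K = R + 8 * A * (8 * A * Θ) + 8 * A * Θ := ⟨_, rfl⟩
  have p1 : 0 ≤ 8 * A * (8 * A * Θ) := by positivity
  have p2 : 0 ≤ 8 * A * Θ := by positivity
  refine ⟨A, K, A1, by linarith, fun w => ?_⟩
  have tr : ∀ w w' : List Bool, True → List.Sublist w' w → True := fun _ _ _ _ => trivial
  have B : ∀ g ∈ ({.Z 0, .H 0, .Y, .E, .V, .c 0 0, .c 1 0, .c 2 0} : Set Gn), Bd v R Θ s (fun _ => True) 0 A (X g) := fun g hg w _ => hb w g hg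
  have key : ∀ w, Bd v R Θ s (fun _ => True) w.length (A * K ^ w.length) (DW w (X (.c 2 0))) := by
    intro w
    induction w with
    | nil => simpa [DW] using B (.c 2 0) (by simp)
    | cons i w ih =>
      obtain ⟨f, hf⟩ : ∃ f, f = DW w (X (.c 2 0)) := ⟨_, rfl⟩
      rw [← hf] at ih
      obtain ⟨T, hT⟩ : ∃ T, T = A * K ^ w.length := ⟨_, rfl⟩
      rw [← hT] at ih
      have T0 : 0 ≤ T := ih.nn (w := []) trivial
      have d1 := (ih.δ (P := fun _ => True) false (fun _ _ => trivial)).smul R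
      have d2 := (ih.δ (P := fun _ => True) true (fun _ _ => trivial)).smul Θ
      rw [O_f, smul_smul, mul_inv_cancel₀ (by positivity), one_smul, abs_of_pos (by positivity)] at d1
      rw [O_t, smul_smul, mul_inv_cancel₀ (by positivity), one_smul, abs_of_pos (by positivity)] at d2
      have d3 := (B .V (by simp)).mul hs tr d2
      have d4 := ((B (.Z 0) (by simp)).mul hs tr d3).neg
      have e : A * K ^ (i :: w).length = T * R + T * (8 * A * (8 * A * Θ)) + T * (8 * A * Θ) := by
        rw [List.length_cons, pow_succ, ← mul_assoc, ← hT, hK]; ring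
      rw [e]
      have r1 := mul_nonneg T0 p1
      have r2 := mul_nonneg T0 p2
      have r3 : 0 ≤ T * R := by positivity
      cases i
      · have := d1.add d4
        rw [← sub_eq_add_neg] at this
        simp only [DW, ← hf]
        exact this.mono (by nlinarith)
      · simp only [DW, ← hf]
        exact d3.mono (by nlinarith)
  have := key w [] trivial
  simp only [Ops.D_nil, List.length_nil, zero_add] at this
  refine this.trans (mll ?_ (by rw [hK]; positivity))
  unfold yw
  exact div_le_self (by positivity) (by nlinarith [(Nat.cast_nonneg w.length : (0:ℝ) ≤ w.length)])
end PR
end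
end

section
open Set MeasureTheory
open scoped BoundedContinuousFunction
noncomputable section
open MvPolynomial PR

lemma gen1 {R : Type*} [CommRing R] (w z z1 : R) : -(w * w * (2 * z * z1)) = -(w * w * (0 + (z * z1 + z1 * z))) := by ring
lemma gen2 {R : Type*} [CommRing R] {Z H Y Zq Zp Hp c1 c2 W : R}
    (pde : (1 + Z * Z) * Hp - (Z * H * Zp + Z * H * Zp) + (H * H) * Zq = (c1 + c2 * Y) * (H * (H * H)))
    (WZ : W * (1 + Z * Z) = 1) : W * ((2 * (Z * (H * Zp)) - H * (H * Zq)) + (c1 + c2 * Y) * (H * (H * H))) = Hp := by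
  linear_combination W * (-pde) + Hp * WZ
lemma gen3 {E : Type*} [NormedCommRing E] [NormedAlgebra ℝ E] (f : ℝ →ᵇ E) : (2:ℝ) • f = f + f := two_smul ℝ f

variable {a b : ℝ} [hab : Fact (a < b)]

lemma DP_uniq_cast {u v v' : AA a b} (h : DP u v) (e : v = v') : DP u v' := e ▸ h

theorem Sys.jet (S : Sys a b) {s M : ℝ} (hs : 1 ≤ s) (hM : 1 ≤ M) (cc : Fin 3 → ℕ → FF a b) (c0 : cc 0 0 = S.c1) (c1 : cc 1 0 = S.c2)
    (hcq : ∀ i k, HQ (cc i k) 0) (hcp : ∀ i k q, DP (cc i k q) (cc i (k+1) q))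
    (hcb : ∀ i k, ‖cc i k‖ ≤ M ^ (k+1) * (k.factorial:ℝ) ^ s) :
    ∃ v : Gn → FF a b, Jet v ∧ (∃ C r, Dat v s C r M) ∧ v (.Z 0) = S.Z ∧ v (.H 0) = S.H ∧ v .Y = S.Y ∧ v .V = S.V ∧ ∀ i k, v (.c i k) = cc i k := by
  obtain ⟨C, r, hC, hr, hb⟩ := S.qana
  obtain ⟨Zk, Z0, Zs, Zb⟩ := Q_seq (u := S.Z) (B := fun k => C * (r ^ k * k.factorial)) fun l => (hb l).1
  obtain ⟨Hk, H0, Hs, Hb⟩ := Q_seq (u := S.H) (B := fun k => C * (r ^ k * k.factorial)) fun l => (hb l).2.1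
  have Z1 : Zk 1 = S.Zq := (Zs 0).uniq (by rw [Z0]; exact S.hZq)
  have H1 : Hk 1 = S.Zp := (Hs 0).uniq (by rw [H0]; exact S.hHq)
  let v : Gn → FF a b := fun
    | .Z k => Zk k | .H k => Hk k | .Y => S.Y | .E => S.W | .V => S.V | .c i k => cc i k
  have hZZ : HQ (1 + S.Z * S.Z) (0 + (S.Z * S.Zq + S.Zq * S.Z)) := by
    have h1 := HQ.const (E := AA a b) 1
    rw [map_one] at h1
    exact h1.add (S.hZq.mul S.hZq)
  have hq : ∀ g, HQ (v g) (aeval v (dq (X g))) := by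
    intro g
    rw [dq_X]
    rcases g with k | k | _ | _ | _ | ⟨i, k⟩
    · simp only [aeval_X]; exact Zs k
    · simp only [aeval_X]; exact Hs k
    · simp only [aeval_X]; show HQ S.Y (Zk 0); rw [Z0]; exact S.hYq
    · simp only [map_neg, map_mul, map_ofNat, aeval_X]
      show HQ S.W (-(S.W * S.W * (2 * Zk 0 * Zk 1)))
      rw [Z0, Z1]
      have := hZZ.inv S.WZ
      rw [← gen1 (R := FF a b)] at this
      exact this
    · simp only [map_neg, map_mul, aeval_X]
      show HQ S.V (-(S.V * S.V * Hk 1))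
      rw [H1]
      exact S.hHq.inv S.VH
    · simp only [map_zero]; exact hcq i k
  have hHp : aeval v hp = S.Hp := by
    unfold PR.hp
    simp only [map_mul, map_add, map_sub, map_ofNat, aeval_X]
    show S.W * ((2 * (Zk 0 * (Hk 0 * Hk 1)) - Hk 0 * (Hk 0 * Zk 1)) + (cc 0 0 + cc 1 0 * S.Y) * (Hk 0 * (Hk 0 * Hk 0))) = S.Hp
    rw [Z0, H0, H1, Z1, c0, c1]
    have := S.pde
    rw [gen3] at this
    exact gen2 (R := FF a b) this S.WZ
  have eZ : ∀ k q, DP (Zk k q) (Hk (k+1) q) := by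
    intro k
    induction k with
    | zero => intro q; rw [Z0, H1]; exact S.hZp q
    | succ k ih => exact DP_HQ ih (Zs k) (Hs (k+1))
  have eH : ∀ k q, DP (Hk k q) (aeval v (dq^[k] hp) q) := by
    intro k
    induction k with
    | zero => intro q; simp only [Function.iterate_zero, id]; rw [H0, hHp]; exact S.hHp q
    | succ k ih => rw [Function.iterate_succ_apply']; exact DP_HQ ih (Hs k) (jq hq _)
  have hpp : ∀ g q, DP (v g q) (aeval v (dp (X g)) q) := by
    intro g q
    rw [dp_X]
    rcases g with k | k | _ | _ | _ | ⟨i, k⟩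
    · simp only [aeval_X]; exact eZ k q
    · exact eH k q
    · simp only [aeval_X]; show DP (S.Y q) (Hk 0 q); rw [H0]; exact S.hYp q
    · simp only [map_neg, map_mul, map_ofNat, aeval_X]
      rw [gen1 (R := FF a b)]
      show DP (S.W q) (-(S.W q * S.W q * (0 + (Zk 0 q * Hk 1 q + Hk 1 q * Zk 0 q))))
      rw [Z0, H1]
      have h1 := DP_const (a := a) (b := b) 1
      rw [map_one] at h1
      exact (h1.add ((S.hZp q).mul (S.hZp q))).inv (congrArg (fun f : FF a b => f q) S.WZ)
    · simp only [map_neg, map_mul, aeval_X, hHp]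
      show DP (S.V q) (-(S.V q * S.V q * S.Hp q))
      exact (S.hHp q).inv (congrArg (fun f : FF a b => f q) S.VH)
    · simp only [aeval_X]; exact hcp i k q
  refine ⟨v, ⟨hq, hpp⟩, ⟨1 + C + ‖S.W‖ + ‖S.V‖, r, ?_⟩, Z0, H0, rfl, rfl, fun _ _ => rfl⟩
  have w0 := norm_nonneg S.W
  have v0 := norm_nonneg S.V
  have mono : ∀ k : ℕ, C * (r ^ k * k.factorial) ≤ (1 + C + ‖S.W‖ + ‖S.V‖) * (r ^ k * k.factorial) := fun k =>
    mlr (by linarith) (by positivity)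
  refine ⟨hs, hr, by linarith, hM, fun k => (Zb k).trans (mono k), fun k => (Hb k).trans (mono k), ?_, ?_, ?_, hcb⟩
  · have := (hb []).2.2
    simp only [Ops.D_nil, List.length_nil, pow_zero, Nat.factorial_zero, Nat.cast_one, mul_one] at this
    exact this.trans (by linarith)
  · show ‖S.W‖ ≤ _; linarith
  · show ‖S.V‖ ≤ _; linarith
end
end

section
open Set MeasureTheory
open scoped BoundedContinuousFunction
noncomputable section
namespace Fam
variable {P : Type*} [AddCommGroup P] [Module ℝ P] (D : Bool → P →ₗ[ℝ] P)

def L (h : ℝ × ℝ) : P →ₗ[ℝ] P := h.1 • D false + h.2 • D true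
def LM : ∀ n : ℕ, (Fin n → ℝ × ℝ) → P → P
  | 0, _, f => f
  | n+1, m, f => L D (m 0) (LM n (Fin.tail m) f)
def W : List Bool → P → P
  | [], f => f
  | i :: w, f => D i (W w f)

lemma W_append (w w' : List Bool) (f : P) : W D (w ++ w') f = W D w (W D w' f) := by
  induction w with
  | nil => rfl
  | cons i w ih => simp [W, ih]
lemma W_add (w : List Bool) (f g : P) : W D w (f + g) = W D w f + W D w g := by
  induction w with
  | nil => rfl
  | cons i w ih => simp [W, ih]
lemma W_smul (w : List Bool) (c : ℝ) (f : P) : W D w (c • f) = c • W D w f := by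
  induction w with
  | nil => rfl
  | cons i w ih => simp [W, ih]

def cl (u v : ℝ) : ℝ × ℝ →L[ℝ] ℝ := u • ContinuousLinearMap.fst ℝ ℝ ℝ + v • ContinuousLinearMap.snd ℝ ℝ ℝ
lemma cl_apply (u v : ℝ) (h : ℝ × ℝ) : cl u v h = u * h.1 + v * h.2 := by simp [cl]

variable {D} {F : P →ₗ[ℝ] (ℝ × ℝ → ℝ)} {S : Set (ℝ × ℝ)}

def Good (D : Bool → P →ₗ[ℝ] P) (F : P →ₗ[ℝ] (ℝ × ℝ → ℝ)) (S : Set (ℝ × ℝ)) : Prop :=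
  ∀ f, ∀ z ∈ S, HasFDerivWithinAt (F f) (cl (F (D false f) z) (F (D true f) z)) S z

lemma Good.contDiff (h : Good D F S) (hS : UniqueDiffOn ℝ S) (n : ℕ) : ∀ f, ContDiffOn ℝ n (F f) S := by
  induction n with
  | zero => intro f; exact contDiffOn_zero.2 (fun z hz => (h f z hz).continuousWithinAt)
  | succ n ih =>
    intro f
    push_cast
    rw [contDiffOn_succ_iff_hasFDerivWithinAt_of_uniqueDiffOn hS]
    refine ⟨fun h => by simp at h, _, ?_, h f⟩
    unfold cl
    exact ((ih _).smul contDiffOn_const).add ((ih _).smul contDiffOn_const)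

lemma Good.contDiff_top (h : Good D F S) (hS : UniqueDiffOn ℝ S) (f) : ContDiffOn ℝ (⊤ : ℕ∞) (F f) S :=
  contDiffOn_infty.2 (fun n => h.contDiff hS n f)

lemma Good.iter (h : Good D F S) (hS : UniqueDiffOn ℝ S) (f) (n : ℕ) : ∀ m, ∀ z ∈ S,
    iteratedFDerivWithin ℝ n (F f) S z m = F (LM D n m f) z := by
  induction n with
  | zero => intro m z hz; simp [LM]
  | succ n ih =>
    intro m z hz
    rw [iteratedFDerivWithin_succ_apply_left]
    have hd : DifferentiableWithinAt ℝ (iteratedFDerivWithin ℝ n (F f) S) S z :=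
      (h.contDiff hS (n+1) f).differentiableOn_iteratedFDerivWithin (by exact_mod_cast Nat.lt_succ_self n) hS z hz
    have h1 := hd.hasFDerivWithinAt.continuousMultilinear_apply_const (Fin.tail m)
    have h2 : HasFDerivWithinAt (fun y => iteratedFDerivWithin ℝ n (F f) S y (Fin.tail m)) _ S z :=
      (h (LM D n (Fin.tail m) f) z hz).congr (fun y hy => ih _ y hy) (ih _ z hz)
    have h3 := (hS z hz).eq h1 h2
    have h4 := DFunLike.congr_fun h3 (m 0)
    rw [cl_apply] at h4
    simp only [ContinuousLinearMap.flipMultilinear_apply_apply] at h4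
    rw [h4]
    simp [LM, L, mul_comm]

lemma Good.bound (f : P) {B : ℕ → ℝ} (hB : ∀ w, ∀ z ∈ S, |F (W D w f) z| ≤ B w.length) (n : ℕ) :
    ∀ m w, ∀ z ∈ S, |F (W D w (LM D n m f)) z| ≤ (∏ i, (2 * ‖m i‖)) * B (w.length + n) := by
  induction n with
  | zero => intro m w z hz; simpa [LM] using hB w z hz
  | succ n ih =>
    intro m w z hz
    have h1 := ih (Fin.tail m) (w ++ [false]) z hz
    have h2 := ih (Fin.tail m) (w ++ [true]) z hz
    simp only [W_append, W, List.length_append, List.length_singleton] at h1 h2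
    obtain ⟨g, hg⟩ : ∃ g, g = LM D n (Fin.tail m) f := ⟨_, rfl⟩
    rw [← hg] at h1 h2
    have e : F (W D w (LM D (n+1) m f)) z = (m 0).1 * F (W D w (D false g)) z + (m 0).2 * F (W D w (D true g)) z := by
      simp [LM, L, ← hg, W_add, W_smul]
    rw [e, Fin.prod_univ_succ]
    have a1 : |(m 0).1| ≤ ‖m 0‖ := by rw [← Real.norm_eq_abs]; exact norm_fst_le (m 0)
    have a2 : |(m 0).2| ≤ ‖m 0‖ := by rw [← Real.norm_eq_abs]; exact norm_snd_le (m 0)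
    rw [add_right_comm] at h1 h2
    obtain ⟨T, hT⟩ : ∃ T, T = (∏ i, (2 * ‖Fin.tail m i‖)) * B (w.length + n + 1) := ⟨_, rfl⟩
    rw [← hT] at h1 h2
    have T0 : 0 ≤ T := (abs_nonneg _).trans h1
    calc _ ≤ ‖m 0‖ * T + ‖m 0‖ * T := by
          refine (abs_add_le _ _).trans (add_le_add ?_ ?_) <;> rw [abs_mul]
          · exact mul_le_mul a1 h1 (abs_nonneg _) (norm_nonneg _)
          · exact mul_le_mul a2 h2 (abs_nonneg _) (norm_nonneg _)
      _ = _ := by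
        rw [hT]; simp only [Fin.tail]
        rw [show w.length + n + 1 = w.length + (n + 1) by ring]; ring

lemma Good.line (h : Good D F S) {z y : ℝ × ℝ} (hseg : ∀ t ∈ Icc (0:ℝ) 1, z + t • y ∈ S) (f : P) (n : ℕ) :
    ∀ t ∈ Icc (0:ℝ) 1, iteratedDerivWithin n (fun t : ℝ => F f (z + t • y)) (Icc 0 1) t = F (LM D n (fun _ => y) f) (z + t • y) := by
  have key : ∀ f, ∀ t ∈ Icc (0:ℝ) 1, HasDerivWithinAt (fun t : ℝ => F f (z + t • y)) (F (L D y f) (z + t • y)) (Icc 0 1) t := by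
    intro f t ht
    have h1 : HasDerivWithinAt (fun t : ℝ => z + t • y) y (Icc 0 1) t := by
      simpa using (((hasDerivAt_id t).smul_const y).const_add z).hasDerivWithinAt
    have h2 := (h f _ (hseg t ht)).comp_hasDerivWithinAt t h1 (fun t ht => hseg t ht)
    rw [cl_apply] at h2
    have e : F (L D y f) (z + t • y) = F (D false f) (z + t • y) * y.1 + F (D true f) (z + t • y) * y.2 := by
      simp [L, mul_comm]
    rw [e]; exact h2
  induction n with
  | zero => intro t ht; simp [LM]
  | succ n ih =>
    intro t ht
    rw [iteratedDerivWithin_succ]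
    rw [derivWithin_congr ih (ih t ht)]
    exact (key _ t ht).derivWithin (uniqueDiffOn_Icc one_pos t ht)

/-- Taylor -/
lemma Good.taylor (h : Good D F S) (hS : UniqueDiffOn ℝ S) (f : P) {A K : ℝ} (hA : 0 ≤ A) (hK : 0 < K)
    (hB : ∀ w, ∀ z ∈ S, |F (W D w f) z| ≤ A * K ^ w.length * w.length.factorial)
    {z : ℝ × ℝ} (hz : z ∈ S) {G : Set (ℝ × ℝ)} (hG : ∀ x ∈ G, x ∈ S ∧ ‖x - z‖ * (4 * K) < 1 ∧ ∀ t ∈ Icc (0:ℝ) 1, z + t • (x - z) ∈ S) :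
    ∃ φ : ℝ × ℝ → ℝ, (∀ x, ‖x - z‖ * (4 * K) < 1 → AnalyticAt ℝ φ x) ∧ ∀ x ∈ G, φ x = F f x := by
  have hb := Good.bound (S := S) f (B := fun n => A * K ^ n * n.factorial) hB
  let p : FormalMultilinearSeries ℝ (ℝ × ℝ) ℝ := fun n => (n.factorial : ℝ)⁻¹ • iteratedFDerivWithin ℝ n (F f) S z
  have hp : ∀ n m, p n m = (n.factorial : ℝ)⁻¹ * F (LM D n m f) z := by
    intro n m
    simp [p, h.iter hS f n m z hz]
  have hf0 : ∀ n : ℕ, (0:ℝ) < n.factorial := fun n => by exact_mod_cast n.factorial_pos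
  have hpn : ∀ n, ‖p n‖ ≤ A * (2 * K) ^ n := by
    intro n
    refine ContinuousMultilinearMap.opNorm_le_bound (by positivity) fun m => ?_
    rw [hp, norm_mul, norm_inv, Real.norm_of_nonneg (hf0 n).le, inv_mul_le_iff₀ (hf0 n)]
    have := hb n m [] z hz
    simp only [W, List.length_nil, zero_add, Finset.prod_mul_distrib, Finset.prod_const, Finset.card_univ, Fintype.card_fin] at this
    refine this.trans (le_of_eq ?_)
    rw [mul_pow]; ring
  obtain ⟨r, hr⟩ : ∃ r : NNReal, r = ⟨(2*K)⁻¹, by positivity⟩ := ⟨_, rfl⟩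
  have hrr : (r : ℝ) = (2*K)⁻¹ := by rw [hr]; rfl
  have hr0 : 0 < r := by rw [← NNReal.coe_pos, hrr]; positivity
  have hrad : (r : ENNReal) ≤ p.radius := by
    refine p.le_radius_of_bound A fun n => ?_
    rw [hrr]
    calc _ ≤ A * (2 * K) ^ n * (2*K)⁻¹ ^ n := mlr (hpn n) (by positivity)
      _ = A := by rw [inv_pow]; field_simp
      _ ≤ A := le_rfl
  have hball := (p.hasFPowerSeriesOnBall (lt_of_lt_of_le (by exact_mod_cast hr0) hrad)).mono (by exact_mod_cast hr0) hrad
  have hs1 : ∀ x : ℝ × ℝ, ‖x - z‖ * (4 * K) < 1 → ‖x - z‖ < r := by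
    intro x hx
    rw [hrr, ← one_div, lt_div_iff₀ (by positivity)]
    nlinarith [norm_nonneg (x - z)]
  have hmem : ∀ x : ℝ × ℝ, ‖x - z‖ * (4 * K) < 1 → x - z ∈ Metric.eball (0 : ℝ × ℝ) r := by
    intro x hx
    rw [Metric.eball_coe]
    simpa using hs1 x hx
  refine ⟨fun x => p.sum (x - z), fun x hx => ?_, fun x hx => ?_⟩
  · have := hball.analyticAt_of_mem (hmem x hx)
    exact this.comp (f := fun x => x - z) (by fun_prop)
  · obtain ⟨hxS, hxn, hseg⟩ := hG x hx
    have hs : HasSum (fun n => p n fun _ => x - z) (p.sum (x - z)) := by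
      simpa using hball.hasSum (hmem x hxn)
    refine tendsto_nhds_unique hs.tendsto_sum_nat ?_
    rw [tendsto_iff_norm_sub_tendsto_zero]
    obtain ⟨g, hg⟩ : ∃ g : ℝ → ℝ, g = fun t => F f (z + t • (x - z)) := ⟨_, rfl⟩
    have hline := h.line hseg f
    rw [← hg] at hline
    have hgc : ∀ n : ℕ, ContDiffOn ℝ n g (Icc 0 1) := by
      intro n
      rw [hg]
      exact (h.contDiff hS n f).comp (by fun_prop) hseg
    rw [← Filter.tendsto_add_atTop_iff_nat 1]
    have htay : ∀ n, ‖∑ i ∈ Finset.range (n+1), p i (fun _ => x - z) - F f x‖ ≤ A * (1/2) ^ (n+1) * (n+1) := by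
      intro n
      have hT := taylor_mean_remainder_bound (f := g) (n := n) (C := A * K ^ (n+1) * (n+1).factorial * (2 * ‖x - z‖) ^ (n+1)) zero_le_one
        (by exact_mod_cast hgc (n+1)) (right_mem_Icc.2 zero_le_one) (by
          intro t ht
          rw [hline (n+1) t ht, Real.norm_eq_abs]
          have := hb (n+1) (fun _ => x - z) [] _ (hseg t ht)
          simp only [W, List.length_nil, zero_add, Finset.prod_const, Finset.card_univ, Fintype.card_fin] at this
          linarith)
      have e1 : g 1 = F f x := by simp [hg]
      have e2 : taylorWithinEval g n (Icc 0 1) 0 1 = ∑ i ∈ Finset.range (n+1), p i (fun _ => x - z) := by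
        rw [taylor_within_apply]
        refine Finset.sum_congr rfl fun i _ => ?_
        rw [hp, hline i 0 (left_mem_Icc.2 zero_le_one)]
        simp
      rw [e1, e2, ← norm_neg, neg_sub] at hT
      refine hT.trans ?_
      have e3 : K ^ (n+1) * (2 * ‖x - z‖) ^ (n+1) ≤ (1/2) ^ (n+1) := by
        rw [← mul_pow]
        exact pow_le_pow_left₀ (by positivity) (by linarith) _
      rw [Nat.factorial_succ, div_le_iff₀ (hf0 n)]
      push_cast
      calc _ = A * ((n+1) * n.factorial) * (K ^ (n+1) * (2 * ‖x - z‖) ^ (n+1)) := by ring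
        _ ≤ A * ((n+1) * n.factorial) * (1/2) ^ (n+1) := mll e3 (by positivity)
        _ = _ := by ring
    refine squeeze_zero (fun _ => norm_nonneg _) htay ?_
    have := tendsto_self_mul_const_pow_of_lt_one (r := (1/2:ℝ)) (by norm_num) (by norm_num)
    have h2 := ((Filter.tendsto_add_atTop_iff_nat 1).2 this).const_mul A
    rw [mul_zero] at h2
    refine h2.congr fun n => ?_
    push_cast; ring

end Fam
end
end

section
open Set
noncomputable section

end
open Set MeasureTheory
open scoped BoundedContinuousFunction
noncomputable section
namespace Fam
variable {P : Type*} [AddCommGroup P] [Module ℝ P] (D : Bool → P →ₗ[ℝ] P)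
lemma LM_word (n : ℕ) : ∀ m : Fin n → ℝ × ℝ, (∀ i, m i = (1,0) ∨ m i = (0,1)) →
    ∃ w : List Bool, w.length = n ∧ ∀ f, LM D n m f = W D w f := by
  induction n with
  | zero => intro m _; exact ⟨[], rfl, fun f => rfl⟩
  | succ n ih =>
    intro m hm
    obtain ⟨w, hw, h⟩ := ih (Fin.tail m) (fun i => hm _)
    rcases hm 0 with h0 | h0
    · exact ⟨false :: w, by simp [hw], fun f => by simp [LM, W, h, h0, L]⟩
    · exact ⟨true :: w, by simp [hw], fun f => by simp [LM, W, h, h0, L]⟩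
end Fam
namespace PR
open MvPolynomial
variable {a b : ℝ} [hab : Fact (a < b)] {v : Gn → FF a b} {s C r M : ℝ} {ψ : ℝ × ℝ → ℝ} {S : Set (ℝ × ℝ)}

def Dl : Bool → PR →ₗ[ℝ] PR
  | false => (dq : PR →ₗ[ℝ] PR) - LinearMap.mulLeft ℝ (x (.Z 0)) ∘ₗ LinearMap.mulLeft ℝ (x .V) ∘ₗ (dp : PR →ₗ[ℝ] PR)
  | true => LinearMap.mulLeft ℝ (x .V) ∘ₗ (dp : PR →ₗ[ℝ] PR)

lemma Dl_eq (i : Bool) (f : PR) : Dl i f = Dx i f := by cases i <;> rfl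
lemma W_eq (w : List Bool) (f : PR) : Fam.W Dl w f = DW w f := by
  induction w with
  | nil => rfl
  | cons i w ih => simp only [Fam.W, DW, ih, Dl_eq]

lemma ff_add {E : Type*} [NormedCommRing E] (f g : ℝ →ᵇ E) (q : ℝ) : (f + g) q = f q + g q := rfl
lemma ff_sub {E : Type*} [NormedCommRing E] (f g : ℝ →ᵇ E) (q : ℝ) : (f - g) q = f q - g q := rfl
lemma ff_mul {E : Type*} [NormedCommRing E] (f g : ℝ →ᵇ E) (q : ℝ) : (f * g) q = f q * g q := rfl
lemma ff_smul {E : Type*} [NormedCommRing E] [NormedAlgebra ℝ E] (c : ℝ) (g : ℝ →ᵇ E) (q : ℝ) : (c • g) q = c • g q := rfl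

def Fp (v : Gn → FF a b) (ψ : ℝ × ℝ → ℝ) : PR →ₗ[ℝ] (ℝ × ℝ → ℝ) where
  toFun f z := ex ((aeval v f : FF a b) z.1) (-ψ z)
  map_add' f g := by
    funext z
    rw [map_add]; rfl
  map_smul' c g := by
    funext z
    rw [map_smul]; rfl

lemma Fp_le (f : PR) (z : ℝ × ℝ) : |Fp v ψ f z| ≤ ‖aeval v f‖ :=
  (ex_le _ _).trans ((aeval v f : FF a b).norm_coe_le_norm _)

lemma fam_deriv {u uq : FF a b} {w : AA a b} (h : HQ u uq) (z : ℝ × ℝ) (hw : DP (u z.1) w) {A B : ℝ}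
    (hr : ∀ z ∈ S, -ψ z ∈ Icc a b) (hz : z ∈ S) (hψ : HasFDerivWithinAt ψ (Fam.cl A B) S z) :
    HasFDerivWithinAt (fun z => ex (u z.1) (-ψ z)) (Fam.cl (ex (uq z.1) (-ψ z) - A * ex w (-ψ z)) (-(B * ex w (-ψ z)))) S z := by
  have h2 : HasFDerivWithinAt (fun y => ex (u z.1) (-ψ y)) (ex w (-ψ z) • (-(Fam.cl A B))) S z :=
    (DP_deriv hw (hr z hz)).comp_hasFDerivWithinAt z hψ.neg hr
  have h1 : HasFDerivWithinAt (fun y : ℝ × ℝ => ex (u y.1 - u z.1) (-ψ y)) (ex (uq z.1) (-ψ z) • ContinuousLinearMap.fst ℝ ℝ ℝ) S z := by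
    rw [hasFDerivWithinAt_iff_isLittleO]
    have l1 : (fun y : ℝ × ℝ => u y.1 - u z.1 - (y.1 - z.1) • uq z.1) =o[nhdsWithin z S] (fun y => y - z) := by
      have := (hasDerivAt_iff_isLittleO.1 (h z.1)).comp_tendsto ((continuous_fst.tendsto z).mono_left (nhdsWithin_le_nhds (s := S)))
      refine this.trans_isBigO (Asymptotics.IsBigO.of_bound 1 (Filter.Eventually.of_forall fun y => ?_))
      rw [one_mul]
      exact norm_fst_le (y - z)
    have l2 : (fun y : ℝ × ℝ => ex (u y.1 - u z.1 - (y.1 - z.1) • uq z.1) (-ψ y)) =o[nhdsWithin z S] (fun y => y - z) :=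
      (Asymptotics.IsBigO.of_bound 1 (Filter.Eventually.of_forall fun y => by rw [one_mul, Real.norm_eq_abs]; exact ex_le _ _)).trans_isLittleO l1
    have l3 : (fun y : ℝ × ℝ => (y.1 - z.1) * (ex (uq z.1) (-ψ y) - ex (uq z.1) (-ψ z))) =o[nhdsWithin z S] (fun y => y - z) := by
      have c1 : (fun y => ex (uq z.1) (-ψ y) - ex (uq z.1) (-ψ z)) =o[nhdsWithin z S] (fun _ => (1:ℝ)) := by
        rw [Asymptotics.isLittleO_one_iff, ← sub_self (ex (uq z.1) (-ψ z))]
        refine Filter.Tendsto.sub_const ?_ _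
        exact ((ex_cont (uq z.1)).tendsto _).comp hψ.continuousWithinAt.neg
      have c2 : (fun y : ℝ × ℝ => y.1 - z.1) =O[nhdsWithin z S] (fun y => y - z) :=
        Asymptotics.IsBigO.of_bound 1 (Filter.Eventually.of_forall fun y => by rw [one_mul]; exact norm_fst_le (y - z))
      have := c2.norm_right.mul_isLittleO c1
      simp only [mul_one] at this
      exact this.of_norm_right
    refine (l2.add l3).congr_left fun y => ?_
    simp only [ex_sub, ex_smul, ContinuousLinearMap.smul_apply, ContinuousLinearMap.coe_fst', smul_eq_mul, Prod.fst_sub]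
    ring
  have h3 := h1.add h2
  refine (h3.congr_fderiv ?_).congr_of_eventuallyEq (Filter.Eventually.of_forall fun y => ?_) ?_
  · ext <;> simp [Fam.cl] <;> ring
  · simp
  · simp

theorem good (J : Jet v) (hr : ∀ z ∈ S, -ψ z ∈ Icc a b)
    (hψ : ∀ z ∈ S, HasFDerivWithinAt ψ (Fam.cl (ex (v (.Z 0) z.1) (-ψ z) * ex (v .V z.1) (-ψ z)) (-ex (v .V z.1) (-ψ z))) S z) :
    Fam.Good Dl (Fp v ψ) S := by
  intro f z hz
  have := fam_deriv (jq J.hq f) z (J.p f z.1) hr hz (hψ z hz)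
  refine this.congr_fderiv ?_
  have e1 : Fp v ψ (Dl false f) z = ex ((aeval v (dq f) : FF a b) z.1) (-ψ z) - ex (v (.Z 0) z.1) (-ψ z) * (ex (v .V z.1) (-ψ z) * ex ((aeval v (dp f) : FF a b) z.1) (-ψ z)) := by
    rw [Dl_eq]
    simp only [Fp, LinearMap.coe_mk, AddHom.coe_mk, Dx]
    rw [map_sub, map_mul, map_mul, aeval_X, aeval_X]; rfl
  have e2 : Fp v ψ (Dl true f) z = ex (v .V z.1) (-ψ z) * ex ((aeval v (dp f) : FF a b) z.1) (-ψ z) := by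
    rw [Dl_eq]
    simp only [Fp, LinearMap.coe_mk, AddHom.coe_mk, Dx]
    rw [map_mul, aeval_X]; rfl
  rw [e1, e2]
  congr 1 <;> ring

theorem concl (J : Jet v) (hD : Dat v s C r M) (hS : UniqueDiffOn ℝ S) (hr : ∀ z ∈ S, -ψ z ∈ Icc a b)
    (hψ : ∀ z ∈ S, HasFDerivWithinAt ψ (Fam.cl (ex (v (.Z 0) z.1) (-ψ z) * ex (v .V z.1) (-ψ z)) (-ex (v .V z.1) (-ψ z))) S z)
    (hc : ∀ q, ∀ p ∈ Icc a b, ex (v (.c 2 0) q) p = -p)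
    (star : ∀ z ∈ S, ∀ r > 0, ∃ z' ∈ S, ‖z - z'‖ < r ∧ ∃ U ∈ nhds z, ∀ x ∈ U ∩ S, ∀ t ∈ Icc (0:ℝ) 1, z' + t • (x - z') ∈ S) :
    GevreyOn2 s S ψ ∧ (s = 1 → AnalyticOn ℝ ψ S) := by
  have G := good J hr hψ
  obtain ⟨A, K, A1, K1, hb⟩ := phys hD
  have e : ∀ z ∈ S, Fp v ψ (X (.c 2 0)) z = ψ z := by
    intro z hz
    simp only [Fp, LinearMap.coe_mk, AddHom.coe_mk]
    rw [aeval_X, hc _ _ (hr z hz), neg_neg]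
  have hB : ∀ w, ∀ z ∈ S, |Fp v ψ (Fam.W Dl w (X (.c 2 0))) z| ≤ A * K ^ w.length * (w.length.factorial:ℝ) ^ s := by
    intro w z hz
    rw [W_eq]
    exact (Fp_le _ _).trans (hb w)
  refine ⟨⟨(G.contDiff_top hS _).congr (fun z hz => (e z hz).symm), A * K, by nlinarith, ?_⟩, ?_⟩
  · intro m n z hz
    unfold mpw
    rw [iteratedFDerivWithin_congr (fun z hz => (e z hz).symm) hz, G.iter hS _ _ _ z hz]
    obtain ⟨w, hw, h⟩ := Fam.LM_word Dl (m+n) (fun i => if (i : ℕ) < m then ((1 : ℝ), (0 : ℝ)) else ((0 : ℝ), (1 : ℝ)))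
      (fun i => by split_ifs <;> simp)
    rw [h]
    refine (hB w z hz).trans ?_
    rw [hw]
    refine mlr ?_ (by positivity)
    rw [mul_pow]
    exact mul_le_mul (le_self_pow₀ A1 (by simp)) (pow_le_pow_right₀ K1 (by simp)) (by positivity) (by positivity)
  · intro s1 z hz
    subst s1
    simp only [Real.rpow_one] at hB
    have K0 : 0 < 4 * K := by linarith
    obtain ⟨z', hz', hd, U, hU, hs⟩ := star z hz (1/(4*K)) (by positivity)
    rw [lt_div_iff₀ K0] at hd
    have hV : {x : ℝ × ℝ | ‖x - z'‖ * (4 * K) < 1} ∈ nhds z :=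
      (isOpen_lt (by fun_prop) continuous_const).mem_nhds hd
    obtain ⟨φ, hφ, hφ2⟩ := G.taylor hS (X (.c 2 0)) (by linarith) (by linarith) hB hz' (G := (U ∩ {x : ℝ × ℝ | ‖x - z'‖ * (4 * K) < 1}) ∩ S)
      (fun x hx => ⟨hx.2, hx.1.2, hs x ⟨hx.1.1, hx.2⟩⟩)
    rw [analyticWithinAt_iff_exists_analyticAt]
    refine ⟨φ, ?_, hφ z hd⟩
    rw [insert_eq_of_mem hz]
    filter_upwards [mem_nhdsWithin_of_mem_nhds (Filter.inter_mem hU hV), self_mem_nhdsWithin] with x h1 h2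
    rw [hφ2 x ⟨h1, h2⟩, e x h2]
end PR
end
end

section
open Set MeasureTheory
noncomputable section
namespace Geo
variable {η : ℝ → ℝ} {d : ℝ}

def Oc (d : ℝ) (η : ℝ → ℝ) : Set (ℝ × ℝ) := {z : ℝ × ℝ | -d ≤ z.2 ∧ z.2 ≤ η z.1}

lemma lip (hη : ContDiff ℝ 2 η) (x0 : ℝ) : ∃ L κ : ℝ, 0 < κ ∧ 0 ≤ L ∧ ∀ x x', |x - x0| ≤ κ → |x' - x0| ≤ κ → |η x - η x'| ≤ L * |x - x'| := by
  obtain ⟨K, t, ht, h⟩ := (hη.contDiffAt (x := x0)).of_le (m := 1) (by norm_num) |>.exists_lipschitzOnWith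
  obtain ⟨ε, hε, hb⟩ := Metric.nhds_basis_closedBall.mem_iff.1 ht
  refine ⟨K, ε, hε, K.2, fun x x' hx hx' => ?_⟩
  have := h.dist_le_mul x (hb (by simpa [Real.dist_eq] using hx)) x' (hb (by simpa [Real.dist_eq] using hx'))
  simpa [Real.dist_eq] using this

lemma star (hη : ContDiff ℝ 2 η) (hηd : ∀ x, -d < η x) : ∀ z ∈ Oc d η, ∀ r > 0, ∃ z' ∈ Oc d η, ‖z - z'‖ < r ∧ ∃ U ∈ nhds z, ∀ x ∈ U ∩ Oc d η, ∀ t ∈ Icc (0:ℝ) 1, z' + t • (x - z') ∈ Oc d η := by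
  rintro ⟨x0, y0⟩ ⟨hz1, hz2⟩ r hr
  simp only at hz1 hz2
  obtain ⟨L, κ, hκ, hL, lip⟩ := lip hη x0
  obtain ⟨h, hh⟩ : ∃ h, h = min (r/2) (η x0 + d) := ⟨_, rfl⟩
  have h0 : 0 < h := by rw [hh]; exact lt_min (by linarith) (by linarith [hηd x0])
  have h1 : h ≤ r/2 := by rw [hh]; exact min_le_left _ _
  have h2 : h ≤ η x0 + d := by rw [hh]; exact min_le_right _ _
  obtain ⟨y', hy'⟩ : ∃ y', y' = max (-d) (y0 - h) := ⟨_, rfl⟩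
  have y1 : -d ≤ y' := by rw [hy']; exact le_max_left _ _
  have y2 : y0 - h ≤ y' := by rw [hy']; exact le_max_right _ _
  have y3 : y' ≤ η x0 - h := by rw [hy']; exact max_le (by linarith) (by linarith)
  have y4 : y' ≤ y0 := by rw [hy']; exact max_le (by linarith) (by linarith)
  refine ⟨(x0, y'), ⟨y1, by simp only; linarith⟩, ?_, ?_⟩
  · rw [Prod.norm_def]
    simp only [Prod.mk_sub_mk, sub_self, norm_zero, Real.norm_eq_abs]
    rw [abs_of_nonneg (by linarith)]
    exact max_lt hr (by linarith)
  obtain ⟨k, hk⟩ : ∃ k, k = min κ (h / (2*L+1)) := ⟨_, rfl⟩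
  have k0 : 0 < k := by rw [hk]; positivity
  have k1 : k ≤ κ := by rw [hk]; exact min_le_left _ _
  have k2 : 2 * L * k ≤ h := by
    have : k ≤ h / (2*L+1) := by rw [hk]; exact min_le_right _ _
    rw [le_div_iff₀ (by positivity)] at this
    nlinarith
  refine ⟨{x | |x.1 - x0| < k}, (isOpen_lt (by fun_prop) continuous_const).mem_nhds (by simpa using k0), ?_⟩
  rintro ⟨x, y⟩ ⟨hx, hy1, hy2⟩ t ⟨t0, t1⟩
  simp only [mem_setOf_eq] at hx hy1 hy2
  simp only [Oc, mem_setOf_eq, Prod.mk_sub_mk, Prod.smul_mk, smul_eq_mul, Prod.mk_add_mk]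
  refine ⟨by nlinarith, ?_⟩
  obtain ⟨xt, hxt⟩ : ∃ xt, xt = x0 + t * (x - x0) := ⟨_, rfl⟩
  rw [← hxt]
  have a1 : |xt - x0| ≤ t * k := by
    rw [hxt, add_sub_cancel_left, abs_mul, abs_of_nonneg t0]
    exact mll hx.le t0
  have a2 : |x - xt| ≤ (1 - t) * k := by
    rw [hxt, show x - (x0 + t * (x - x0)) = (1-t) * (x - x0) by ring, abs_mul, abs_of_nonneg (by linarith)]
    exact mll hx.le (by linarith)
  have a3 : |xt - x0| ≤ κ := by nlinarith
  have b1 := (abs_le.1 (lip x xt (hx.le.trans k1) a3)).2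
  have b2 := (abs_le.1 (lip x0 xt (by simpa using hκ.le) a3)).2
  rw [abs_sub_comm x0] at b2
  have c1 : L * |x - xt| ≤ L * ((1 - t) * k) := mll a2 hL
  have c2 : L * |xt - x0| ≤ L * (t * k) := mll a1 hL
  have d1 : t * y ≤ t * (η xt + L * ((1 - t) * k)) := mll (by linarith) t0
  have d2 : (1 - t) * y' ≤ (1 - t) * (η xt + L * (t * k) - h) := mll (by linarith) (by linarith)
  have d3 : (1 - t) * (2 * L * k * t) ≤ (1 - t) * h := mll (by nlinarith) (by linarith)
  nlinarith

lemma isOpen_Oo (hη : Continuous η) : IsOpen {z : ℝ × ℝ | -d < z.2 ∧ z.2 < η z.1} :=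
  (isOpen_lt continuous_const continuous_snd).inter (isOpen_lt continuous_snd (hη.comp continuous_fst))

lemma uniq (hη : ContDiff ℝ 2 η) (hηd : ∀ x, -d < η x) : UniqueDiffOn ℝ (Oc d η) := by
  rintro ⟨x0, y0⟩ ⟨hz1, hz2⟩
  simp only at hz1 hz2
  obtain ⟨L, κ, hκ, hL, lip⟩ := lip hη x0
  have hsub : {z : ℝ × ℝ | |z.1 - x0| ≤ κ ∧ -d ≤ z.2 ∧ z.2 + L * |z.1 - x0| ≤ η x0} ⊆ Oc d η := by
    rintro ⟨x, y⟩ ⟨h1, h2, h3⟩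
    simp only at h1 h2 h3
    refine ⟨h2, ?_⟩
    have := (abs_le.1 (lip x0 x (by simpa using hκ.le) h1)).2
    rw [abs_sub_comm x0] at this
    simp only
    linarith
  have hin : (x0, y0) ∈ {z : ℝ × ℝ | |z.1 - x0| ≤ κ ∧ -d ≤ z.2 ∧ z.2 + L * |z.1 - x0| ≤ η x0} := ⟨by simpa using hκ.le, hz1, by simpa using hz2⟩
  refine UniqueDiffWithinAt.mono (uniqueDiffWithinAt_convex ?_ ?_ (subset_closure hin)) hsub
  · rintro ⟨x, y⟩ ⟨h1, h2, h3⟩ ⟨x', y'⟩ ⟨h1', h2', h3'⟩ s t hs ht hst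
    simp only at h1 h2 h3 h1' h2' h3'
    simp only [mem_setOf_eq, Prod.smul_mk, smul_eq_mul, Prod.mk_add_mk]
    have e : |s * x + t * x' - x0| ≤ s * |x - x0| + t * |x' - x0| := by
      rw [show s * x + t * x' - x0 = s * (x - x0) + t * (x' - x0) by linear_combination x0 * hst]
      refine (abs_add_le _ _).trans (le_of_eq ?_)
      rw [abs_mul, abs_mul, abs_of_nonneg hs, abs_of_nonneg ht]
    refine ⟨?_, ?_, ?_⟩
    · nlinarith
    · nlinarith [mll h2 hs, mll h2' ht, congrArg (· * d) hst]
    · have := mll e hL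
      have e1 := mll h3 hs
      have e2 := mll h3' ht
      have e3 : s * η x0 + t * η x0 = η x0 := by rw [← add_mul, hst, one_mul]
      nlinarith
  · refine ⟨(x0, (η x0 - d)/2), mem_interior.2 ⟨{z : ℝ × ℝ | |z.1 - x0| < κ ∧ -d < z.2 ∧ z.2 + L * |z.1 - x0| < η x0}, ?_, ?_, ?_⟩⟩
    · rintro z ⟨h1, h2, h3⟩; exact ⟨h1.le, h2.le, h3.le⟩
    · have o1 : IsOpen {z : ℝ × ℝ | |z.1 - x0| < κ} := isOpen_lt (by fun_prop) continuous_const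
      have o2 : IsOpen {z : ℝ × ℝ | z.2 + L * |z.1 - x0| < η x0} := isOpen_lt (by fun_prop) continuous_const
      exact o1.inter ((isOpen_lt continuous_const continuous_snd).inter o2)
    · have := hηd x0
      refine ⟨by simpa using hκ, ?_, ?_⟩ <;> simp <;> linarith

lemma clos (hη : Continuous η) (hηd : ∀ x, -d < η x) : Oc d η ⊆ closure {z : ℝ × ℝ | -d < z.2 ∧ z.2 < η z.1} := by
  rintro ⟨x, y⟩ ⟨h1, h2⟩
  simp only at h1 h2
  have hy : y ∈ closure (Ioo (-d) (η x)) := by rw [closure_Ioo (hηd x).ne]; exact ⟨h1, h2⟩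
  exact map_mem_closure (f := fun y => (x, y)) (by fun_prop) hy (fun y hy => hy)

lemma clos_int (hη : Continuous η) (hηd : ∀ x, -d < η x) : Oc d η ⊆ closure (interior (Oc d η)) :=
  (clos hη hηd).trans (closure_mono (interior_maximal (fun z hz => ⟨hz.1.le, hz.2.le⟩) (isOpen_Oo hη)))

variable {S : Set (ℝ × ℝ)} {ψ : ℝ × ℝ → ℝ}
lemma m10 (hS : UniqueDiffOn ℝ S) {z} (hz : z ∈ S) : mpw S 1 0 ψ z = fderivWithin ℝ ψ S z (1,0) := by
  unfold mpw; rw [iteratedFDerivWithin_one_apply (hS z hz)]; simp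
lemma m01 (hS : UniqueDiffOn ℝ S) {z} (hz : z ∈ S) : mpw S 0 1 ψ z = fderivWithin ℝ ψ S z (0,1) := by
  unfold mpw; change iteratedFDerivWithin ℝ 1 _ _ _ _ = _; rw [iteratedFDerivWithin_one_apply (hS z hz)]; simp
lemma m20 (hS : UniqueDiffOn ℝ S) {z} (hz : z ∈ S) : mpw S 2 0 ψ z = fderivWithin ℝ (fderivWithin ℝ ψ S) S z (1,0) (1,0) := by
  unfold mpw; rw [iteratedFDerivWithin_two_apply _ hS hz]; simp
lemma m11 (hS : UniqueDiffOn ℝ S) {z} (hz : z ∈ S) : mpw S 1 1 ψ z = fderivWithin ℝ (fderivWithin ℝ ψ S) S z (1,0) (0,1) := by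
  unfold mpw; change iteratedFDerivWithin ℝ 2 _ _ _ _ = _; rw [iteratedFDerivWithin_two_apply _ hS hz]; simp
lemma m02 (hS : UniqueDiffOn ℝ S) {z} (hz : z ∈ S) : mpw S 0 2 ψ z = fderivWithin ℝ (fderivWithin ℝ ψ S) S z (0,1) (0,1) := by
  unfold mpw; change iteratedFDerivWithin ℝ 2 _ _ _ _ = _; rw [iteratedFDerivWithin_two_apply _ hS hz]; simp

lemma clm_eq (T : ℝ × ℝ →L[ℝ] ℝ) : T = Fam.cl (T (1,0)) (T (0,1)) := by
  ext <;> simp [Fam.cl]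

lemma d1 (hψ : ContDiffOn ℝ 2 ψ S) (hS : UniqueDiffOn ℝ S) {z} (hz : z ∈ S) :
    HasFDerivWithinAt ψ (Fam.cl (mpw S 1 0 ψ z) (mpw S 0 1 ψ z)) S z := by
  rw [m10 hS hz, m01 hS hz, ← clm_eq]
  exact ((hψ.differentiableOn (by norm_num)) z hz).hasFDerivWithinAt

lemma d2 (hψ : ContDiffOn ℝ 2 ψ S) (hS : UniqueDiffOn ℝ S) (hi : S ⊆ closure (interior S)) {z} (hz : z ∈ S) :
    HasFDerivWithinAt (mpw S 1 0 ψ) (Fam.cl (mpw S 2 0 ψ z) (mpw S 1 1 ψ z)) S z ∧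
    HasFDerivWithinAt (mpw S 0 1 ψ) (Fam.cl (mpw S 1 1 ψ z) (mpw S 0 2 ψ z)) S z := by
  have hd : HasFDerivWithinAt (fderivWithin ℝ ψ S) _ S z :=
    ((hψ.fderivWithin hS (m := 1) (by norm_num)).differentiableOn (by norm_num) z hz).hasFDerivWithinAt
  have sym := (hψ z hz).isSymmSndFDerivWithinAt (by simp) hS (hi hz) hz
  have e := sym (1,0) (0,1)
  have h : ∀ m : ℝ × ℝ, HasFDerivWithinAt (fun y => fderivWithin ℝ ψ S y m) ((ContinuousLinearMap.apply ℝ ℝ m).comp (fderivWithin ℝ (fderivWithin ℝ ψ S) S z)) S z :=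
    fun m => ((ContinuousLinearMap.apply ℝ ℝ m).hasFDerivAt).comp_hasFDerivWithinAt z hd
  constructor
  · have := (h (1,0)).congr (f₁ := mpw S 1 0 ψ) (fun y hy => m10 hS hy) (m10 hS hz)
    rw [clm_eq ((ContinuousLinearMap.apply ℝ ℝ ((1:ℝ),(0:ℝ))).comp _)] at this
    rw [m20 hS hz, m11 hS hz, e]
    exact this
  · have := (h (0,1)).congr (f₁ := mpw S 0 1 ψ) (fun y hy => m01 hS hy) (m01 hS hz)
    rw [clm_eq ((ContinuousLinearMap.apply ℝ ℝ ((0:ℝ),(1:ℝ))).comp _)] at this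
    rw [m02 hS hz, m11 hS hz]
    exact this

lemma c2 (hψ : ContDiffOn ℝ 2 ψ S) (hS : UniqueDiffOn ℝ S) (a b : ℕ) (h : a + b = 2) : ContinuousOn (mpw S a b ψ) S := by
  unfold mpw
  have := hψ.continuousOn_iteratedFDerivWithin (m := a+b) (by rw [h]; rfl) hS
  intro z hz
  exact (ContinuousMultilinearMap.apply ℝ (fun _ : Fin (a+b) => ℝ × ℝ) ℝ _).continuous.continuousAt.comp_continuousWithinAt (this z hz)
end Geo
end
end

section
open Set MeasureTheory
noncomputable section
namespace Geo
variable {η : ℝ → ℝ} {d μ p₀ δ : ℝ} {ψ px py pxx pxy pyy u ux uy : ℝ × ℝ → ℝ}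

/-- `u` has the stated partial derivatives on the closed fluid domain -/
def PD (d : ℝ) (η : ℝ → ℝ) (u ux uy : ℝ × ℝ → ℝ) : Prop :=
  ∀ z ∈ Oc d η, HasFDerivWithinAt u (Fam.cl (ux z) (uy z)) (Oc d η) z

lemma PD.vert (h : PD d η u ux uy) (x : ℝ) {y : ℝ} (hy : y ∈ Icc (-d) (η x)) :
    HasDerivWithinAt (fun t => u (x, t)) (uy (x, y)) (Icc (-d) (η x)) y := by
  have h1 : HasDerivWithinAt (fun t : ℝ => (x, t)) ((0:ℝ), (1:ℝ)) (Icc (-d) (η x)) y :=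
    (hasDerivWithinAt_const _ _ _).prodMk (hasDerivWithinAt_id _ _)
  have := (h (x, y) hy).comp_hasDerivWithinAt y h1 (fun t ht => ht)
  rw [Fam.cl_apply] at this
  simp only [mul_zero, mul_one, zero_add] at this
  exact this

lemma PD.bot (h : PD d η u ux uy) (hηd : ∀ x, -d < η x) (x : ℝ) :
    HasDerivAt (fun t => u (t, -d)) (ux (x, -d)) x := by
  have h1 : HasDerivAt (fun t : ℝ => (t, -d)) ((1:ℝ), (0:ℝ)) x :=
    (hasDerivAt_id _).prodMk (hasDerivAt_const _ _)
  have hin : ∀ t, (t, -d) ∈ Oc d η := fun t => ⟨le_rfl, (hηd t).le⟩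
  have := (h (x, -d) (hin x)).comp_hasDerivAt x h1 (Filter.Eventually.of_forall hin)
  rw [Fam.cl_apply] at this
  simp only [mul_zero, mul_one, add_zero] at this
  exact this

lemma PD.vert_le (h : PD d η u ux uy) {B : ℝ} (hB : ∀ z ∈ Oc d η, |uy z| ≤ B) (x : ℝ) {y y' : ℝ} (hy : y ∈ Icc (-d) (η x))
    (hy' : y' ∈ Icc (-d) (η x)) : |u (x, y') - u (x, y)| ≤ B * |y' - y| := by
  have := (convex_Icc (-d) (η x)).norm_image_sub_le_of_norm_hasDerivWithin_le (f := fun t => u (x, t)) (f' := fun t => uy (x, t)) (C := B)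
    (fun t ht => h.vert x ht) (fun t ht => hB (x, t) ht) hy hy'
  simpa using this

lemma PD.anti (h : PD d η u ux uy) (hst : ∀ z ∈ Oc d η, uy z ≤ -δ) (x : ℝ) {y y' : ℝ} (hy : y ∈ Icc (-d) (η x))
    (hy' : y' ∈ Icc (-d) (η x)) (hyy : y ≤ y') : u (x, y') - u (x, y) ≤ -δ * (y' - y) := by
  have hd : ∀ t ∈ interior (Icc (-d) (η x)), HasDerivAt (fun t => u (x, t)) (uy (x, t)) t := by
    intro t ht
    rw [interior_Icc] at ht
    exact (h.vert x (Ioo_subset_Icc_self ht)).hasDerivAt (Icc_mem_nhds ht.1 ht.2)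
  exact (convex_Icc (-d) (η x)).image_sub_le_mul_sub_of_deriv_le (f := fun t => u (x, t)) (C := -δ)
    (fun t ht => (h.vert x ht).continuousWithinAt) (fun t ht => (hd t ht).differentiableAt.differentiableWithinAt)
    (fun t ht => by rw [(hd t ht).deriv]; exact hst (x, t) (by rw [interior_Icc] at ht; exact Ioo_subset_Icc_self ht)) y hy y' hy' hyy

lemma depth (hηd : ∀ x, -d < η x) (hδ : 0 < δ) (h : PD d η ψ px py) (hst : ∀ z ∈ Oc d η, py z ≤ -δ)
    (htop : ∀ x, ψ (x, η x) = 0) (hbot : ∀ x, ψ (x, -d) = -p₀) (x : ℝ) : η x + d ≤ -p₀ / δ := by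
  have := h.anti hst x (left_mem_Icc.2 (hηd x).le) (right_mem_Icc.2 (hηd x).le) (hηd x).le
  rw [htop, hbot] at this
  rw [le_div_iff₀ hδ]; linarith

/-- interpolation -/
lemma interp {f f' : ℝ → ℝ} (hf : ∀ x, HasDerivAt f (f' x) x) {B K : ℝ} (hB : ∀ x, |f x| ≤ B) (hK : 0 ≤ K) (hμ : 0 ≤ μ)
    (hH : ∀ x x', |f' x - f' x'| ≤ K * |x - x'| ^ μ) (x : ℝ) : |f' x| ≤ 2 * B + K := by
  obtain ⟨c, hc, h⟩ := exists_hasDerivAt_eq_slope f f' (by linarith : x < x + 1) (fun t _ => (hf t).continuousAt.continuousWithinAt) (fun t _ => hf t)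
  have h1 := hH x c
  have h2 : |x - c| ≤ 1 := by rw [abs_le]; constructor <;> linarith [hc.1, hc.2]
  have h3 : |x - c| ^ μ ≤ 1 := Real.rpow_le_one (abs_nonneg _) h2 hμ
  have h4 : |f' c| ≤ 2 * B := by
    rw [h]; simp only [add_sub_cancel_left, div_one]
    have := abs_sub (f (x+1)) (f x)
    linarith [hB (x+1), hB x]
  have h5 : |f' x| ≤ |f' x - f' c| + |f' c| := by simpa using abs_add_le (f' x - f' c) (f' c)
  nlinarith

lemma interp2 {f f' f'' : ℝ → ℝ} (hf : ∀ x, HasDerivAt f (f' x) x) (hf' : ∀ x, HasDerivAt f' (f'' x) x) {B K : ℝ} (hB : ∀ x, |f x| ≤ B) (hK : 0 ≤ K) (hμ : 0 ≤ μ)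
    (hH : ∀ x x', |f'' x - f'' x'| ≤ K * |x - x'| ^ μ) : ∃ C, ∀ x, |f' x| ≤ C ∧ |f'' x| ≤ C := by
  have B0 : 0 ≤ B := (abs_nonneg _).trans (hB 0)
  have sl : ∀ x, ∃ c ∈ Ioo x (x+1), |f' c| ≤ 2 * B := by
    intro x
    obtain ⟨c, hc, h⟩ := exists_hasDerivAt_eq_slope f f' (by linarith : x < x + 1) (fun t _ => (hf t).continuousAt.continuousWithinAt) (fun t _ => hf t)
    refine ⟨c, hc, ?_⟩
    rw [h]; simp only [add_sub_cancel_left, div_one]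
    have := abs_sub (f (x+1)) (f x)
    linarith [hB (x+1), hB x]
  have b2 : ∀ x, |f'' x| ≤ 4 * B + K * 3 ^ μ := by
    intro x
    obtain ⟨c1, hc1, h1⟩ := sl (x+1)
    obtain ⟨c2, hc2, h2⟩ := sl (x-1)
    obtain ⟨c, hc, h⟩ := exists_hasDerivAt_eq_slope f' f'' (by linarith [hc1.1, hc2.2] : c2 < c1) (fun t _ => (hf' t).continuousAt.continuousWithinAt) (fun t _ => hf' t)
    have h3 : |f'' c| ≤ 4 * B := by
      have hp : 1 ≤ c1 - c2 := by linarith [hc1.1, hc2.2]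
      rw [h, abs_div, abs_of_pos (by linarith : 0 < c1 - c2), div_le_iff₀ (by linarith)]
      have := abs_sub (f' c1) (f' c2)
      nlinarith
    have h4 : |x - c| ≤ 3 := by rw [abs_le]; constructor <;> linarith [hc.1, hc.2, hc1.1, hc1.2, hc2.1, hc2.2]
    have h5 : |x - c| ^ μ ≤ 3 ^ μ := Real.rpow_le_rpow (abs_nonneg _) h4 hμ
    have h6 : |f'' x| ≤ |f'' x - f'' c| + |f'' c| := by simpa using abs_add_le (f'' x - f'' c) (f'' c)
    have h7 := hH x c
    have h8 := mll h5 hK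
    linarith
  obtain ⟨N, hN⟩ : ∃ N, N = 4 * B + K * 3 ^ μ := ⟨_, rfl⟩
  have N0 : 0 ≤ N := by rw [hN]; positivity
  rw [← hN] at b2
  refine ⟨2 * B + N, fun x => ⟨?_, by linarith [b2 x]⟩⟩
  obtain ⟨c, hc, h⟩ := sl x
  have := (convex_univ).norm_image_sub_le_of_norm_hasDerivWithin_le (f := f') (f' := f'') (C := N) (s := univ)
    (fun t _ => (hf' t).hasDerivWithinAt) (fun t _ => b2 t) (mem_univ c) (mem_univ x)
  simp only [Real.norm_eq_abs] at this
  have h1 : |x - c| ≤ 1 := by rw [abs_le]; constructor <;> linarith [hc.1, hc.2]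
  have h6 : |f' x| ≤ |f' x - f' c| + |f' c| := by simpa using abs_add_le (f' x - f' c) (f' c)
  nlinarith

lemma ed_v (x y y' : ℝ) : edist2 (x, y) (x, y') = |y - y'| := by
  simp [edist2, Real.sqrt_sq_eq_abs]
lemma ed_h (x x' y : ℝ) : edist2 (x, y) (x', y) = |x - x'| := by
  simp [edist2, Real.sqrt_sq_eq_abs]

/-- Hoelder -/
def Hol (d : ℝ) (η : ℝ → ℝ) (μ : ℝ) (f : ℝ × ℝ → ℝ) : Prop :=
  ∃ K, ∀ z ∈ Oc d η, ∀ z' ∈ Oc d η, |f z - f z'| ≤ K * (edist2 z z') ^ μ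

lemma Hol.abs {f : ℝ × ℝ → ℝ} (h : Hol d η μ f) : ∃ K, 0 ≤ K ∧ ∀ z ∈ Oc d η, ∀ z' ∈ Oc d η, |f z - f z'| ≤ K * (edist2 z z') ^ μ := by
  obtain ⟨K, h⟩ := h
  refine ⟨|K|, abs_nonneg _, fun z hz z' hz' => (h z hz z' hz').trans (mlr (le_abs_self _) ?_)⟩
  exact Real.rpow_nonneg (Real.sqrt_nonneg _) _

lemma Hol.bdd {f : ℝ × ℝ → ℝ} (h : Hol d η μ f) (hμ : 0 ≤ μ) (hηd : ∀ x, -d < η x) {T B : ℝ} (hT : ∀ x, η x + d ≤ T)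
    (hb : ∀ x, |f (x, -d)| ≤ B) : ∃ C, ∀ z ∈ Oc d η, |f z| ≤ C := by
  obtain ⟨K, hK, h⟩ := h.abs
  refine ⟨B + K * T ^ μ, ?_⟩
  rintro ⟨x, y⟩ ⟨h1, h2⟩
  simp only at h1 h2
  have := h (x, y) ⟨h1, h2⟩ (x, -d) ⟨le_rfl, (hηd x).le⟩
  rw [ed_v] at this
  have e : |y - -d| ^ μ ≤ T ^ μ := by
    refine Real.rpow_le_rpow (abs_nonneg _) ?_ hμ
    rw [abs_of_nonneg (by linarith)]; linarith [hT x]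
  have e2 := mll e hK
  have h6 : |f (x,y)| ≤ |f (x,y) - f (x,-d)| + |f (x,-d)| := by simpa using abs_add_le (f (x,y) - f (x,-d)) (f (x,-d))
  linarith [hb x]

theorem bounds (hμ : 0 ≤ μ) (hηd : ∀ x, -d < η x) {T N : ℝ} (hT : ∀ x, η x + d ≤ T)
    (h1 : PD d η ψ px py) (h2 : PD d η px pxx pxy) (h3 : PD d η py pxy pyy)
    (hxy : Hol d η μ pxy) (hyy : Hol d η μ pyy) (hN : ∀ z ∈ Oc d η, |pxx z + pyy z| ≤ N)
    (hbern : ∀ x, |py (x, η x)| ≤ N) (hbot : ∀ x, ψ (x, -d) = -p₀) :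
    (∀ x, px (x, -d) = 0) ∧ ∃ B, ∀ z ∈ Oc d η, |px z| ≤ B ∧ |py z| ≤ B ∧ |pxx z| ≤ B ∧ |pxy z| ≤ B ∧ |pyy z| ≤ B := by
  have inb : ∀ x, (x, -d) ∈ Oc d η := fun x => ⟨le_rfl, (hηd x).le⟩
  have bx : ∀ x, px (x, -d) = 0 := fun x => by
    refine (h1.bot hηd x).unique ?_
    simp only [hbot]; exact hasDerivAt_const _ _
  have bxx : ∀ x, pxx (x, -d) = 0 := fun x => by
    refine (h2.bot hηd x).unique ?_
    simp only [bx]; exact hasDerivAt_const _ _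
  have T0 : 0 ≤ T := by linarith [hηd 0, hT 0]
  obtain ⟨C1, hC1⟩ := hyy.bdd hμ hηd hT (B := N) (fun x => by simpa [bxx] using hN _ (inb x))
  have hC2 : ∀ z ∈ Oc d η, |pxx z| ≤ N + C1 := fun z hz => by
    have := abs_sub (pxx z + pyy z) (pyy z)
    rw [add_sub_cancel_right] at this
    linarith [hN z hz, hC1 z hz]
  have C0 : 0 ≤ C1 := (abs_nonneg _).trans (hC1 _ (inb 0))
  have hC3 : ∀ z ∈ Oc d η, |py z| ≤ N + C1 * T := by
    rintro ⟨x, y⟩ hz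
    have := h3.vert_le hC1 x (right_mem_Icc.2 (hηd x).le) hz
    have h6 : |py (x,y)| ≤ |py (x,y) - py (x,η x)| + |py (x,η x)| := by simpa using abs_add_le (py (x,y) - py (x,η x)) (py (x,η x))
    have h7 : |y - η x| ≤ T := by rw [abs_le]; constructor <;> linarith [hz.1, hz.2, hT x]
    have h8 := mll h7 C0
    linarith [hbern x]
  obtain ⟨K, hK, hxyK⟩ := hxy.abs
  obtain ⟨C4, hC4⟩ := hxy.bdd hμ hηd hT (B := 2 * (N + C1 * T) + K) (interp (h3.bot hηd) (fun x => hC3 _ (inb x)) hK hμ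
    (fun x x' => by simpa [ed_h] using hxyK _ (inb x) _ (inb x')))
  have hC5 : ∀ z ∈ Oc d η, |px z| ≤ C4 * T := by
    rintro ⟨x, y⟩ hz
    have := h2.vert_le hC4 x (left_mem_Icc.2 (hηd x).le) hz
    rw [bx, sub_zero] at this
    have h7 : |y - -d| ≤ T := by rw [abs_le]; constructor <;> linarith [hz.1, hz.2, hT x]
    exact this.trans (mll h7 ((abs_nonneg _).trans (hC4 _ (inb 0))))
  refine ⟨bx, |N| + |C1| + |C1 * T| + |C4| + |C4 * T|, fun z hz => ?_⟩
  have := hC1 z hz; have := hC2 z hz; have := hC3 z hz; have := hC4 z hz; have := hC5 z hz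
  have := le_abs_self N; have := le_abs_self C1; have := le_abs_self (C1 * T); have := le_abs_self C4; have := le_abs_self (C4 * T)
  have := abs_nonneg N; have := abs_nonneg C1; have := abs_nonneg (C1 * T); have := abs_nonneg C4; have := abs_nonneg (C4 * T)
  refine ⟨?_, ?_, ?_, ?_, ?_⟩ <;> linarith
end Geo
end
end

section
open Set MeasureTheory Filter Topology
noncomputable section
namespace Geo
variable {η : ℝ → ℝ} {d μ p₀ δ : ℝ} {ψ px py pxx pxy pyy u ux uy : ℝ × ℝ → ℝ} {Yf : ℝ × ℝ → ℝ}

/-- the strip -/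
def TT (p₀ : ℝ) : Set (ℝ × ℝ) := {w | w.2 ∈ Icc p₀ 0}

/-- height function of the hodograph transform -/
structure Hod (d : ℝ) (η : ℝ → ℝ) (p₀ : ℝ) (ψ : ℝ × ℝ → ℝ) (Yf : ℝ × ℝ → ℝ) : Prop where
  mem : ∀ w ∈ TT p₀, (w.1, Yf w) ∈ Oc d η
  val : ∀ w ∈ TT p₀, ψ (w.1, Yf w) = -w.2
  rg : ∀ z ∈ Oc d η, (z.1, -ψ z) ∈ TT p₀
  inv : ∀ z ∈ Oc d η, Yf (z.1, -ψ z) = z.2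

lemma PD.lower (hδ : 0 < δ) (h : PD d η u ux uy) (hst : ∀ z ∈ Oc d η, uy z ≤ -δ) (x : ℝ) {y y' : ℝ} (hy : y ∈ Icc (-d) (η x))
    (hy' : y' ∈ Icc (-d) (η x)) : δ * |y' - y| ≤ |u (x, y') - u (x, y)| := by
  rcases le_total y y' with hl | hl
  · have := h.anti hst x hy hy' hl
    rw [abs_of_nonneg (by linarith : 0 ≤ y' - y)]
    linarith [neg_abs_le (u (x, y') - u (x, y))]
  · have := h.anti hst x hy' hy hl
    rw [abs_of_nonpos (by linarith : y' - y ≤ 0)]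
    linarith [le_abs_self (u (x, y') - u (x, y))]

lemma hod (hηd : ∀ x, -d < η x) (hδ : 0 < δ) (h : PD d η ψ px py) (hst : ∀ z ∈ Oc d η, py z ≤ -δ)
    (htop : ∀ x, ψ (x, η x) = 0) (hbot : ∀ x, ψ (x, -d) = -p₀) : ∃ Yf, Hod d η p₀ ψ Yf := by
  have ivt : ∀ w : ℝ × ℝ, ∃ y, w ∈ TT p₀ → y ∈ Icc (-d) (η w.1) ∧ ψ (w.1, y) = -w.2 := by
    intro w
    by_cases hw : w ∈ TT p₀
    · have hc : ContinuousOn (fun t => ψ (w.1, t)) (Icc (-d) (η w.1)) := fun t ht => (h.vert w.1 ht).continuousWithinAt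
      have := intermediate_value_Icc' (hηd w.1).le hc
      have hin : -w.2 ∈ Icc (ψ (w.1, η w.1)) (ψ (w.1, -d)) := by
        rw [htop, hbot]; exact ⟨by linarith [hw.2], by linarith [hw.1]⟩
      obtain ⟨y, hy, e⟩ := this hin
      exact ⟨y, fun _ => ⟨hy, e⟩⟩
    · exact ⟨0, fun h => absurd h hw⟩
  choose Yf hY using ivt
  have rg : ∀ z ∈ Oc d η, (z.1, -ψ z) ∈ TT p₀ := by
    intro z hz
    have hz' : z.2 ∈ Icc (-d) (η z.1) := hz
    have h1 := h.anti hst z.1 (left_mem_Icc.2 (hηd z.1).le) hz' hz.1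
    have h2 := h.anti hst z.1 hz' (right_mem_Icc.2 (hηd z.1).le) hz.2
    rw [hbot] at h1; rw [htop] at h2
    have h3 : 0 ≤ δ * (z.2 - -d) := mul_nonneg hδ.le (by linarith [hz.1])
    have h4 : 0 ≤ δ * (η z.1 - z.2) := mul_nonneg hδ.le (by linarith [hz.2])
    change ψ (z.1, z.2) - _ ≤ _ at h1
    change _ - ψ (z.1, z.2) ≤ _ at h2
    have hin : -ψ z ∈ Icc p₀ 0 := ⟨by change p₀ ≤ -ψ (z.1, z.2); linarith, by change -ψ (z.1, z.2) ≤ 0; linarith⟩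
    exact hin
  refine ⟨Yf, fun w hw => (hY w hw).1, fun w hw => (hY w hw).2, rg, fun z hz => ?_⟩
  have h1 := hY _ (rg z hz)
  have h2 := h.lower hδ hst z.1 (y := z.2) hz h1.1
  have h3 : ψ (z.1, Yf (z.1, -ψ z)) = ψ (z.1, z.2) := by rw [h1.2]; simp
  rw [h3, sub_self, abs_zero] at h2
  have : |Yf (z.1, -ψ z) - z.2| ≤ 0 := by
    by_contra hc
    have := mul_pos hδ (not_le.1 hc)
    linarith
  exact sub_eq_zero.1 (abs_nonpos_iff.1 this)

lemma Hod.cont (hηc : Continuous η) (hηd : ∀ x, -d < η x) (hδ : 0 < δ) (h : PD d η ψ px py) (hst : ∀ z ∈ Oc d η, py z ≤ -δ)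
    (H : Hod d η p₀ ψ Yf) : ContinuousOn Yf (TT p₀) := by
  intro w0 hw0
  have hm0 := H.mem w0 hw0
  obtain ⟨c, hc⟩ : ∃ c : ℝ → ℝ, c = fun q => max (-d) (min (Yf w0) (η q)) := ⟨_, rfl⟩
  have hcc : Continuous c := by rw [hc]; fun_prop
  have hc0 : c w0.1 = Yf w0 := by rw [hc]; simp only; rw [min_eq_left hm0.2, max_eq_right hm0.1]
  have hcm : ∀ q, (q, c q) ∈ Oc d η := by
    intro q; rw [hc]
    exact ⟨le_max_left _ _, max_le (hηd q).le (min_le_right _ _)⟩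
  have hψc : ContinuousOn ψ (Oc d η) := fun z hz => (h z hz).continuousWithinAt
  have hpc : Continuous (fun q => (q, c q)) := by fun_prop
  have hk : Continuous (fun q => ψ (q, c q)) := hψc.comp_continuous hpc hcm
  obtain ⟨E, hE⟩ : ∃ E : ℝ × ℝ → ℝ, E = fun w => |-w.2 - ψ (w.1, c w.1)| / δ + |c w.1 - Yf w0| := ⟨_, rfl⟩
  have hEc : Continuous E := by
    rw [hE]
    have := hk.comp (continuous_fst (X := ℝ) (Y := ℝ))
    have h2 := hcc.comp (continuous_fst (X := ℝ) (Y := ℝ))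
    exact ((continuous_snd.neg.sub this).abs.div_const _).add (h2.sub continuous_const).abs
  have hE0 : E w0 = 0 := by
    rw [hE]; simp only; rw [hc0, H.val w0 hw0]; simp
  rw [ContinuousWithinAt, tendsto_iff_dist_tendsto_zero]
  have ht : Tendsto E (𝓝[TT p₀] w0) (𝓝 0) := by
    have := hEc.continuousAt (x := w0)
    rw [ContinuousAt, hE0] at this
    exact this.mono_left nhdsWithin_le_nhds
  refine squeeze_zero' (Eventually.of_forall fun _ => dist_nonneg) ?_ ht
  filter_upwards [self_mem_nhdsWithin] with w hw
  have h1 := h.lower hδ hst w.1 (hcm w.1) (H.mem w hw)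
  rw [H.val w hw] at h1
  rw [hE, Real.dist_eq]
  have h2 : |Yf w - c w.1| ≤ |-w.2 - ψ (w.1, c w.1)| / δ := by
    rw [le_div_iff₀ hδ]; linarith
  calc |Yf w - Yf w0| = |(Yf w - c w.1) + (c w.1 - Yf w0)| := by ring_nf
    _ ≤ _ := (abs_add_le _ _).trans (by simpa using h2)

lemma Hod.contΨ (hY : ContinuousOn Yf (TT p₀)) (H : Hod d η p₀ ψ Yf) {f : ℝ × ℝ → ℝ} (hf : ContinuousOn f (Oc d η)) :
    ContinuousOn (fun w => f (w.1, Yf w)) (TT p₀) :=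
  hf.comp (continuous_fst.continuousOn.prodMk hY) H.mem

/-- derivative of the hodograph map as an equivalence -/
def eqv (a b : ℝ) (hb : b ≠ 0) : (ℝ × ℝ) ≃L[ℝ] (ℝ × ℝ) :=
  ContinuousLinearEquiv.equivOfInverse
    ((ContinuousLinearMap.fst ℝ ℝ ℝ).prod (Fam.cl (-a) (-b)))
    ((ContinuousLinearMap.fst ℝ ℝ ℝ).prod (Fam.cl (-a / b) (-1 / b)))
    (fun z => by
      ext
      · simp
      · simp [Fam.cl_apply]; field_simp; ring)
    (fun z => by
      ext
      · simp
      · simp [Fam.cl_apply]; field_simp; ring)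

lemma Hod.dΨ (hY : ContinuousOn Yf (TT p₀)) (H : Hod d η p₀ ψ Yf) (hδ : 0 < δ) (h : PD d η ψ px py) (hst : ∀ z ∈ Oc d η, py z ≤ -δ)
    {w : ℝ × ℝ} (hw : w ∈ TT p₀) :
    HasFDerivWithinAt (fun w => (w.1, Yf w)) ((ContinuousLinearMap.fst ℝ ℝ ℝ).prod
      (Fam.cl (-px (w.1, Yf w) / py (w.1, Yf w)) (-1 / py (w.1, Yf w)))) (TT p₀) w := by
  have hm := H.mem w hw
  have hne : py (w.1, Yf w) ≠ 0 := by have := hst _ hm; linarith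
  have hf : HasFDerivWithinAt (fun z : ℝ × ℝ => (z.1, -ψ z)) ((eqv (px (w.1, Yf w)) (py (w.1, Yf w)) hne : (ℝ × ℝ) ≃L[ℝ] (ℝ × ℝ)) : (ℝ × ℝ) →L[ℝ] (ℝ × ℝ)) (Oc d η) (w.1, Yf w) := by
    have := (hasFDerivWithinAt_fst (𝕜 := ℝ) (E := ℝ) (F := ℝ) (s := Oc d η) (p := (w.1, Yf w))).prodMk (h _ hm).neg
    refine this.congr_fderiv ?_
    ext z <;> simp [eqv, Fam.cl_apply]
  have hT : Tendsto (fun w : ℝ × ℝ => (w.1, Yf w)) (𝓝[TT p₀] w) (𝓝[Oc d η] (w.1, Yf w)) := by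
    refine tendsto_nhdsWithin_iff.2 ⟨?_, ?_⟩
    · exact (continuous_fst.continuousOn.prodMk hY) w hw
    · filter_upwards [self_mem_nhdsWithin] with x hx using H.mem x hx
  have := hf.of_local_left_inverse (g := fun w : ℝ × ℝ => (w.1, Yf w)) hT hw (by
    filter_upwards [self_mem_nhdsWithin] with x hx
    simp [H.val x hx])
  exact this

lemma Hod.dY (hY : ContinuousOn Yf (TT p₀)) (H : Hod d η p₀ ψ Yf) (hδ : 0 < δ) (h : PD d η ψ px py) (hst : ∀ z ∈ Oc d η, py z ≤ -δ)
    {w : ℝ × ℝ} (hw : w ∈ TT p₀) :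
    HasFDerivWithinAt Yf (Fam.cl (-px (w.1, Yf w) / py (w.1, Yf w)) (-1 / py (w.1, Yf w))) (TT p₀) w :=
  (H.dΨ hY hδ h hst hw).snd

lemma Hod.dU (hY : ContinuousOn Yf (TT p₀)) (H : Hod d η p₀ ψ Yf) (hδ : 0 < δ) (h : PD d η ψ px py) (hst : ∀ z ∈ Oc d η, py z ≤ -δ)
    (hu : PD d η u ux uy) {w : ℝ × ℝ} (hw : w ∈ TT p₀) :
    HasFDerivWithinAt (fun w => u (w.1, Yf w)) (Fam.cl (ux (w.1, Yf w) + uy (w.1, Yf w) * (-px (w.1, Yf w) / py (w.1, Yf w)))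
      (uy (w.1, Yf w) * (-1 / py (w.1, Yf w)))) (TT p₀) w := by
  have := (hu _ (H.mem w hw)).comp w (H.dΨ hY hδ h hst hw) (fun x hx => H.mem x hx)
  refine this.congr_fderiv ?_
  ext z <;> simp [Fam.cl_apply]
end Geo
end
end

section
open Set MeasureTheory Filter Topology
open scoped BoundedContinuousFunction
noncomputable section
namespace Geo
variable {p₀ : ℝ} [hab : Fact (p₀ < 0)] {U Uq Up : ℝ × ℝ → ℝ} {f f' : FF p₀ 0}

/-- `f` represents `U` -/
def Lf (f : FF p₀ 0) (U : ℝ × ℝ → ℝ) : Prop := ∀ q, ∀ p ∈ Icc p₀ 0, ex (f q) p = U (q, p)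

lemma lift (hc : ContinuousOn U (TT p₀)) {B : ℝ} (hB : ∀ w ∈ TT p₀, |U w| ≤ B) : ∃ f : FF p₀ 0, Lf f U ∧ ‖f‖ ≤ B := by
  have hB0 : 0 ≤ B := (abs_nonneg _).trans (hB (0, 0) ⟨hab.out.le, le_rfl⟩)
  have hcont : Continuous (fun z : ℝ × Icc p₀ 0 => U (z.1, (z.2 : ℝ))) := by
    have h1 : Continuous (fun z : ℝ × Icc p₀ 0 => (z.1, (z.2 : ℝ))) := by fun_prop
    exact hc.comp_continuous h1 (fun z => z.2.2)
  let F : C(ℝ, C(Icc p₀ 0, ℝ)) := ContinuousMap.curry ⟨_, hcont⟩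
  have hF : ∀ q, ‖F q‖ ≤ B := fun q => (ContinuousMap.norm_le _ hB0).2 fun p => hB (q, p) p.2
  refine ⟨BoundedContinuousFunction.ofNormedAddCommGroup F F.continuous B hF, fun q p hp => ?_, BoundedContinuousFunction.norm_ofNormedAddCommGroup_le _ hB0 hF⟩
  exact ex_of (F q) ⟨p, hp⟩

lemma Lf.ext {f f' : FF p₀ 0} {U U' : ℝ × ℝ → ℝ} (h : Lf f U) (h' : Lf f' U') (he : ∀ w ∈ TT p₀, U w = U' w) : f = f' := by
  ext q p
  have h1 := h q p p.2
  have h2 := h' q p p.2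
  rw [ex_of] at h1 h2
  rw [h1, h2]; exact he (q, p) p.2

lemma Lf.add {f f' : FF p₀ 0} {U U' : ℝ × ℝ → ℝ} (h : Lf f U) (h' : Lf f' U') : Lf (f + f') (fun w => U w + U' w) :=
  fun q p hp => by
    simp only [← h q p hp, ← h' q p hp]; rfl
lemma Lf.sub {f f' : FF p₀ 0} {U U' : ℝ × ℝ → ℝ} (h : Lf f U) (h' : Lf f' U') : Lf (f - f') (fun w => U w - U' w) :=
  fun q p hp => by
    simp only [← h q p hp, ← h' q p hp]; rfl
lemma Lf.mul {f f' : FF p₀ 0} {U U' : ℝ × ℝ → ℝ} (h : Lf f U) (h' : Lf f' U') : Lf (f * f') (fun w => U w * U' w) :=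
  fun q p hp => by
    simp only [← h q p hp, ← h' q p hp]; rfl
lemma Lf.smul {f : FF p₀ 0} {U : ℝ × ℝ → ℝ} (c : ℝ) (h : Lf f U) : Lf (c • f) (fun w => c * U w) :=
  fun q p hp => by
    simp only [← h q p hp]; rfl
lemma Lf.one : Lf (1 : FF p₀ 0) (fun _ => 1) := fun _ _ _ => rfl
lemma Lf.zero : Lf (0 : FF p₀ 0) (fun _ => 0) := fun _ _ _ => rfl
lemma Lf.R0 {f : FF p₀ 0} {U : ℝ × ℝ → ℝ} (h : Lf f U) : Lf (_root_.R0 f) (fun w => U (w.1, 0)) := by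
  intro q p hp
  rw [R0_apply, tp_ex, h q 0 ⟨hab.out.le, le_rfl⟩]; rfl

lemma Lf.hq (h : Lf f U) (h' : Lf f' Uq) (hd : ∀ q, ∀ p ∈ Icc p₀ 0, HasDerivAt (fun t => U (t, p)) (Uq (q, p)) q) : HQ f f' := by
  have hG : ∀ q, HasDerivAt (fun q => f 0 + ∫ t in (0:ℝ)..q, f' t) (f' q) q := fun q =>
    (intervalIntegral.integral_hasDerivAt_right (f'.continuous.intervalIntegrable _ _)
      (f'.continuous.stronglyMeasurableAtFilter _ _) f'.continuous.continuousAt).const_add _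
  have he : (f : ℝ → AA p₀ 0) = fun q => f 0 + ∫ t in (0:ℝ)..q, f' t := by
    funext q
    ext p
    have hev := ContinuousLinearMap.intervalIntegral_comp_comm (ContinuousMap.evalCLM ℝ p : AA p₀ 0 →L[ℝ] ℝ)
      (f'.continuous.intervalIntegrable (μ := volume) 0 q)
    have hc : Continuous (fun t => Uq (t, (p : ℝ))) := by
      have : (fun t => Uq (t, (p : ℝ))) = fun t => (ContinuousMap.evalCLM ℝ p : AA p₀ 0 →L[ℝ] ℝ) (f' t) := by
        funext t
        have := h' t p p.2
        rw [ex_of] at this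
        exact this.symm
      rw [this]
      exact (ContinuousLinearMap.continuous _).comp f'.continuous
    have hint := intervalIntegral.integral_eq_sub_of_hasDerivAt (a := 0) (b := q) (fun t _ => hd t p p.2) (hc.intervalIntegrable _ _)
    have e1 := h q p p.2
    have e2 := h 0 p p.2
    rw [ex_of] at e1 e2
    have e3 : ∀ t, (ContinuousMap.evalCLM ℝ p : AA p₀ 0 →L[ℝ] ℝ) (f' t) = Uq (t, (p : ℝ)) := by
      intro t
      have := h' t p p.2
      rw [ex_of] at this
      exact this
    simp only [e3] at hev
    change f q p = f 0 p + (ContinuousMap.evalCLM ℝ p : AA p₀ 0 →L[ℝ] ℝ) (∫ t in (0:ℝ)..q, f' t)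
    rw [← hev, hint, e1, e2]; ring
  intro q
  rw [he]
  exact hG q

lemma Lf.dp (h : Lf f U) (h' : Lf f' Up) (hd : ∀ q, ∀ p ∈ Ioo p₀ 0, HasDerivAt (fun t => U (q, t)) (Up (q, p)) p) (q : ℝ) : DP (f q) (f' q) := by
  refine DP_of fun p hp => ?_
  rw [h' q p (Ioo_subset_Icc_self hp)]
  refine (hd q p hp).congr_of_eventuallyEq ?_
  filter_upwards [Ioo_mem_nhds hp.1 hp.2] with t ht
  exact h q t (Ioo_subset_Icc_self ht)

lemma slice_q {U : ℝ × ℝ → ℝ} {A B q p : ℝ} (h : HasFDerivWithinAt U (Fam.cl A B) (TT p₀) (q, p)) (hp : p ∈ Icc p₀ 0) :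
    HasDerivAt (fun t => U (t, p)) A q := by
  have h1 : HasDerivAt (fun t : ℝ => (t, p)) ((1:ℝ), (0:ℝ)) q := (hasDerivAt_id _).prodMk (hasDerivAt_const _ _)
  have := h.comp_hasDerivAt q h1 (Filter.Eventually.of_forall fun t => hp)
  rw [Fam.cl_apply] at this
  simp only [mul_zero, mul_one, add_zero] at this
  exact this

lemma slice_p {U : ℝ × ℝ → ℝ} {A B q p : ℝ} (h : HasFDerivWithinAt U (Fam.cl A B) (TT p₀) (q, p)) (hp : p ∈ Ioo p₀ 0) :
    HasDerivAt (fun t => U (q, t)) B p := by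
  have h1 : HasDerivAt (fun t : ℝ => (q, t)) ((0:ℝ), (1:ℝ)) p := (hasDerivAt_const _ _).prodMk (hasDerivAt_id _)
  have hev : ∀ᶠ t in 𝓝 p, (q, t) ∈ TT p₀ := by
    filter_upwards [Ioo_mem_nhds hp.1 hp.2] with t ht using Ioo_subset_Icc_self ht
  have := h.comp_hasDerivAt p h1 hev
  rw [Fam.cl_apply] at this
  simp only [mul_zero, mul_one, zero_add] at this
  exact this
end Geo
end
end

section
open Set MeasureTheory Filter Topology
open scoped BoundedContinuousFunction
noncomputable section
namespace Geo
variable {p₀ : ℝ} [hab : Fact (p₀ < 0)]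

lemma d_const {c : FF p₀ 0} {C : ℝ → ℝ} (h : Lf c (fun w => C w.2)) (τ) : (dOps (AA p₀ 0)).δ τ c = 0 := by
  have e : Tr (τ : ℝ) c = c := by
    ext q p
    have h1 := h q p p.2
    have h2 := h (q + τ) p p.2
    rw [ex_of] at h1 h2
    rw [Tr_apply, h1, h2]
  change (τ : ℝ)⁻¹ • (Tr (τ : ℝ) c - c) = 0
  rw [e]
  ext q p
  change (τ : ℝ)⁻¹ * (c q p - c q p) = 0
  rw [sub_self, mul_zero]

theorem mkSys {A Hh V C20 C11 C02 Y : ℝ × ℝ → ℝ} {C1 C2 : ℝ → ℝ} {fA fH fV f20 f11 f02 fY c1 c2 : FF p₀ 0}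
    (lA : Lf fA A) (lH : Lf fH Hh) (lV : Lf fV V) (l20 : Lf f20 C20) (l11 : Lf f11 C11) (l02 : Lf f02 C02) (lY : Lf fY Y)
    (lc1 : Lf c1 (fun w => C1 w.2)) (lc2 : Lf c2 (fun w => C2 w.2))
    (hA : ContinuousOn A (TT p₀)) (hH : ContinuousOn Hh (TT p₀))
    (qA : ∀ q, ∀ p ∈ Icc p₀ 0, HasDerivAt (fun t => A (t, p)) (C20 (q,p) + C11 (q,p) * (A (q,p) * Hh (q,p))) q)
    (pA : ∀ q, ∀ p ∈ Ioo p₀ 0, HasDerivAt (fun t => A (q, t)) (C11 (q,p) * Hh (q,p)) p)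
    (qH : ∀ q, ∀ p ∈ Icc p₀ 0, HasDerivAt (fun t => Hh (t, p)) ((C11 (q,p) + C02 (q,p) * (A (q,p) * Hh (q,p))) * (Hh (q,p) * Hh (q,p))) q)
    (pH : ∀ q, ∀ p ∈ Ioo p₀ 0, HasDerivAt (fun t => Hh (q, t)) (C02 (q,p) * Hh (q,p) * (Hh (q,p) * Hh (q,p))) p)
    (qY : ∀ q, ∀ p ∈ Icc p₀ 0, HasDerivAt (fun t => Y (t, p)) (A (q,p) * Hh (q,p)) q)
    (pY : ∀ q, ∀ p ∈ Ioo p₀ 0, HasDerivAt (fun t => Y (q, t)) (Hh (q,p)) p)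
    (VH : ∀ w ∈ TT p₀, V w * Hh w = 1)
    (pde : ∀ w ∈ TT p₀, C20 w + C02 w = C1 w.2 + C2 w.2 * Y w)
    (bot : ∀ q, A (q, p₀) = 0)
    {η η' η'' : ℝ → ℝ} (dη : ∀ x, HasDerivAt η (η' x) x) (dη' : ∀ x, HasDerivAt η' (η'' x) x) {B : ℝ} (hB : ∀ x, |η' x| ≤ B)
    (hηY : ∀ q, Y (q, 0) = η q) {sg k1 k2 : ℝ}
    (surf : ∀ x, η'' x = Real.sqrt (1 + η' x ^ 2) * (1 + η' x ^ 2) * (sg * (V (x,0) ^ 2 * (1 + η' x ^ 2)) + (k1 * η x + k2))) :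
    ∃ S : Sys p₀ 0, S.c1 = c1 ∧ S.c2 = c2 ∧ S.Z = fA * fH ∧ S.V = fV := by
  have z0 : (0:ℝ) ∈ Icc p₀ 0 := ⟨hab.out.le, le_rfl⟩
  have lZ := lA.mul lH
  have qZ : ∀ q, ∀ p ∈ Icc p₀ 0, HasDerivAt (fun t => A (t, p) * Hh (t, p)) _ q := fun q p hp => (qA q p hp).mul (qH q p hp)
  have hZ0 : ∀ q, A (q, 0) * Hh (q, 0) = η' q := by
    intro q
    have := qY q 0 z0
    simp only [hηY] at this
    exact this.unique (dη q)
  obtain ⟨fW, lW, -⟩ := lift (p₀ := p₀) (U := fun w => (1 + (A w * Hh w) * (A w * Hh w))⁻¹) (B := 1)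
    ((continuousOn_const.add ((hA.mul hH).mul (hA.mul hH))).inv₀ (fun w _ => by
      change 1 + (A w * Hh w) * (A w * Hh w) ≠ 0
      nlinarith [mul_self_nonneg (A w * Hh w)]))
    (fun w _ => by
      have h0 := mul_self_nonneg (A w * Hh w)
      rw [abs_inv, abs_of_pos (by linarith)]
      exact inv_le_one_of_one_le₀ (by linarith))
  have cη' : Continuous η' := continuous_iff_continuousAt.2 fun x => (dη' x).continuousAt
  have B0 : 0 ≤ B := (abs_nonneg _).trans (hB 0)
  obtain ⟨fJ, lJ, -⟩ := lift (p₀ := p₀) (U := fun w => Real.sqrt (1 + η' w.1 ^ 2)) (B := 1 + B)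
    (by
      have : Continuous (fun w : ℝ × ℝ => Real.sqrt (1 + η' w.1 ^ 2)) := by fun_prop
      exact this.continuousOn)
    (fun w _ => by
      rw [abs_of_nonneg (Real.sqrt_nonneg _)]
      apply Real.sqrt_le_iff.2
      refine ⟨by linarith, ?_⟩
      have h1 := hB w.1
      have h2 : η' w.1 ^ 2 ≤ B ^ 2 := by
        rw [← sq_abs]; exact pow_le_pow_left₀ (abs_nonneg _) h1 2
      nlinarith)
  have lZq := ((l20.mul lH).add (((lA.mul l11)).mul (lH.mul lH))).add (((l11.mul lH).add ((lA.mul l02).mul (lH.mul lH))).mul lZ)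
  have lZp := ((l11.mul lH).add ((lA.mul l02).mul (lH.mul lH))).mul lH
  have lHp := (l02.mul lH).mul (lH.mul lH)
  have lOne := Lf.one (p₀ := p₀)
  have rZ := lZ.R0
  have rV := lV.R0
  have rY := lY.R0
  have lE := ((rV.mul rV).mul (lOne.add (rZ.mul rZ))).smul sg |>.add ((rY.smul k1).add (lOne.smul k2))
  have eZq : ∀ q, (C20 (q,0) * Hh (q,0) + A (q,0) * C11 (q,0) * (Hh (q,0) * Hh (q,0))) +
      ((C11 (q,0) * Hh (q,0) + A (q,0) * C02 (q,0) * (Hh (q,0) * Hh (q,0))) * (A (q,0) * Hh (q,0))) = η'' q := by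
    intro q
    have h1 := qZ q 0 z0
    simp only [hZ0] at h1
    rw [← h1.unique (dη' q), ← hZ0]; ring
  refine ⟨{
    Z := fA * fH, H := fH, Y := fY, Zq := _, Zp := _, Hp := _, c1 := c1, c2 := c2, V := fV, W := fW, J := fJ, sg := sg, k1 := k1, k2 := k2,
    hZq := lZ.hq lZq ?_, hHq := lH.hq lZp ?_, hYq := lY.hq lZ qY, hZp := lZ.dp lZp ?_, hHp := lH.dp lHp pH, hYp := lY.dp lH pY,
    hc1 := d_const lc1, hc2 := d_const lc2, pde := ?_, VH := (lV.mul lH).ext lOne VH,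
    WZ := (lW.mul (lOne.add (lZ.mul lZ))).ext lOne ?_, bot := ?_, hJ := ?_, top := ?_ }, rfl, rfl, rfl, rfl⟩
  · intro q p hp
    exact (qZ q p hp).congr_deriv (by ring)
  · intro q p hp
    exact (qH q p hp).congr_deriv (by ring)
  · intro q p hp
    exact ((pA q p hp).mul (pH q p hp)).congr_deriv (by ring)
  · refine Lf.ext (((lOne.add (lZ.mul lZ)).mul lHp).sub (((lZ.mul lH).mul lZp).smul 2) |>.add ((lH.mul lH).mul lZq))
      ((lc1.add (lc2.mul lY)).mul (lH.mul (lH.mul lH))) ?_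
    intro w hw
    rw [← pde w hw]; ring
  · intro w hw
    exact inv_mul_cancel₀ (by nlinarith [mul_self_nonneg (A w * Hh w)])
  · intro q
    rw [bt_ex, lZ q p₀ ⟨le_rfl, hab.out.le⟩]
    simp [bot]
  · refine lJ.hq ((rZ.mul (lOne.add (rZ.mul rZ))).mul lE) ?_
    intro q p hp
    simp only [hZ0, hηY]
    have hpos : 0 < 1 + η' q ^ 2 := by positivity
    have h1 := ((((dη' q).pow 2).const_add 1).sqrt hpos.ne')
    refine h1.congr_deriv ?_
    simp only [Pi.pow_apply]
    have hs := Real.sqrt_pos.2 hpos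
    rw [surf q]
    field_simp
    ring
  · refine Lf.ext lZq.R0 ((lJ.mul (lOne.add (rZ.mul rZ))).mul lE) ?_
    intro w hw
    simp only [hZ0, hηY]
    have := eZq w.1
    simp only [hZ0] at this
    rw [this, surf]; ring
end Geo
end
end

section
open Set MeasureTheory Filter Topology
open scoped BoundedContinuousFunction
noncomputable section
namespace Geo
variable {p₀ : ℝ} [hab : Fact (p₀ < 0)]

lemma liftC {b : ℝ → ℝ} (hb : ContinuousOn b (Icc p₀ 0)) {B : ℝ} (hB : ∀ p ∈ Icc p₀ 0, |b p| ≤ B) :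
    ∃ f : FF p₀ 0, Lf f (fun w => b w.2) ∧ ‖f‖ ≤ B :=
  lift (hb.comp continuous_snd.continuousOn (fun _ hw => hw)) (fun w hw => hB w.2 hw)

lemma gk {β : ℝ → ℝ} (h : ContDiffOn ℝ (⊤ : ℕ∞) β (Icc p₀ 0)) (k : ℕ) :
    ContinuousOn (iteratedDerivWithin k β (Icc p₀ 0)) (Icc p₀ 0) ∧
    ∀ p ∈ Ioo p₀ 0, HasDerivAt (iteratedDerivWithin k β (Icc p₀ 0)) (iteratedDerivWithin (k+1) β (Icc p₀ 0) p) p := by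
  have hu := uniqueDiffOn_Icc hab.out
  refine ⟨h.continuousOn_iteratedDerivWithin (by exact_mod_cast le_top) hu, fun p hp => ?_⟩
  have hd := h.differentiableOn_iteratedDerivWithin (m := k) (by exact_mod_cast WithTop.coe_lt_top k) hu p (Ioo_subset_Icc_self hp)
  rw [iteratedDerivWithin_succ]
  exact hd.hasDerivWithinAt.hasDerivAt (Icc_mem_nhds hp.1 hp.2)

theorem cct {s g : ℝ} (hs : 1 ≤ s) (hg : 0 < g) {β ρ : ℝ → ℝ} (hβ : GevreyOnIcc s p₀ β) (hρ : GevreyOnIcc s p₀ ρ) :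
    ∃ M, 1 ≤ M ∧ ∃ cc : Fin 3 → ℕ → FF p₀ 0, (∀ i k, HQ (cc i k) 0) ∧ (∀ i k q, DP (cc i k q) (cc i (k+1) q)) ∧
      (∀ i k, ‖cc i k‖ ≤ M ^ (k+1) * (k.factorial:ℝ) ^ s) ∧ Lf (cc 0 0) (fun w => -β w.2) ∧
      Lf (cc 1 0) (fun w => g * derivWithin ρ (Icc p₀ 0) w.2) ∧ Lf (cc 2 0) (fun w => -w.2) := by
  obtain ⟨cβ, M1, hM1, b1⟩ := hβ
  obtain ⟨cρ, M2, hM2, b2⟩ := hρ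
  have hp := hab.out
  have h2s : (1:ℝ) ≤ 2 ^ s := Real.one_le_rpow (by norm_num) (by linarith)
  obtain ⟨M, hM⟩ : ∃ M : ℝ, M = M1 + (g + 1) * M2 ^ 2 * 2 ^ s + |p₀| := ⟨_, rfl⟩
  have p1 : 1 ≤ M2 ^ 2 := one_le_pow₀ hM2
  have p2 : M2 ^ 2 ≤ M2 ^ 2 * 2 ^ s := le_mul_of_one_le_right (by positivity) h2s
  have p3 : 0 ≤ g * (M2 ^ 2 * 2 ^ s) := by positivity
  have ex3 : (g + 1) * M2 ^ 2 * 2 ^ s = g * (M2 ^ 2 * 2 ^ s) + M2 ^ 2 * 2 ^ s := by ring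
  have hMa : M1 ≤ M := by rw [hM, ex3]; linarith [abs_nonneg p₀]
  have hMb : |p₀| ≤ M := by rw [hM, ex3]; linarith
  have hMc : g * M2 ^ 2 ≤ M := by
    have : g * M2 ^ 2 ≤ g * (M2 ^ 2 * 2 ^ s) := mll p2 hg.le
    rw [hM, ex3]; linarith [abs_nonneg p₀]
  have hMd : M2 * 2 ^ s ≤ M := by
    have : M2 * 2 ^ s ≤ M2 ^ 2 * 2 ^ s := by
      apply mlr _ (by positivity)
      nlinarith
    rw [hM, ex3]; linarith [abs_nonneg p₀]
  have hM0 : 1 ≤ M := hM1.trans hMa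
  have fac : ∀ k : ℕ, 0 ≤ (k.factorial : ℝ) ^ s := fun k => by positivity
  let bb : Fin 3 → ℕ → ℝ → ℝ := fun i k => match i with
    | 0 => fun p => -iteratedDerivWithin k β (Icc p₀ 0) p
    | 1 => fun p => g * iteratedDerivWithin (k+1) ρ (Icc p₀ 0) p
    | 2 => match k with
      | 0 => fun p => -p
      | 1 => fun _ => -1
      | _ + 2 => fun _ => 0
  have key : ∀ i k, ContinuousOn (bb i k) (Icc p₀ 0) ∧ (∀ p ∈ Ioo p₀ 0, HasDerivAt (bb i k) (bb i (k+1) p) p) ∧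
      ∀ p ∈ Icc p₀ 0, |bb i k p| ≤ M ^ (k+1) * (k.factorial:ℝ) ^ s := by
    intro i k
    match i with
    | 0 =>
      refine ⟨(gk cβ k).1.neg, fun p hp => ((gk cβ k).2 p hp).neg, fun p hp => ?_⟩
      change |-iteratedDerivWithin k β (Icc p₀ 0) p| ≤ _
      rw [abs_neg]
      exact (b1 k p hp).trans (mlr (pow_le_pow_left₀ (by linarith) hMa _) (fac k))
    | 1 =>
      refine ⟨(gk cρ (k+1)).1.const_mul g, fun p hp => ((gk cρ (k+1)).2 p hp).const_mul g, fun p hp => ?_⟩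
      change |g * iteratedDerivWithin (k+1) ρ (Icc p₀ 0) p| ≤ _
      rw [abs_mul, abs_of_pos hg]
      have h1 := b2 (k+1) p hp
      have h2 : ((k+1).factorial : ℝ) ^ s ≤ (2 ^ s) ^ k * (k.factorial : ℝ) ^ s := by
        rw [Nat.factorial_succ, Nat.cast_mul, Real.mul_rpow (by positivity) (by positivity)]
        apply mlr _ (fac k)
        rw [← Real.rpow_natCast, ← Real.rpow_mul (by norm_num), mul_comm s, Real.rpow_mul (by norm_num), Real.rpow_natCast]
        apply Real.rpow_le_rpow (by positivity) _ (by linarith)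
        exact_mod_cast Nat.lt_two_pow_self
      calc g * |iteratedDerivWithin (k+1) ρ (Icc p₀ 0) p| ≤ g * (M2 ^ (k+1+1) * ((2 ^ s) ^ k * (k.factorial : ℝ) ^ s)) := by
            gcongr; exact h1.trans (mll h2 (by positivity))
        _ = ((g * M2 ^ 2) * (M2 * 2 ^ s) ^ k) * (k.factorial : ℝ) ^ s := by rw [mul_pow]; ring
        _ ≤ (M * M ^ k) * (k.factorial : ℝ) ^ s := by gcongr
        _ = _ := by ring
    | 2 =>
      match k with
      | 0 =>
        refine ⟨continuous_neg.continuousOn, fun p _ => (hasDerivAt_id p).neg, fun p hp => ?_⟩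
        change |-p| ≤ _
        have : |-p| ≤ |p₀| := by rw [abs_neg, abs_of_nonpos hp.2, abs_of_neg hab.out]; linarith [hp.1]
        simpa using this.trans hMb
      | 1 =>
        refine ⟨continuousOn_const, fun p _ => hasDerivAt_const p _, fun p hp => ?_⟩
        change |(-1:ℝ)| ≤ _
        simpa using one_le_pow₀ hM0 (n := 2)
      | k + 2 =>
        refine ⟨continuousOn_const, fun p _ => hasDerivAt_const p _, fun p hp => ?_⟩
        change |(0:ℝ)| ≤ _
        rw [abs_zero]
        exact mul_nonneg (by positivity) (fac _)
  choose cc hcc hcb using fun i k => liftC (key i k).1 (key i k).2.2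
  refine ⟨M, hM0, cc, fun i k => (hcc i k).hq Lf.zero (fun q p hp => hasDerivAt_const q (bb i k p)),
    fun i k q => (hcc i k).dp (hcc i (k+1)) (fun q p hp => (key i k).2.1 p hp) q, hcb, ?_, ?_, hcc 2 0⟩
  · have := hcc 0 0
    simpa [bb] using this
  · have := hcc 1 0
    simpa [bb, iteratedDerivWithin_one] using this
end Geo
end
end

section
open Set MeasureTheory Filter Topology
open scoped BoundedContinuousFunction
noncomputable section
namespace Geo
variable {p₀ d g σ Q μ δ s : ℝ} {η β ρ : ℝ → ℝ} {ψ px py pxx pxy pyy : ℝ × ℝ → ℝ}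

lemma inv_d {P : ℝ → ℝ} {P' t : ℝ} (h : HasDerivAt P P' t) (h0 : P t ≠ 0) : HasDerivAt (fun t => -1 / P t) (P' * ((-1 / P t) * (-1 / P t))) t := by
  refine ((hasDerivAt_const t (-1:ℝ)).div h h0).congr_deriv ?_
  field_simp; ring

lemma gb (hp : p₀ < 0) (h : GevreyOnIcc s p₀ β) : ∃ M, 0 ≤ M ∧ ∀ p ∈ Icc p₀ 0, |β p| ≤ M ∧ |derivWithin β (Icc p₀ 0) p| ≤ M := by
  obtain ⟨-, M, hM, hb⟩ := h
  refine ⟨M ^ 2, by positivity, fun p hp => ⟨?_, ?_⟩⟩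
  · have := hb 0 p hp
    simp at this
    nlinarith
  · have := hb 1 p hp
    simpa [iteratedDerivWithin_one] using this

/-- a priori bounds -/
theorem apriori (hp₀ : p₀ < 0) (hg : 0 < g) (hσ : 0 < σ) (hμ : 0 ≤ μ) (hδ : 0 < δ)
    (hηd : ∀ x, -d < η x) (hη : ContDiff ℝ 2 η) (hd : 0 < d)
    (hη2 : ∃ K, ∀ x x' : ℝ, |deriv (deriv η) x - deriv (deriv η) x'| ≤ K * |x - x'| ^ μ)
    (h1 : PD d η ψ px py) (h2 : PD d η px pxx pxy) (h3 : PD d η py pxy pyy)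
    (hxy : Hol d η μ pxy) (hyy : Hol d η μ pyy) (hβ : GevreyOnIcc s p₀ β) (hρ : GevreyOnIcc s p₀ ρ)
    (hρpos : ∀ p ∈ Icc p₀ 0, 0 < ρ p)
    (hr : ∀ z ∈ Oc d η, -ψ z ∈ Icc p₀ 0)
    (hpde : ∀ z ∈ Oc d η, pxx z + pyy z - g * z.2 * derivWithin ρ (Icc p₀ 0) (-ψ z) = -β (-ψ z))
    (hsurf : ∀ x : ℝ, (px (x, η x)) ^ 2 + (py (x, η x)) ^ 2 + 2 * g * (η x + d) * ρ (-ψ (x, η x))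
        - 2 * σ * deriv (deriv η) x / (1 + (deriv η x) ^ 2) ^ ((3 : ℝ) / 2) = Q)
    (htop : ∀ x : ℝ, ψ (x, η x) = 0) (hbot : ∀ x : ℝ, ψ (x, -d) = -p₀) (hst : ∀ z ∈ Oc d η, py z ≤ -δ) :
    (∀ x, px (x, -d) = 0) ∧ ∃ B, (∀ x, |deriv η x| ≤ B) ∧ (∀ z ∈ Oc d η, |z.2| ≤ B) ∧
      ∀ z ∈ Oc d η, |px z| ≤ B ∧ |py z| ≤ B ∧ |pxx z| ≤ B ∧ |pxy z| ≤ B ∧ |pyy z| ≤ B := by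
  have hT := depth hηd hδ h1 hst htop hbot
  obtain ⟨T, hTe⟩ : ∃ T, T = -p₀ / δ := ⟨_, rfl⟩
  rw [← hTe] at hT
  have T0 : 0 ≤ T := by have := hT 0; have := hηd 0; linarith
  have hy : ∀ z ∈ Oc d η, |z.2| ≤ d + T := by
    intro z hz
    have := hT z.1
    rw [abs_le]; constructor <;> linarith [hz.1, hz.2]
  have hηb : ∀ x, |η x| ≤ d + T := fun x => hy (x, η x) ⟨(hηd x).le, le_rfl⟩
  have dη : ∀ x, HasDerivAt η (deriv η x) x := fun x => (hη.differentiable (by norm_num) x).hasDerivAt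
  have hη1 : ContDiff ℝ 1 (deriv η) := by
    have : ContDiff ℝ (1 + 1) η := by simpa [one_add_one_eq_two] using hη
    exact (contDiff_succ_iff_deriv.1 this).2.2
  have dη' : ∀ x, HasDerivAt (deriv η) (deriv (deriv η) x) x := fun x => (hη1.differentiable (by norm_num) x).hasDerivAt
  obtain ⟨K, hK⟩ := hη2
  obtain ⟨C, hC⟩ := interp2 dη dη' hηb (abs_nonneg K) hμ (fun x x' => (hK x x').trans
    (mlr (le_abs_self K) (by positivity)))
  have C0 : 0 ≤ C := (abs_nonneg _).trans (hC 0).1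
  obtain ⟨M1, M10, b1⟩ := gb hp₀ hβ
  obtain ⟨M2, M20, b2⟩ := gb hp₀ hρ
  have hN : ∀ z ∈ Oc d η, |pxx z + pyy z| ≤ g * (d + T) * M2 + M1 := by
    intro z hz
    have e : pxx z + pyy z = g * z.2 * derivWithin ρ (Icc p₀ 0) (-ψ z) - β (-ψ z) := by linarith [hpde z hz]
    rw [e]
    refine (abs_sub _ _).trans (add_le_add ?_ (b1 _ (hr z hz)).1)
    rw [abs_mul, abs_mul, abs_of_pos hg]
    exact mul_le_mul (mll (hy z hz) hg.le) (b2 _ (hr z hz)).2 (abs_nonneg _) (by positivity)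
  have hbern : ∀ x, |py (x, η x)| ≤ |Q| + 2 * σ * C + 1 := by
    intro x
    have e := hsurf x
    have hin : (x, η x) ∈ Oc d η := ⟨(hηd x).le, le_rfl⟩
    have hpos := hρpos _ (hr _ hin)
    have q1 : 0 ≤ 2 * g * (η x + d) * ρ (-ψ (x, η x)) := by
      have := hηd x
      have : 0 < η x + d := by linarith
      positivity
    have q2 : 1 ≤ (1 + (deriv η x) ^ 2) ^ ((3 : ℝ) / 2) := Real.one_le_rpow (by nlinarith) (by norm_num)
    have q3 : 2 * σ * deriv (deriv η) x / (1 + (deriv η x) ^ 2) ^ ((3 : ℝ) / 2) ≤ 2 * σ * C := by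
      rw [div_le_iff₀ (by linarith)]
      have u1 : 2 * σ * deriv (deriv η) x ≤ 2 * σ * C := mll ((le_abs_self _).trans (hC x).2) (by positivity)
      have u2 : 2 * σ * C ≤ 2 * σ * C * (1 + (deriv η x) ^ 2) ^ ((3 : ℝ) / 2) := le_mul_of_one_le_right (by positivity) q2
      linarith
    have q4 : py (x, η x) ^ 2 ≤ |Q| + 2 * σ * C := by nlinarith [le_abs_self Q, sq_nonneg (px (x, η x))]
    rw [← sq_abs] at q4
    nlinarith [sq_nonneg (|py (x, η x)| - 1), abs_nonneg (py (x, η x))]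
  have n1 : 0 ≤ g * (d + T) * M2 + M1 := by positivity
  have n2 : 0 ≤ |Q| + 2 * σ * C + 1 := by positivity
  obtain ⟨hb0, B, hB⟩ := bounds (N := g * (d + T) * M2 + M1 + (|Q| + 2 * σ * C + 1)) hμ hηd hT h1 h2 h3 hxy hyy
    (fun z hz => (hN z hz).trans (by linarith)) (fun x => (hbern x).trans (by linarith)) hbot
  refine ⟨hb0, max B (max C (d + T)), fun x => (hC x).1.trans ((le_max_left _ _).trans (le_max_right _ _)),
    fun z hz => (hy z hz).trans ((le_max_right _ _).trans (le_max_right _ _)), fun z hz => ?_⟩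
  have hl := le_max_left B (max C (d + T))
  obtain ⟨a1, a2, a3, a4, a5⟩ := hB z hz
  exact ⟨a1.trans hl, a2.trans hl, a3.trans hl, a4.trans hl, a5.trans hl⟩
end Geo
end
end

section
open Set MeasureTheory Filter Topology
open scoped BoundedContinuousFunction
noncomputable section
namespace Geo
variable {p₀ d g σ Q μ δ s : ℝ} {η β ρ : ℝ → ℝ} {ψ px py pxx pxy pyy : ℝ × ℝ → ℝ}

theorem core (hp₀ : p₀ < 0) (hg : 0 < g) (hσ : 0 < σ) (hδ : 0 < δ) (hs : 1 ≤ s)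
    (hηd : ∀ x, -d < η x) (hη : ContDiff ℝ 2 η)
    (h1 : PD d η ψ px py) (h2 : PD d η px pxx pxy) (h3 : PD d η py pxy pyy)
    (kxx : ContinuousOn pxx (Oc d η)) (kxy : ContinuousOn pxy (Oc d η)) (kyy : ContinuousOn pyy (Oc d η))
    (hβ : GevreyOnIcc s p₀ β) (hρ : GevreyOnIcc s p₀ ρ) {Yf : ℝ × ℝ → ℝ} (H : Hod d η p₀ ψ Yf)
    (hpde : ∀ z ∈ Oc d η, pxx z + pyy z - g * z.2 * derivWithin ρ (Icc p₀ 0) (-ψ z) = -β (-ψ z))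
    (hsurf : ∀ x : ℝ, (px (x, η x)) ^ 2 + (py (x, η x)) ^ 2 + 2 * g * (η x + d) * ρ (-ψ (x, η x))
        - 2 * σ * deriv (deriv η) x / (1 + (deriv η x) ^ 2) ^ ((3 : ℝ) / 2) = Q)
    (htop : ∀ x : ℝ, ψ (x, η x) = 0) (hbot : ∀ x : ℝ, ψ (x, -d) = -p₀) (hst : ∀ z ∈ Oc d η, py z ≤ -δ)
    (hb0 : ∀ x, px (x, -d) = 0) {B : ℝ} (hB1 : ∀ x, |deriv η x| ≤ B) (hB2 : ∀ z ∈ Oc d η, |z.2| ≤ B)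
    (hB : ∀ z ∈ Oc d η, |px z| ≤ B ∧ |py z| ≤ B ∧ |pxx z| ≤ B ∧ |pxy z| ≤ B ∧ |pyy z| ≤ B) :
    GevreyOn2 s (Oc d η) ψ ∧ (s = 1 → AnalyticOn ℝ ψ (Oc d η)) := by
  haveI : Fact (p₀ < 0) := ⟨hp₀⟩
  have hY := H.cont hη.continuous hηd hδ h1 hst
  have z0 : (0:ℝ) ∈ Icc p₀ 0 := ⟨hp₀.le, le_rfl⟩
  have kx : ContinuousOn px (Oc d η) := fun z hz => (h2 z hz).continuousWithinAt
  have ky : ContinuousOn py (Oc d η) := fun z hz => (h3 z hz).continuousWithinAt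
  have ne : ∀ z ∈ Oc d η, py z ≠ 0 := fun z hz => by have := hst z hz; linarith
  have kh : ContinuousOn (fun z => -1 / py z) (Oc d η) := continuousOn_const.div ky ne
  obtain ⟨fA, lA, -⟩ := lift (H.contΨ hY kx) (fun w hw => (hB _ (H.mem w hw)).1)
  obtain ⟨fV, lV, -⟩ := lift (H.contΨ hY ky.neg) (B := B) (fun w hw => by
    change |-py (w.1, Yf w)| ≤ B
    rw [abs_neg]; exact (hB _ (H.mem w hw)).2.1)
  obtain ⟨f20, l20, -⟩ := lift (H.contΨ hY kxx) (fun w hw => (hB _ (H.mem w hw)).2.2.1)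
  obtain ⟨f11, l11, -⟩ := lift (H.contΨ hY kxy) (fun w hw => (hB _ (H.mem w hw)).2.2.2.1)
  obtain ⟨f02, l02, -⟩ := lift (H.contΨ hY kyy) (fun w hw => (hB _ (H.mem w hw)).2.2.2.2)
  obtain ⟨fY, lY, -⟩ := lift hY (fun w hw => hB2 _ (H.mem w hw))
  obtain ⟨fH, lH, -⟩ := lift (H.contΨ hY kh) (B := 1 / δ) (fun w hw => by
    have := hst _ (H.mem w hw)
    rw [abs_div, abs_neg, abs_one, abs_of_neg (by linarith)]
    exact one_div_le_one_div_of_le hδ (by linarith))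
  obtain ⟨M, hM, cc, hcq, hcp, hcb, l1, l2, l3⟩ := cct hs hg hβ hρ
  have dη : ∀ x, HasDerivAt η (deriv η x) x := fun x => (hη.differentiable (by norm_num) x).hasDerivAt
  have hη1 : ContDiff ℝ 1 (deriv η) := by
    have : ContDiff ℝ (1 + 1) η := by simpa [one_add_one_eq_two] using hη
    exact (contDiff_succ_iff_deriv.1 this).2.2
  have dη' : ∀ x, HasDerivAt (deriv η) (deriv (deriv η) x) x := fun x => (hη1.differentiable (by norm_num) x).hasDerivAt
  have it : ∀ x, (x, η x) ∈ Oc d η := fun x => ⟨(hηd x).le, le_rfl⟩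
  have ib : ∀ x, (x, -d) ∈ Oc d η := fun x => ⟨le_rfl, (hηd x).le⟩
  have Yt : ∀ q, Yf (q, 0) = η q := fun q => by
    have := H.inv _ (it q)
    simpa [htop] using this
  have Yb : ∀ q, Yf (q, p₀) = -d := fun q => by
    have := H.inv _ (ib q)
    simpa [hbot] using this
  have qY : ∀ q, ∀ p ∈ Icc p₀ 0, HasDerivAt (fun t => Yf (t, p)) (px (q, Yf (q,p)) * (-1 / py (q, Yf (q,p)))) q :=
    fun q p hp => (slice_q (H.dY hY hδ h1 hst (w := (q,p)) hp) hp).congr_deriv (by ring)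
  have hZ0 : ∀ q, px (q, η q) * (-1 / py (q, η q)) = deriv η q := fun q => by
    have := qY q 0 z0
    simp only [Yt] at this
    exact this.unique (dη q)
  obtain ⟨S, S1, S2, S3, S4⟩ := mkSys (p₀ := p₀) (C1 := fun p => -β p) (C2 := fun p => g * derivWithin ρ (Icc p₀ 0) p) lA lH lV l20 l11 l02 lY l1 l2 (H.contΨ hY kx) (H.contΨ hY kh)
    (fun q p hp => (slice_q (H.dU hY hδ h1 hst h2 (w := (q,p)) hp) hp).congr_deriv (by ring))
    (fun q p hp => slice_p (H.dU hY hδ h1 hst h2 (w := (q,p)) (Ioo_subset_Icc_self hp)) hp)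
    (fun q p hp => (inv_d (slice_q (H.dU hY hδ h1 hst h3 (w := (q,p)) hp) hp) (ne _ (H.mem (q,p) hp))).congr_deriv (by ring))
    (fun q p hp => inv_d (slice_p (H.dU hY hδ h1 hst h3 (w := (q,p)) (Ioo_subset_Icc_self hp)) hp) (ne _ (H.mem (q,p) (Ioo_subset_Icc_self hp))))
    qY
    (fun q p hp => slice_p (H.dY hY hδ h1 hst (w := (q,p)) (Ioo_subset_Icc_self hp)) hp)
    (fun w hw => by
      have := ne _ (H.mem w hw)
      change -py (w.1, Yf w) * (-1 / py (w.1, Yf w)) = 1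
      field_simp)
    (fun w hw => by
      have := hpde _ (H.mem w hw)
      rw [H.val w hw, neg_neg] at this
      linear_combination this)
    (fun q => by simp only [Yb]; exact hb0 q)
    dη dη' hB1 Yt (sg := 1 / (2 * σ)) (k1 := g * ρ 0 / σ) (k2 := (2 * g * ρ 0 * d - Q) / (2 * σ))
    (fun x => by
      have e := hsurf x
      have hz := hZ0 x
      have hn := ne _ (it x)
      have hpos : 0 < 1 + deriv η x ^ 2 := by positivity
      have e32 : (1 + (deriv η x) ^ 2) ^ ((3 : ℝ) / 2) = Real.sqrt (1 + deriv η x ^ 2) * (1 + deriv η x ^ 2) := by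
        rw [Real.sqrt_eq_rpow, show (3:ℝ)/2 = 1/2 + 1 by norm_num, Real.rpow_add hpos, Real.rpow_one]
      rw [htop, neg_zero, e32] at e
      have hpx : px (x, η x) = -(deriv η x * py (x, η x)) := by
        rw [← hz]; field_simp
      rw [hpx] at e
      have hsq := Real.sqrt_pos.2 hpos
      simp only [Yt]
      change _ = Real.sqrt (1 + deriv η x ^ 2) * (1 + deriv η x ^ 2) * (1 / (2 * σ) * ((-py (x, η x)) ^ 2 * (1 + deriv η x ^ 2)) + (g * ρ 0 / σ * η x + (2 * g * ρ 0 * d - Q) / (2 * σ)))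
      obtain ⟨r, hr⟩ : ∃ r, r = Real.sqrt (1 + deriv η x ^ 2) * (1 + deriv η x ^ 2) := ⟨_, rfl⟩
      have hr0 : r ≠ 0 := by rw [hr]; positivity
      rw [← hr] at e ⊢
      field_simp at e ⊢
      linear_combination -e)
  obtain ⟨v, J, ⟨C, r, hD⟩, vZ, -, -, vV, vc⟩ := S.jet hs hM cc S1.symm S2.symm hcq hcp hcb
  refine PR.concl J hD (uniq hη hηd) (fun z hz => H.rg z hz) (fun z hz => ?_) (fun q p hp => ?_) (star hη hηd)
  · have hw := H.rg z hz
    have hi := H.inv z hz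
    have a1 := (lA.mul lH) z.1 _ hw
    have a2 := lV z.1 _ hw
    simp only [hi] at a1 a2
    rw [vZ, vV, S3, S4, a1, a2]
    have hn := ne z hz
    refine (h1 z hz).congr_fderiv ?_
    congr 1
    · change px z = px z * (-1 / py z) * (-py z)
      field_simp
    · change py z = - -py z
      ring
  · rw [vc, l3 q p hp]
end Geo
end
end

noncomputable section

theorem stratified_stream_function_gevrey
    (p₀ d g σ Q μ δ s : ℝ)
    (hp₀ : p₀ < 0) (hd : 0 < d) (hg : 0 < g) (hσ : 0 < σ)
    (hμ : μ ∈ Set.Ioo (0 : ℝ) 1) (hδ : 0 < δ) (hs : 1 ≤ s)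
    (η : ℝ → ℝ) (ψ : ℝ × ℝ → ℝ) (β ρ : ℝ → ℝ)
    (hηd : ∀ x, -d < η x)
    (Ωo Ωc : Set (ℝ × ℝ))
    (hΩo : Ωo = {z : ℝ × ℝ | -d < z.2 ∧ z.2 < η z.1})
    (hΩc : Ωc = {z : ℝ × ℝ | -d ≤ z.2 ∧ z.2 ≤ η z.1})
    -- η ∈ C^{2,μ}
    (hη : ContDiff ℝ 2 η)
    (hη2 : ∃ K, ∀ x x' : ℝ, |deriv (deriv η) x - deriv (deriv η) x'| ≤ K * |x - x'| ^ μ)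
    -- ψ ∈ C²(Ω̄) with μ-Hölder continuous second derivatives
    (hψ : ContDiffOn ℝ 2 ψ Ωc)
    (hψ2 : ∀ a b : ℕ, a + b = 2 → ∃ K, ∀ z ∈ Ωc, ∀ z' ∈ Ωc,
      |mpw Ωc a b ψ z - mpw Ωc a b ψ z'| ≤ K * (edist2 z z') ^ μ)
    -- β, ρ ∈ G^s([p₀,0]), ρ > 0
    (hβ : GevreyOnIcc s p₀ β)
    (hρpos : ∀ p ∈ Set.Icc p₀ 0, 0 < ρ p)
    (hρ : GevreyOnIcc s p₀ ρ)
    -- Yih's equation Δψ − g y ρ'(−ψ) = −β(−ψ) in Ω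
    (hpde : ∀ z ∈ Ωo,
      mpw Ωc 2 0 ψ z + mpw Ωc 0 2 ψ z
        - g * z.2 * derivWithin ρ (Set.Icc p₀ 0) (-ψ z) = -β (-ψ z))
    -- Bernoulli condition with surface tension on the free surface
    (hsurf : ∀ x : ℝ,
      (mpw Ωc 1 0 ψ (x, η x)) ^ 2 + (mpw Ωc 0 1 ψ (x, η x)) ^ 2
        + 2 * g * (η x + d) * ρ (-ψ (x, η x))
        - 2 * σ * deriv (deriv η) x / (1 + (deriv η x) ^ 2) ^ ((3 : ℝ) / 2) = Q)
    -- kinematic boundary conditions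
    (htop : ∀ x : ℝ, ψ (x, η x) = 0)
    (hbot : ∀ x : ℝ, ψ (x, -d) = -p₀)
    -- no stagnation: ψ_y ≤ −δ on Ω̄
    (hstag : ∀ z ∈ Ωc, mpw Ωc 0 1 ψ z ≤ -δ) :
    GevreyOn2 s Ωc ψ ∧ (s = 1 → AnalyticOn ℝ ψ Ωc) := by
  have hΩ : Ωc = Geo.Oc d η := hΩc
  subst hΩ
  have hS := Geo.uniq hη hηd
  have hi := Geo.clos_int hη.continuous hηd
  have h1 : Geo.PD d η ψ _ _ := fun z hz => Geo.d1 hψ hS hz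
  have h2 : Geo.PD d η _ _ _ := fun z hz => (Geo.d2 hψ hS hi hz).1
  have h3 : Geo.PD d η _ _ _ := fun z hz => (Geo.d2 hψ hS hi hz).2
  have kxx := Geo.c2 hψ hS 2 0 rfl
  have kxy := Geo.c2 hψ hS 1 1 rfl
  have kyy := Geo.c2 hψ hS 0 2 rfl
  obtain ⟨Yf, H⟩ := Geo.hod hηd hδ h1 hstag htop hbot
  haveI : Fact (p₀ < 0) := ⟨hp₀⟩
  have hr : ∀ z ∈ Geo.Oc d η, -ψ z ∈ Icc p₀ 0 := fun z hz => H.rg z hz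
  have hpde' : ∀ z ∈ Geo.Oc d η, mpw (Geo.Oc d η) 2 0 ψ z + mpw (Geo.Oc d η) 0 2 ψ z
        - g * z.2 * derivWithin ρ (Set.Icc p₀ 0) (-ψ z) = -β (-ψ z) := by
    rw [hΩo] at hpde
    have k1 : ContinuousOn (fun z => derivWithin ρ (Icc p₀ 0) (-ψ z)) (Geo.Oc d η) := by
      have := (Geo.gk hρ.1 1).1
      rw [iteratedDerivWithin_one] at this
      exact this.comp hψ.continuousOn.neg hr
    have k2 : ContinuousOn (fun z => -β (-ψ z)) (Geo.Oc d η) := (hβ.1.continuousOn.comp hψ.continuousOn.neg hr).neg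
    exact Set.EqOn.of_subset_closure (s := {z : ℝ × ℝ | -d < z.2 ∧ z.2 < η z.1}) hpde
      ((kxx.add kyy).sub ((continuousOn_const.mul continuous_snd.continuousOn).mul k1)) k2
      (fun z hz => ⟨hz.1.le, hz.2.le⟩) (Geo.clos hη.continuous hηd)
  obtain ⟨hb0, B, hB1, hB2, hB⟩ := Geo.apriori hp₀ hg hσ hμ.1.le hδ hηd hη hd hη2 h1 h2 h3 (hψ2 1 1 rfl) (hψ2 0 2 rfl)
    hβ hρ hρpos hr hpde' hsurf htop hbot hstag
  exact Geo.core hp₀ hg hσ hδ hs hηd hη h1 h2 h3 kxx kxy kyy hβ hρ H hpde' hsurf htop hbot hstag hb0 hB1 hB2 hB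

end
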